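/- arXiv:dg-ga/9603005 — 10 statements merged into one kernel-verified Lean document; each statement's English description precedes it below -/
import Mathlib

section
/- Let A³ ⊆ ℝ³ be open and let f : A³ → ℂ be a real-analytic map which is horizontally weakly conformal and whose differential is nowhere zero (equivalently, f is a real-analytic horizontally conformal submersion). Then there exists an open set A⁴ ⊆ ℝ⁴ with A⁴ ∩ {x₀ = 0} = A³ and a real-analytic map φ : A⁴ → ℂ whose (real) differential has rank 2 at every point, such that φ restricted to A³ equals f, and such that φ is a hyperbolic harmonic morphism on A⁴ ∖ {x₀ = 0}, i.e. on A⁴ ∖ {x₀ = 0} it satisfies x₀·(∂²φ/∂x₀² + ∂²φ/∂x₁² + ∂²φ/∂x₂² + ∂²φ/∂x₃²) − 2 ∂φ/∂x₀ = 0 and (∂φ/∂x₀)² + (∂φ/∂x₁)² + (∂φ/∂x₂)² + (∂φ/∂x₃)² = 0. -/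
open Complex

/-- Partial derivative in the `i`-th coordinate direction of a map `ℝ³ → ℂ`. -/
noncomputable def pd3 (f : (Fin 3 → ℝ) → ℂ) (i : Fin 3) (x : Fin 3 → ℝ) : ℂ :=
  fderiv ℝ f x (Pi.single i 1)

/-- Partial derivative in the `i`-th coordinate direction of a map `ℝ⁴ → ℂ`. -/
noncomputable def pd4 (f : (Fin 4 → ℝ) → ℂ) (i : Fin 4) (x : Fin 4 → ℝ) : ℂ :=
  fderiv ℝ f x (Pi.single i 1)

/-- The identification of `ℝ³` with the hyperplane `{x₀ = 0}` of `ℝ⁴`. -/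
def incl3 (x : Fin 3 → ℝ) : Fin 4 → ℝ := Fin.cons 0 x

open Filter Topology
open scoped Matrix ContDiff

/-- The standard inclusion of real into complex vectors. -/
noncomputable def complexVec {ι : Type*} : (ι → ℝ) →L[ℝ] (ι → ℂ) :=
  ContinuousLinearMap.pi fun i => ofRealCLM.comp (ContinuousLinearMap.proj i)

@[simp] lemma complexVec_apply {ι : Type*} (x : ι → ℝ) (i : ι) : complexVec x i = (x i : ℂ) := rfl

section Complexification

variable {ι : Type*} [Fintype ι] [DecidableEq ι]

/-- The complex-multilinear extension of a real-multilinear map on `ℝ^ι`. -/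
noncomputable def ContinuousMultilinearMap.complexify {n : ℕ}
    (p : ContinuousMultilinearMap ℝ (fun _ : Fin n => ι → ℝ) ℂ) :
    ContinuousMultilinearMap ℂ (fun _ : Fin n => ι → ℂ) ℂ :=
  ∑ s : Fin n → ι, p (fun j => Pi.single (s j) 1) •
    (ContinuousMultilinearMap.mkPiAlgebra ℂ (Fin n) ℂ).compContinuousLinearMap
      fun j => ContinuousLinearMap.proj (s j)

lemma ContinuousMultilinearMap.complexify_apply {n : ℕ}
    (p : ContinuousMultilinearMap ℝ (fun _ : Fin n => ι → ℝ) ℂ) (z : Fin n → ι → ℂ) :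
    p.complexify z = ∑ s : Fin n → ι, p (fun j => Pi.single (s j) 1) * ∏ j, z j (s j) := by
  simp [complexify]

lemma ContinuousMultilinearMap.complexify_complexVec {n : ℕ}
    (p : ContinuousMultilinearMap ℝ (fun _ : Fin n => ι → ℝ) ℂ) (v : Fin n → ι → ℝ) :
    p.complexify (fun j => complexVec (v j)) = p v := by
  have hv : v = fun j => ∑ i, v j i • (Pi.single i 1 : ι → ℝ) := by
    funext j
    exact pi_eq_sum_univ' (v j)
  conv_rhs => rw [hv]
  rw [complexify_apply, p.map_sum]
  refine Finset.sum_congr rfl fun s _ => ?_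
  rw [p.map_smul_univ (fun j => v j (s j)) fun j => Pi.single (s j) 1]
  simp [mul_comm]

lemma ContinuousMultilinearMap.norm_complexify_le {n : ℕ}
    (p : ContinuousMultilinearMap ℝ (fun _ : Fin n => ι → ℝ) ℂ) :
    ‖p.complexify‖ ≤ Fintype.card ι ^ n * ‖p‖ := by
  refine ContinuousMultilinearMap.opNorm_le_bound (by positivity) fun z => ?_
  rw [complexify_apply]
  calc _ ≤ ∑ s : Fin n → ι, ‖p‖ * ∏ j, ‖z j‖ := by
        refine (norm_sum_le _ _).trans (Finset.sum_le_sum fun s _ => ?_)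
        rw [norm_mul, norm_prod]
        gcongr with j
        · refine (p.le_opNorm _).trans ?_
          have : ∀ j : Fin n, ‖(Pi.single (s j) 1 : ι → ℝ)‖ = 1 := fun j => by
            simp [Pi.norm_single]
          simp [this]
        · exact norm_le_pi_norm _ _
    _ = _ := by simp; ring

/-- A real-analytic germ on `ℝ^ι` extends to a holomorphic germ on `ℂ^ι`. -/
lemma AnalyticAt.exists_complexify {f : (ι → ℝ) → ℂ} {p : ι → ℝ} (hf : AnalyticAt ℝ f p) :
    ∃ F : (ι → ℂ) → ℂ, AnalyticAt ℂ F (complexVec p) ∧ ∀ᶠ x in 𝓝 p, F (complexVec x) = f x := by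
  obtain ⟨P, r, hP⟩ := hf
  let Q : FormalMultilinearSeries ℂ (ι → ℂ) ℂ := fun n => (P n).complexify
  have hQr : 0 < Q.radius := by
    obtain ⟨C, r', hC, hr', hb⟩ := P.le_mul_pow_of_radius_pos (hP.r_pos.trans_le hP.r_le)
    set k : ℝ := Fintype.card ι * r' + 1
    have hk : 0 < k := by positivity
    refine lt_of_lt_of_le ?_ (Q.le_radius_of_bound C (r := ⟨k⁻¹, by positivity⟩) fun n => ?_)
    · exact ENNReal.coe_pos.2 (inv_pos.2 hk)
    · have h1 : ‖Q n‖ ≤ Fintype.card ι ^ n * (C * r' ^ n) :=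
        (P n).norm_complexify_le.trans (by gcongr; exact hb n)
      calc ‖Q n‖ * k⁻¹ ^ n ≤ (Fintype.card ι ^ n * (C * r' ^ n)) * k⁻¹ ^ n := by gcongr
        _ = C * ((Fintype.card ι * r') / k) ^ n := by
          rw [div_eq_mul_inv, mul_pow, mul_pow]; ring
        _ ≤ C * 1 ^ n := by
          gcongr
          rw [div_le_one hk]
          simp [k]
        _ = C := by simp
  refine ⟨fun z => Q.sum (z - complexVec p), ?_, ?_⟩
  · have h := (Q.hasFPowerSeriesOnBall hQr).analyticAt
    have h2 : AnalyticAt ℂ (fun z : ι → ℂ => z - complexVec p) (complexVec p) := by fun_prop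
    exact AnalyticAt.fun_comp (by simpa using h) h2
  · filter_upwards [hP.hasFPowerSeriesAt.eventually_hasSum_sub] with x hx
    rw [← hx.tsum_eq, ← map_sub]
    exact tsum_congr fun n => (P n).complexify_complexVec fun _ => x - p

end Complexification

/-- A holomorphic germ on `ℂ^ι` vanishing at the real points vanishes. -/
lemma AnalyticAt.eventually_eq_zero_of_real {ι : Type*} [Fintype ι] {h : (ι → ℂ) → ℂ} {p : ι → ℝ}
    (hh : AnalyticAt ℂ h (complexVec p)) (h0 : ∀ᶠ x in 𝓝 p, h (complexVec x) = 0) :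
    ∀ᶠ z in 𝓝 (complexVec p), h z = 0 := by
  obtain ⟨r, hr, hrA⟩ := Metric.eventually_nhds_iff_ball.1 hh.eventually_analyticAt
  obtain ⟨r', hr', hr0⟩ := Metric.eventually_nhds_iff_ball.1 h0
  set s := min r r' / 4 with hs
  have hs0 : 0 < s := by positivity
  refine Metric.eventually_nhds_iff_ball.2 ⟨s, hs0, fun z hz => ?_⟩
  set x : ι → ℝ := fun i => (z i).re
  set v : ι → ℝ := fun i => (z i).im
  have hzx : z = complexVec x + I • complexVec v := by
    funext i
    simp [x, v, mul_comm I]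
  have hxp : ‖x - p‖ ≤ s := by
    rw [pi_norm_le_iff_of_nonneg hs0.le]
    intro i
    have : ‖(z - complexVec p) i‖ ≤ s :=
      (norm_le_pi_norm _ i).trans (by rw [← dist_eq_norm]; exact (Metric.mem_ball.1 hz).le)
    simpa [x] using (abs_re_le_norm _).trans this
  have hv : ‖v‖ ≤ s := by
    rw [pi_norm_le_iff_of_nonneg hs0.le]
    intro i
    have : ‖(z - complexVec p) i‖ ≤ s :=
      (norm_le_pi_norm _ i).trans (by rw [← dist_eq_norm]; exact (Metric.mem_ball.1 hz).le)
    simpa [v] using (abs_im_le_norm _).trans this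
  have hnorm : ∀ u : ι → ℝ, ‖complexVec u‖ ≤ ‖u‖ := fun u => by
    rw [pi_norm_le_iff_of_nonneg (norm_nonneg _)]
    intro i
    simpa using norm_le_pi_norm u i
  have hsr : 4 * s ≤ r := by rw [hs]; linarith [min_le_left r r']
  have hsr' : 4 * s ≤ r' := by rw [hs]; linarith [min_le_right r r']
  have hmem : ∀ t ∈ Metric.ball (0 : ℂ) 2,
      complexVec x + t • complexVec v ∈ Metric.ball (complexVec p) r := fun t ht => by
    rw [mem_ball_zero_iff] at ht
    rw [mem_ball_iff_norm]
    calc ‖complexVec x + t • complexVec v - complexVec p‖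
        = ‖complexVec (x - p) + t • complexVec v‖ := by rw [map_sub]; congr 1; abel
      _ ≤ ‖x - p‖ + ‖t‖ * ‖v‖ := (norm_add_le _ _).trans (by
          rw [norm_smul]; gcongr <;> exact hnorm _)
      _ ≤ s + 2 * s := by gcongr
      _ < r := by linarith
  have han : AnalyticOnNhd ℂ (fun t : ℂ => h (complexVec x + t • complexVec v))
      (Metric.ball 0 2) := fun t ht =>
    AnalyticAt.fun_comp (hrA _ (hmem t ht)) (by fun_prop)
  have hz0 : ∃ᶠ t in 𝓝[≠] (0 : ℂ), h (complexVec x + t • complexVec v) = 0 := by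
    have hT : Tendsto (fun t : ℝ => (t : ℂ)) (𝓝[≠] 0) (𝓝[≠] 0) := by
      refine tendsto_nhdsWithin_iff.2 ⟨?_, ?_⟩
      · exact (continuous_ofReal.tendsto' 0 0 (by simp)).mono_left nhdsWithin_le_nhds
      · filter_upwards [self_mem_nhdsWithin] with t ht
        simpa using ht
    refine hT.frequently (Eventually.frequently ?_)
    filter_upwards [nhdsWithin_le_nhds (Metric.ball_mem_nhds (0 : ℝ) one_pos)] with t ht
    have : complexVec x + (t : ℂ) • complexVec v = complexVec (x + t • v) := by
      funext i; simp
    rw [this]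
    refine hr0 _ ?_
    rw [mem_ball_zero_iff] at ht
    rw [mem_ball_iff_norm]
    calc ‖x + t • v - p‖ = ‖(x - p) + t • v‖ := by congr 1; abel
      _ ≤ ‖x - p‖ + ‖t‖ * ‖v‖ := (norm_add_le _ _).trans (by rw [norm_smul])
      _ ≤ s + 1 * s := by gcongr
      _ < r' := by linarith
  have := han.eqOn_zero_of_preconnected_of_frequently_eq_zero
    (convex_ball (0 : ℂ) 2).isPreconnected (Metric.mem_ball_self two_pos) hz0
    (show I ∈ Metric.ball (0 : ℂ) 2 by simp)
  rw [hzx]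
  exact this

/-- The complex gradient of a function on `ℂ³`. -/
noncomputable def cgrad (F : (Fin 3 → ℂ) → ℂ) (z : Fin 3 → ℂ) : Fin 3 → ℂ :=
  fun j => fderiv ℂ F z (Pi.single j 1)

lemma fderiv_eq_cgrad_dotProduct (F : (Fin 3 → ℂ) → ℂ) (z v : Fin 3 → ℂ) :
    fderiv ℂ F z v = cgrad F z ⬝ᵥ v := by
  conv_lhs => rw [pi_eq_sum_univ' v]
  simp [cgrad, dotProduct, mul_comm]

lemma AnalyticAt.cgrad {F : (Fin 3 → ℂ) → ℂ} {z : Fin 3 → ℂ} (hF : AnalyticAt ℂ F z) :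
    AnalyticAt ℂ (cgrad F) z :=
  .pi fun j =>
    ((ContinuousLinearMap.apply ℂ ℂ (Pi.single j 1)).analyticAt _).fun_comp hF.fderiv

/-- The gradient of a solution of the complex eikonal equation is constant in its own direction. -/
lemma fderiv_cgrad_cgrad_eq_zero {F : (Fin 3 → ℂ) → ℂ} {z : Fin 3 → ℂ} (hF : AnalyticAt ℂ F z)
    (hnull : ∀ᶠ w in 𝓝 z, cgrad F w ⬝ᵥ cgrad F w = 0) :
    fderiv ℂ (cgrad F) z (cgrad F z) = 0 := by
  have hsymm := hF.contDiffAt.isSymmSndFDerivAt_of_omega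
  have hg : ∀ v j, fderiv ℂ (cgrad F) z v j = fderiv ℂ (fderiv ℂ F) z v (Pi.single j 1) := by
    intro v j
    have h1 := hasFDerivAt_pi'.1 hF.cgrad.differentiableAt.hasFDerivAt j
    have h2 : HasFDerivAt (fun w => cgrad F w j) _ z :=
      hF.fderiv.differentiableAt.hasFDerivAt.clm_apply (hasFDerivAt_const (Pi.single j 1) z)
    simpa using congr($(h1.unique h2) v)
  have hgi : ∀ j, HasFDerivAt (fun w => cgrad F w j) _ z :=
    hasFDerivAt_pi'.1 hF.cgrad.differentiableAt.hasFDerivAt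
  funext j
  have h := (HasFDerivAt.fun_sum fun i (_ : i ∈ Finset.univ) => (hgi i).mul (hgi i)).unique
    ((hasFDerivAt_const (0 : ℂ) z).congr_of_eventuallyEq hnull)
  have h' := congr($h (Pi.single j 1))
  rw [hg, hsymm]
  have : cgrad F z = ∑ i, cgrad F z i • (Pi.single i 1 : Fin 3 → ℂ) := pi_eq_sum_univ' _
  rw [this, map_sum]
  simp [hg] at h'
  simp [Fin.sum_univ_three] at h' ⊢
  linear_combination h' / 2

/-- The direction field of the twistor planes scales under differentiation along the gradient. -/
lemma exists_fderiv_cgrad_eq_smul {F : (Fin 3 → ℂ) → ℂ} {M : (Fin 3 → ℂ) → Fin 3 → ℂ}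
    {z : Fin 3 → ℂ} (hF : AnalyticAt ℂ F z) (hM : DifferentiableAt ℂ M z)
    (hnull : ∀ᶠ w in 𝓝 z, cgrad F w ⬝ᵥ cgrad F w = 0)
    (hMn : ∀ᶠ w in 𝓝 z, M w ⨯₃ cgrad F w = -I • cgrad F w) (hn : cgrad F z ≠ 0) :
    ∃ c : ℂ, fderiv ℂ M z (cgrad F z) = c • cgrad F z := by
  have h0 := fderiv_cgrad_cgrad_eq_zero hF hnull
  have hgi : ∀ j, HasFDerivAt (fun w => cgrad F w j) _ z :=
    hasFDerivAt_pi'.1 hF.cgrad.differentiableAt.hasFDerivAt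
  have hMi : ∀ j, HasFDerivAt (fun w => M w j) _ z := hasFDerivAt_pi'.1 hM.hasFDerivAt
  set u := fderiv ℂ M z (cgrad F z) with hu
  set n := cgrad F z with hn'
  have key : ∀ j k l, (∀ A B : Fin 3 → ℂ, (A ⨯₃ B) l = A j * B k - A k * B j) →
      u j * n k = u k * n j := by
    intro j k l hl
    have h1 := ((hMi j).mul (hgi k)).sub ((hMi k).mul (hgi j))
    have h2 : HasFDerivAt (fun w => -I * cgrad F w l) _ z := (hgi l).const_mul (-I)
    have := h1.unique (h2.congr_of_eventuallyEq (by
      filter_upwards [hMn] with w hw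
      have := congr($hw l)
      rw [hl] at this
      simpa using this))
    have := congr($this n)
    simp [← hu, ← hn', h0] at this
    linear_combination this
  have h01 := key 0 1 2 fun A B => by simp [cross_apply]
  have h12 := key 1 2 0 fun A B => by simp [cross_apply]
  have h20 := key 2 0 1 fun A B => by simp [cross_apply]
  obtain ⟨i, hi⟩ := Function.ne_iff.1 hn
  refine ⟨u i / n i, ?_⟩
  have hi' : n i ≠ 0 := hi
  funext j
  have : u j * n i = u i * n j := by
    fin_cases i <;> fin_cases j <;> grind
  simp only [Pi.smul_apply, smul_eq_mul]
  field_simp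
  linear_combination this

/-- The spatial part of a point of `ℝ⁴`, as a complex vector. -/
noncomputable def spatialC : (Fin 4 → ℝ) →L[ℝ] (Fin 3 → ℂ) :=
  complexVec.comp (ContinuousLinearMap.pi fun j => ContinuousLinearMap.proj j.succ)

@[simp] lemma spatialC_apply (X : Fin 4 → ℝ) (j : Fin 3) : spatialC X j = (X j.succ : ℂ) := rfl

/-- Functions constant in the null direction `n` are, after composition with a solution `Y` of the
implicit equation `Y + i x₀ M(Y) = x`, constant along a null plane. -/
lemma fderiv_comp_twistor {M : (Fin 3 → ℂ) → Fin 3 → ℂ} {Y : (Fin 4 → ℝ) → Fin 3 → ℂ}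
    {X : Fin 4 → ℝ} {n : Fin 3 → ℂ} {c : ℂ} (hM : DifferentiableAt ℂ M (Y X))
    (hY : DifferentiableAt ℝ Y X)
    (hE : ∀ᶠ X' in 𝓝 X, Y X' + (I * (X' 0 : ℂ)) • M (Y X') = spatialC X')
    (hn : n ≠ 0) (hMn : fderiv ℂ M (Y X) n = c • n) (L : (Fin 3 → ℂ) →L[ℂ] ℂ) (hL : L n = 0) :
    L (fderiv ℝ Y X (Pi.single 0 1)) =
        -I * ∑ j, M (Y X) j * L (fderiv ℝ Y X (Pi.single j.succ 1)) ∧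
      ∑ j, n j * L (fderiv ℝ Y X (Pi.single j.succ 1)) = 0 := by
  set T : (Fin 3 → ℂ) →ₗ[ℂ] (Fin 3 → ℂ) :=
    LinearMap.id + (I * (X 0 : ℂ)) • (fderiv ℂ M (Y X)).toLinearMap with hT
  set D := fderiv ℝ Y X with hD
  have hTD : ∀ v : Fin 4 → ℝ, T (D v) = spatialC v - (I * (v 0 : ℂ)) • M (Y X) := by
    intro v
    have h0 : HasFDerivAt (fun X' : Fin 4 → ℝ => I * (X' 0 : ℂ))
        (I • (ofRealCLM.comp (ContinuousLinearMap.proj (R := ℝ) (φ := fun _ : Fin 4 => ℝ) 0))) X :=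
      ((ofRealCLM.comp (ContinuousLinearMap.proj (R := ℝ) (φ := fun _ : Fin 4 => ℝ) 0)).hasFDerivAt
        (x := X)).const_mul I
    have h1 : HasFDerivAt (fun X' => M (Y X')) _ X :=
      (hM.hasFDerivAt.restrictScalars ℝ).comp X hY.hasFDerivAt
    have h2 := (hY.hasFDerivAt.add (h0.smul h1)).unique
      (spatialC.hasFDerivAt.congr_of_eventuallyEq hE)
    have h3 := congr($h2 v)
    simp at h3
    rw [← h3]
    simp [hT, hD, ← add_assoc]
  have hTs : ∀ w : Fin 3 → ℂ, T (∑ j, w j • D (Pi.single j.succ 1)) = w := by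
    intro w
    have : ∀ j : Fin 3, T (D (Pi.single j.succ 1)) = Pi.single j 1 := by
      intro j
      rw [hTD]
      funext k
      by_cases h : k = j <;> simp [h]
    simp only [map_sum, map_smul, this]
    exact (pi_eq_sum_univ' w).symm
  have hTi : Function.Injective T :=
    LinearMap.injective_iff_surjective.2 fun w => ⟨_, hTs w⟩
  have hTn : T n = (1 + I * (X 0 : ℂ) * c) • n := by
    simp [hT, hMn, add_smul, smul_smul]
  constructor
  · have : D (Pi.single 0 1) = -I • ∑ j, M (Y X) j • D (Pi.single j.succ 1) := by
      apply hTi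
      rw [map_smul, hTs, hTD]
      funext k
      simp
    rw [this]
    simp [map_sum]
  · have h1 : (1 + I * (X 0 : ℂ) * c) • ∑ j, n j • D (Pi.single j.succ 1) = n := by
      apply hTi
      rw [map_smul, hTs, hTn]
    have h2 : (1 + I * (X 0 : ℂ) * c) ≠ 0 := by
      intro h
      rw [h, zero_smul] at h1
      exact hn h1.symm
    have h3 := congr(L $h1)
    rw [hL, map_smul, smul_eq_mul, mul_eq_zero, or_iff_right h2] at h3
    simpa [map_sum] using h3

/-- The stereographic parametrization of null vectors. -/
lemma null_vector_param {n : Fin 3 → ℂ} {k d μ : ℂ} (hk : k ^ 2 = -1) (hn : n ⬝ᵥ n = 0)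
    (hd : d = n 1 - k * n 2) (hd0 : d ≠ 0) (hμ : μ = k * n 0 / d) :
    n 0 = d / 2 * (-2 * k * μ) ∧ n 1 = d / 2 * (1 + μ ^ 2) ∧ n 2 = d / 2 * (k * (1 - μ ^ 2)) := by
  simp only [dotProduct, Fin.sum_univ_three] at hn
  have h0 : k * n 0 = μ * d := by rw [hμ]; field_simp
  refine ⟨by linear_combination -k * h0 + n 0 * hk, mul_left_cancel₀ hd0 ?_,
    mul_left_cancel₀ hd0 ?_⟩
  · linear_combination (k * n 0 + μ * d) / 2 * h0 + hn / 2 - (n 0 ^ 2 + n 2 ^ 2) / 2 * hk +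
      (n 1 - (d + (n 1 - k * n 2)) / 2) * hd
  · linear_combination -(k / 2) * (k * n 0 + μ * d) * h0 - k / 2 * hn +
      (n 1 * n 2 - k * n 2 ^ 2 / 2 + k * n 0 ^ 2 / 2) * hk +
      (n 2 - k * (d + (n 1 - k * n 2)) / 2) * hd

/-- The null vectors `n` and `e₀ + iM` span a null plane with affine parameter `μ`. -/
lemma twistor_plane {n M : Fin 3 → ℂ} {k d μ : ℂ} (hk : k ^ 2 = -1) (hn : n ⬝ᵥ n = 0)
    (hMn : M ⨯₃ n = -I • n) (hd : d = n 1 - k * n 2) (hd0 : d ≠ 0) (hμ : μ = k * n 0 / d)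
    {G : Fin 4 → ℂ} (h0 : G 0 = -I * ∑ j, M j * G j.succ) (h1 : ∑ j, n j * G j.succ = 0) :
    G 0 + k * G 1 = μ * (G 2 - k * G 3) ∧ G 2 + k * G 3 = -μ * (G 0 - k * G 1) := by
  obtain ⟨e0, e1, e2⟩ := null_vector_param hk hn hd hd0 hμ
  have c0 := congr($hMn 0)
  have c1 := congr($hMn 1)
  have c2 := congr($hMn 2)
  simp [cross_apply] at c0 c1 c2
  simp [Fin.sum_univ_three] at h0 h1
  have hμd : μ * d = k * n 0 := by rw [hμ]; field_simp
  have Z1 : G 0 + k * G 1 = μ * (G 2 - k * G 3) := by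
    apply mul_left_cancel₀ hd0
    linear_combination d * h0 - I * (M 1 - k * M 2) * h1 -
      I * (G 1 * (c2 + k * c1) - k * G 2 * c0 - G 3 * c0) - (G 2 - k * G 3) * hμd +
      (k * G 1 - I * (M 0 * G 1 + M 1 * G 2 + M 2 * G 3)) * hd +
      (G 1 * (k * n 1 + n 2) - G 2 * k * n 0 - G 3 * n 0) * I_sq +
      (G 3 * n 0 - G 1 * n 2) * hk
  refine ⟨Z1, mul_left_cancel₀ (div_ne_zero hd0 two_ne_zero) ?_⟩
  rw [e0, e1, e2] at h1
  linear_combination h1 + d / 2 * μ * Z1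

lemma pd4_congr {φ ψ : (Fin 4 → ℝ) → ℂ} {X : Fin 4 → ℝ} (h : φ =ᶠ[𝓝 X] ψ) (a : Fin 4) :
    pd4 φ a =ᶠ[𝓝 X] pd4 ψ a :=
  h.fderiv.fun_comp fun L => L (Pi.single a 1)

lemma AnalyticAt.pd4 {φ : (Fin 4 → ℝ) → ℂ} {X : Fin 4 → ℝ} (hφ : AnalyticAt ℝ φ X) (a : Fin 4) :
    AnalyticAt ℝ (pd4 φ a) X :=
  ((ContinuousLinearMap.apply ℝ ℂ (Pi.single a 1)).analyticAt _).fun_comp hφ.fderiv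

lemma AnalyticAt.pd4_comm {φ : (Fin 4 → ℝ) → ℂ} {X : Fin 4 → ℝ} (hφ : AnalyticAt ℝ φ X)
    (a b : Fin 4) : _root_.pd4 (_root_.pd4 φ a) b X = _root_.pd4 (_root_.pd4 φ b) a X := by
  have h : ∀ a b : Fin 4, _root_.pd4 (_root_.pd4 φ a) b X =
      fderiv ℝ (fderiv ℝ φ) X (Pi.single b 1) (Pi.single a 1) := by
    intro a b
    have h2 : HasFDerivAt (_root_.pd4 φ a) _ X :=
      hφ.fderiv.differentiableAt.hasFDerivAt.clm_apply
        (hasFDerivAt_const (Pi.single a (1 : ℝ) : Fin 4 → ℝ) X)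
    have := congr($(h2.fderiv) (Pi.single b 1))
    simp at this
    exact this
  rw [h, h, hφ.contDiffAt.isSymmSndFDerivAt_of_omega]

/-- Functions with null gradient along the twistor planes of slope `μ` and satisfying the contact
relation solve the harmonic morphism equations. -/
lemma hyperbolic_of_twistor {φ μ : (Fin 4 → ℝ) → ℂ} {X : Fin 4 → ℝ} {k d : ℂ} (hk : k ^ 2 = -1)
    (hφ : AnalyticAt ℝ φ X) (hμ : AnalyticAt ℝ μ X)
    (Z1 : ∀ᶠ X' in 𝓝 X, pd4 φ 0 X' + k * pd4 φ 1 X' = μ X' * (pd4 φ 2 X' - k * pd4 φ 3 X'))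
    (Z2 : ∀ᶠ X' in 𝓝 X, pd4 φ 2 X' + k * pd4 φ 3 X' = -μ X' * (pd4 φ 0 X' - k * pd4 φ 1 X'))
    (hZ : pd4 μ 0 X + k * pd4 μ 1 X = μ X * (pd4 μ 2 X - k * pd4 μ 3 X))
    (h0 : pd4 φ 0 X = d / 2 * (2 * X 0 * pd4 μ 0 X))
    (h1 : pd4 φ 1 X = d / 2 * (-2 * k * μ X + 2 * X 0 * pd4 μ 1 X))
    (h2 : pd4 φ 2 X = d / 2 * (1 + μ X ^ 2 + 2 * X 0 * pd4 μ 2 X))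
    (h3 : pd4 φ 3 X = d / 2 * (k * (1 - μ X ^ 2) + 2 * X 0 * pd4 μ 3 X)) :
    (X 0 : ℂ) * (pd4 (pd4 φ 0) 0 X + pd4 (pd4 φ 1) 1 X + pd4 (pd4 φ 2) 2 X +
        pd4 (pd4 φ 3) 3 X) - 2 * pd4 φ 0 X = 0 ∧
      pd4 φ 0 X ^ 2 + pd4 φ 1 X ^ 2 + pd4 φ 2 X ^ 2 + pd4 φ 3 X ^ 2 = 0 := by
  have hd : ∀ a, HasFDerivAt (pd4 φ a) _ X := fun a => (hφ.pd4 a).differentiableAt.hasFDerivAt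
  have hμd := hμ.differentiableAt.hasFDerivAt
  have e1 : ∀ b, pd4 (pd4 φ 0) b X + k * pd4 (pd4 φ 1) b X =
      μ X * (pd4 (pd4 φ 2) b X - k * pd4 (pd4 φ 3) b X) +
        (pd4 φ 2 X - k * pd4 φ 3 X) * pd4 μ b X := fun b => by
    have := ((hd 0).add ((hd 1).const_mul k)).unique
      ((hμd.mul ((hd 2).sub ((hd 3).const_mul k))).congr_of_eventuallyEq Z1)
    have := congr($this (Pi.single b 1))
    simp at this
    exact this
  have e2 : ∀ b, pd4 (pd4 φ 2) b X + k * pd4 (pd4 φ 3) b X =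
      -(μ X * (pd4 (pd4 φ 0) b X - k * pd4 (pd4 φ 1) b X)) -
        (pd4 φ 0 X - k * pd4 φ 1 X) * pd4 μ b X := fun b => by
    have := ((hd 2).add ((hd 3).const_mul k)).unique
      ((hμd.neg.mul ((hd 0).sub ((hd 1).const_mul k))).congr_of_eventuallyEq Z2)
    have := congr($this (Pi.single b 1))
    simp at this
    simp only [pd4] at this ⊢
    linear_combination this
  have s := hφ.pd4_comm
  constructor
  · have hΔ : pd4 (pd4 φ 0) 0 X + pd4 (pd4 φ 1) 1 X + pd4 (pd4 φ 2) 2 X + pd4 (pd4 φ 3) 3 X =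
        (pd4 μ 0 X - k * pd4 μ 1 X) * (pd4 φ 2 X - k * pd4 φ 3 X) -
          (pd4 μ 2 X - k * pd4 μ 3 X) * (pd4 φ 0 X - k * pd4 φ 1 X) := by
      linear_combination e1 0 - k * e1 1 + e2 2 - k * e2 3 +
        (pd4 (pd4 φ 1) 1 X + pd4 (pd4 φ 3) 3 X) * hk + k * s 0 1 + k * s 2 3 +
        μ X * (s 2 0 - k * s 3 0 - k * s 2 1 + k ^ 2 * s 3 1)
    have h23 : pd4 φ 2 X - k * pd4 φ 3 X = d * (1 + X 0 * (pd4 μ 2 X - k * pd4 μ 3 X)) := by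
      rw [h2, h3]; linear_combination -d / 2 * (1 - μ X ^ 2) * hk
    have h01 : pd4 φ 0 X - k * pd4 φ 1 X = d * (X 0 * (pd4 μ 0 X - k * pd4 μ 1 X) - μ X) := by
      rw [h0, h1]; linear_combination d * μ X * hk
    rw [hΔ, h23, h01, h0]
    linear_combination -d * X 0 * hZ
  · linear_combination (pd4 φ 0 X - k * pd4 φ 1 X) * Z1.self_of_nhds +
      (pd4 φ 2 X - k * pd4 φ 3 X) * Z2.self_of_nhds + (pd4 φ 1 X ^ 2 + pd4 φ 3 X ^ 2) * hk

lemma pd4_comp {g : (Fin 3 → ℂ) → ℂ} {Y : (Fin 4 → ℝ) → Fin 3 → ℂ} {X : Fin 4 → ℝ}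
    (hg : DifferentiableAt ℂ g (Y X)) (hY : DifferentiableAt ℝ Y X) (a : Fin 4) :
    pd4 (fun X => g (Y X)) a X = fderiv ℂ g (Y X) (fderiv ℝ Y X (Pi.single a 1)) := by
  have h : HasFDerivAt (fun X => g (Y X)) _ X :=
    (hg.hasFDerivAt.restrictScalars ℝ).comp X hY.hasFDerivAt
  rw [pd4, h.fderiv]
  rfl

/-- Data `F`, `M` on `ℂ³` and a solution `Y` of the implicit twistor equation near `X`. -/
structure IsTwistorSolution (F : (Fin 3 → ℂ) → ℂ) (M : (Fin 3 → ℂ) → Fin 3 → ℂ)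
    (Y : (Fin 4 → ℝ) → Fin 3 → ℂ) (X : Fin 4 → ℝ) : Prop where
  analyticAt_F : AnalyticAt ℂ F (Y X)
  analyticAt_M : AnalyticAt ℂ M (Y X)
  analyticAt_Y : AnalyticAt ℝ Y X
  null : ∀ᶠ z in 𝓝 (Y X), cgrad F z ⬝ᵥ cgrad F z = 0
  cross : ∀ᶠ z in 𝓝 (Y X), M z ⨯₃ cgrad F z = -I • cgrad F z
  cgrad_ne_zero : cgrad F (Y X) ≠ 0
  implicit : ∀ᶠ X' in 𝓝 X, Y X' + (I * (X' 0 : ℂ)) • M (Y X') = spatialC X'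

namespace IsTwistorSolution

variable {F : (Fin 3 → ℂ) → ℂ} {M : (Fin 3 → ℂ) → Fin 3 → ℂ} {Y : (Fin 4 → ℝ) → Fin 3 → ℂ}
  {X : Fin 4 → ℝ}

lemma eventually (h : IsTwistorSolution F M Y X) : ∀ᶠ X' in 𝓝 X, IsTwistorSolution F M Y X' := by
  have hc := h.analyticAt_Y.continuousAt
  filter_upwards [hc.eventually h.analyticAt_F.eventually_analyticAt,
    hc.eventually h.analyticAt_M.eventually_analyticAt, h.analyticAt_Y.eventually_analyticAt,
    hc.eventually h.null.eventually_nhds, hc.eventually h.cross.eventually_nhds,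
    hc.eventually (h.analyticAt_F.cgrad.continuousAt.eventually_ne h.cgrad_ne_zero),
    h.implicit.eventually_nhds] with X' h1 h2 h3 h4 h5 h6 h7
  exact ⟨h1, h2, h3, h4, h5, h6, h7⟩

lemma analyticAt (h : IsTwistorSolution F M Y X) : AnalyticAt ℝ (fun X => F (Y X)) X :=
  (h.analyticAt_F.restrictScalars (𝕜 := ℝ)).fun_comp h.analyticAt_Y

lemma twistor_identities (h : IsTwistorSolution F M Y X) {g : (Fin 3 → ℂ) → ℂ} {k : ℂ}
    (hk : k ^ 2 = -1) (hd : cgrad F (Y X) 1 - k * cgrad F (Y X) 2 ≠ 0)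
    (hg : DifferentiableAt ℂ g (Y X)) (hgn : fderiv ℂ g (Y X) (cgrad F (Y X)) = 0)
    {μ : ℂ} (hμ : μ = k * cgrad F (Y X) 0 / (cgrad F (Y X) 1 - k * cgrad F (Y X) 2))
    {ψ : (Fin 4 → ℝ) → ℂ} (hψ : ψ = fun X => g (Y X)) :
    pd4 ψ 0 X + k * pd4 ψ 1 X = μ * (pd4 ψ 2 X - k * pd4 ψ 3 X) ∧
      pd4 ψ 2 X + k * pd4 ψ 3 X = -μ * (pd4 ψ 0 X - k * pd4 ψ 1 X) := by
  obtain ⟨c, hc⟩ := exists_fderiv_cgrad_eq_smul h.analyticAt_F h.analyticAt_M.differentiableAt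
    h.null h.cross h.cgrad_ne_zero
  obtain ⟨h0, h1⟩ := fderiv_comp_twistor h.analyticAt_M.differentiableAt
    h.analyticAt_Y.differentiableAt h.implicit h.cgrad_ne_zero hc _ hgn
  simp only [← pd4_comp hg h.analyticAt_Y.differentiableAt, ← hψ] at h0 h1
  exact twistor_plane hk h.null.self_of_nhds h.cross.self_of_nhds rfl hd hμ
    (G := fun a => pd4 ψ a X) h0 h1

lemma exists_slope (h : IsTwistorSolution F M Y X) :
    ∃ k : ℂ, k ^ 2 = -1 ∧ cgrad F (Y X) 1 - k * cgrad F (Y X) 2 ≠ 0 := by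
  by_contra! H
  have h1 := H I I_sq
  have h2 := H (-I) (by simp)
  have hn := h.null.self_of_nhds
  simp only [dotProduct, Fin.sum_univ_three] at hn
  have e1 : cgrad F (Y X) 1 = 0 := by linear_combination (h1 + h2) / 2
  have e2 : cgrad F (Y X) 2 = 0 := by
    linear_combination I / 2 * (h1 - h2) + cgrad F (Y X) 2 * I_sq
  have e0 : cgrad F (Y X) 0 = 0 := by simpa [e1, e2] using hn
  refine h.cgrad_ne_zero (funext fun j => ?_)
  fin_cases j <;> assumption

/-- Differentiating the equation of the twistor plane through a point. -/
lemma contact (h : IsTwistorSolution F M Y X) {k : ℂ} (hk : k ^ 2 = -1) {d : ℂ}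
    (hd : d = cgrad F (Y X) 1 - k * cgrad F (Y X) 2) (hd0 : d ≠ 0) {μ : (Fin 4 → ℝ) → ℂ}
    (hμ : μ = fun X =>
      k * cgrad F (Y X) 0 / (cgrad F (Y X) 1 - k * cgrad F (Y X) 2))
    (hμd : DifferentiableAt ℝ μ X) (v : Fin 4 → ℝ) :
    fderiv ℂ F (Y X) (fderiv ℝ Y X v) = d / 2 * (-2 * k * μ X * v 1 + (1 + μ X ^ 2) * v 2 +
      k * (1 - μ X ^ 2) * v 3 + 2 * X 0 * fderiv ℝ μ X v) := by
  have hYd := h.analyticAt_Y.differentiableAt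
  have hplane : ∀ᶠ X' in 𝓝 X, (-2 * k) * μ X' * (Y X' 0 - spatialC X' 0) +
      (1 + μ X' ^ 2) * (Y X' 1 - spatialC X' 1) +
      k * (1 - μ X' ^ 2) * (Y X' 2 - spatialC X' 2) = 0 := by
    have hne : ∀ᶠ X' in 𝓝 X, cgrad F (Y X') 1 - k * cgrad F (Y X') 2 ≠ 0 := by
      have hc := (h.analyticAt_F.cgrad.continuousAt.comp h.analyticAt_Y.continuousAt)
      have hc' : ContinuousAt (fun X' => cgrad F (Y X') 1 - k * cgrad F (Y X') 2) X :=
        (continuousAt_pi.1 hc 1).sub (continuousAt_const.mul (continuousAt_pi.1 hc 2))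
      exact hc'.eventually_ne (hd ▸ hd0)
    filter_upwards [h.eventually, hne] with X' hX' hd'
    obtain ⟨e0, e1, e2⟩ := null_vector_param hk hX'.null.self_of_nhds rfl hd' (congrFun hμ X')
    have hM := congr(M (Y X') ⬝ᵥ $(hX'.cross.self_of_nhds))
    rw [dot_self_cross, dotProduct_smul, smul_eq_mul, eq_comm, mul_eq_zero,
      or_iff_right (by simp)] at hM
    simp only [dotProduct, Fin.sum_univ_three] at hM
    rw [← hX'.implicit.self_of_nhds]
    apply mul_left_cancel₀ (div_ne_zero hd' two_ne_zero)
    simp only [Pi.add_apply, Pi.smul_apply, smul_eq_mul]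
    linear_combination -(I * X' 0) * hM + (I * X' 0) *
      (M (Y X') 0 * e0 + M (Y X') 1 * e1 + M (Y X') 2 * e2)
  have hY : ∀ j, HasFDerivAt (fun X' => Y X' j - spatialC X' j) _ X := fun j =>
    (hasFDerivAt_pi'.1 hYd.hasFDerivAt j).sub (hasFDerivAt_pi'.1 spatialC.hasFDerivAt j)
  have hμ' := hμd.hasFDerivAt
  have hD := ((((hμ'.const_mul (-2 * k)).mul (hY 0)).add
    (((hμ'.pow 2).const_add 1).mul (hY 1))).add
    ((((hμ'.pow 2).const_sub 1).const_mul k).mul (hY 2))).unique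
    ((hasFDerivAt_const (0 : ℂ) X).congr_of_eventuallyEq hplane)
  have hDv := congr($hD v)
  have hXY : ∀ j, Y X j - X j.succ = -(I * X 0 * M (Y X) j) := fun j => by
    have := congr($(h.implicit.self_of_nhds) j)
    simp at this
    linear_combination this
  simp at hDv
  have hμX : μ X = k * cgrad F (Y X) 0 / d := by rw [hμ, hd]
  obtain ⟨e0, e1, e2⟩ := null_vector_param hk h.null.self_of_nhds hd hd0 hμX
  have c1 := congr($(h.cross.self_of_nhds) 1)
  have c2 := congr($(h.cross.self_of_nhds) 2)
  simp [cross_apply] at c1 c2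
  rw [fderiv_eq_cgrad_dotProduct]
  simp only [dotProduct, Fin.sum_univ_three]
  have hμd' : μ X * d = k * cgrad F (Y X) 0 := by rw [hμX]; field_simp
  have hK : -k * M (Y X) 0 + μ X * (M (Y X) 1 - k * M (Y X) 2) = -I := by
    apply mul_left_cancel₀ hd0
    linear_combination (M (Y X) 1 - k * M (Y X) 2) * hμd' + (-k * M (Y X) 0 + I) * hd -
      k * c2 - k ^ 2 * c1 + I * cgrad F (Y X) 1 * hk
  have x1 : Y X 0 - X 1 = _ := hXY 0
  have x2 : Y X 1 - X 2 = _ := hXY 1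
  have x3 : Y X 2 - X 3 = _ := hXY 2
  linear_combination e0 * fderiv ℝ Y X v 0 + e1 * fderiv ℝ Y X v 1 + e2 * fderiv ℝ Y X v 2 +
    d / 2 * hDv - d * fderiv ℝ μ X v * (-k * x1 + μ X * x2 - k * μ X * x3 -
      I * X 0 * hK + X 0 * I_sq)

/-- A twistor solution induces a hyperbolic harmonic morphism. -/
lemma hyperbolic (h : IsTwistorSolution F M Y X) {φ : (Fin 4 → ℝ) → ℂ}
    (hφ : φ = fun X => F (Y X)) :
    (X 0 : ℂ) * (pd4 (pd4 φ 0) 0 X + pd4 (pd4 φ 1) 1 X + pd4 (pd4 φ 2) 2 X +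
        pd4 (pd4 φ 3) 3 X) - 2 * pd4 φ 0 X = 0 ∧
      pd4 φ 0 X ^ 2 + pd4 φ 1 X ^ 2 + pd4 φ 2 X ^ 2 + pd4 φ 3 X ^ 2 = 0 := by
  obtain ⟨k, hk, hd0⟩ := h.exists_slope
  set ν : (Fin 3 → ℂ) → ℂ := fun z => k * cgrad F z 0 / (cgrad F z 1 - k * cgrad F z 2)
  have hg : ∀ j, AnalyticAt ℂ (fun z => cgrad F z j) (Y X) :=
    analyticAt_pi_iff.1 h.analyticAt_F.cgrad
  have hνan : AnalyticAt ℂ ν (Y X) :=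
    (analyticAt_const.mul (hg 0)).div ((hg 1).sub (analyticAt_const.mul (hg 2))) hd0
  have hνY : AnalyticAt ℝ (fun X => ν (Y X)) X :=
    (hνan.restrictScalars (𝕜 := ℝ)).fun_comp h.analyticAt_Y
  have hνn : fderiv ℂ ν (Y X) (cgrad F (Y X)) = 0 := by
    have h0 := fderiv_cgrad_cgrad_eq_zero h.analyticAt_F h.null
    have hgi : ∀ j, HasFDerivAt (fun w => cgrad F w j) _ (Y X) :=
      hasFDerivAt_pi'.1 h.analyticAt_F.cgrad.differentiableAt.hasFDerivAt
    have hνd : ∀ᶠ z in 𝓝 (Y X), ν z * (cgrad F z 1 - k * cgrad F z 2) = k * cgrad F z 0 := by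
      filter_upwards [((hg 1).sub (analyticAt_const.mul (hg 2))).continuousAt.eventually_ne hd0]
        with z hz using div_mul_cancel₀ _ hz
    have := (hνan.differentiableAt.hasFDerivAt.mul ((hgi 1).sub ((hgi 2).const_mul k))).unique
      (((hgi 0).const_mul k).congr_of_eventuallyEq hνd)
    have := congr($this (cgrad F (Y X)))
    simpa [h0, hd0] using this
  have hne : ∀ᶠ X' in 𝓝 X, cgrad F (Y X') 1 - k * cgrad F (Y X') 2 ≠ 0 :=
    (((hg 1).sub (analyticAt_const.mul (hg 2))).continuousAt.comp
      h.analyticAt_Y.continuousAt).eventually_ne hd0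
  have hZ : ∀ᶠ X' in 𝓝 X,
      pd4 φ 0 X' + k * pd4 φ 1 X' = ν (Y X') * (pd4 φ 2 X' - k * pd4 φ 3 X') ∧
      pd4 φ 2 X' + k * pd4 φ 3 X' = -ν (Y X') * (pd4 φ 0 X' - k * pd4 φ 1 X') := by
    filter_upwards [h.eventually, hne] with X' h' hd'
    refine h'.twistor_identities hk hd' h'.analyticAt_F.differentiableAt ?_ rfl hφ
    rw [fderiv_eq_cgrad_dotProduct]
    exact h'.null.self_of_nhds
  have hc := h.contact hk rfl hd0 (μ := fun X => ν (Y X)) rfl hνY.differentiableAt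
  have hc' : ∀ a : Fin 4, pd4 φ a X = fderiv ℂ F (Y X) (fderiv ℝ Y X (Pi.single a 1)) := fun a => by
    rw [hφ, pd4_comp h.analyticAt_F.differentiableAt h.analyticAt_Y.differentiableAt]
  simp only [hc] at hc'
  refine hyperbolic_of_twistor hk (d := cgrad F (Y X) 1 - k * cgrad F (Y X) 2)
    (hφ ▸ h.analyticAt) hνY (hZ.mono fun _ h => h.1) (hZ.mono fun _ h => h.2)
    (h.twistor_identities hk hd0 hνan.differentiableAt hνn rfl rfl).1
    ((hc' 0).trans ?_) ((hc' 1).trans ?_) ((hc' 2).trans ?_) ((hc' 3).trans ?_) <;> simp [pd4]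

end IsTwistorSolution

/-- The implicit twistor equation has an analytic solution near each point of `{x₀ = 0}`. -/
lemma exists_implicit_solution {M : (Fin 3 → ℂ) → Fin 3 → ℂ} {p : Fin 3 → ℝ}
    (hM : AnalyticAt ℂ M (complexVec p)) :
    ∃ Y : (Fin 4 → ℝ) → Fin 3 → ℂ, AnalyticAt ℝ Y (incl3 p) ∧ Y (incl3 p) = complexVec p ∧
      ∀ᶠ X in 𝓝 (incl3 p), Y X + (I * (X 0 : ℂ)) • M (Y X) = spatialC X := by
  have hMr : AnalyticAt ℝ M (complexVec p) := hM.restrictScalars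
  let τ : (Fin 4 → ℝ) →L[ℝ] ℂ :=
    I • ofRealCLM.comp (ContinuousLinearMap.proj (R := ℝ) (φ := fun _ : Fin 4 => ℝ) 0)
  have hτ : ∀ X, τ X = I * (X 0 : ℂ) := fun X => rfl
  have hτp : τ (incl3 p) = 0 := by simp [hτ, incl3]
  let Ξ : (Fin 4 → ℝ) × (Fin 3 → ℂ) → (Fin 4 → ℝ) × (Fin 3 → ℂ) :=
    fun w => (w.1, w.2 + τ w.1 • M w.2)
  set a : (Fin 4 → ℝ) × (Fin 3 → ℂ) := (incl3 p, complexVec p)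
  let e : ((Fin 4 → ℝ) × (Fin 3 → ℂ)) ≃L[ℝ] ((Fin 4 → ℝ) × (Fin 3 → ℂ)) :=
    (ContinuousLinearEquiv.refl ℝ _).skewProd (ContinuousLinearEquiv.refl ℝ _)
      (τ.smulRight (M (complexVec p)))
  have hM2 : AnalyticAt ℝ (fun w : (Fin 4 → ℝ) × (Fin 3 → ℂ) => M w.2) a :=
    AnalyticAt.fun_comp (g := M) (f := Prod.snd) hMr analyticAt_snd
  have hτ1 : AnalyticAt ℝ (fun w : (Fin 4 → ℝ) × (Fin 3 → ℂ) => τ w.1) a :=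
    (τ.analyticAt _).fun_comp analyticAt_fst
  have hΞ : AnalyticAt ℝ Ξ a := analyticAt_fst.prod (analyticAt_snd.add (hτ1.smul hM2))
  have hΞ' : HasFDerivAt Ξ (e : ((Fin 4 → ℝ) × (Fin 3 → ℂ)) →L[ℝ] _) a := by
    have h1 : HasFDerivAt (fun w : (Fin 4 → ℝ) × (Fin 3 → ℂ) => τ w.1) _ a :=
      τ.hasFDerivAt.comp a hasFDerivAt_fst
    have h := (hasFDerivAt_fst (𝕜 := ℝ) (p := a)).prodMk ((hasFDerivAt_snd (𝕜 := ℝ) (p := a)).add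
      (h1.smul hM2.differentiableAt.hasFDerivAt))
    refine h.congr_fderiv ?_
    ext v <;> simp [e, hτp, a]
  have hC : ContDiffAt ℝ ω Ξ a := hΞ.contDiffAt
  have hω : (ω : WithTop ℕ∞) ≠ 0 := by simp
  have hΞa : Ξ a = (incl3 p, complexVec p) := by simp [Ξ, a, hτp]
  have hs : spatialC (incl3 p) = complexVec p := by
    funext j; simp [incl3]
  set g := hC.localInverse hΞ' hω
  have hι : AnalyticAt ℝ (fun X : Fin 4 → ℝ => (X, spatialC X)) (incl3 p) :=
    analyticAt_id.prod (spatialC.analyticAt _)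
  have hg : AnalyticAt ℝ g (Ξ a) := (hC.to_localInverse hΞ' hω).analyticAt
  rw [hΞa, ← hs] at hg
  refine ⟨fun X => (g (X, spatialC X)).2, ?_, ?_, ?_⟩
  · exact analyticAt_snd.fun_comp (AnalyticAt.fun_comp (g := g) hg hι)
  · change (g (incl3 p, spatialC (incl3 p))).2 = _
    rw [hs, ← hΞa, show g (Ξ a) = a from hC.localInverse_apply_image hΞ' hω]
  · have hr : ∀ᶠ w in 𝓝 (Ξ a), Ξ (g w) = w :=
      (hC.hasStrictFDerivAt' hΞ' hω).eventually_right_inverse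
    rw [hΞa, ← hs] at hr
    filter_upwards [hι.continuousAt.eventually hr] with X hX
    have h1 : (g (X, spatialC X)).1 = X := congr($hX.1)
    have h2 := congr($hX.2)
    simpa [Ξ, h1, hτ] using h2

/-- The gradient of a complex-valued function on `ℝ³`. -/
noncomputable def grad3 (f : (Fin 3 → ℝ) → ℂ) (x : Fin 3 → ℝ) : Fin 3 → ℂ := fun j => pd3 f j x

/-- The oriented real unit normal to the real and imaginary parts of the gradient, up to sign. -/
noncomputable def axisField (f : (Fin 3 → ℝ) → ℂ) (x : Fin 3 → ℝ) : Fin 3 → ℂ :=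
  (-I / (grad3 f x ⬝ᵥ star (grad3 f x))) • (star (grad3 f x) ⨯₃ grad3 f x)

lemma axisField_cross {f : (Fin 3 → ℝ) → ℂ} {x : Fin 3 → ℝ} (h : grad3 f x ⬝ᵥ grad3 f x = 0)
    (h0 : grad3 f x ≠ 0) : axisField f x ⨯₃ grad3 f x = -I • grad3 f x := by
  have h1 : grad3 f x ⬝ᵥ star (grad3 f x) ≠ 0 := by
    open scoped ComplexOrder in simpa [dotProduct_star_self_eq_zero] using h0
  rw [axisField, map_smul, LinearMap.smul_apply, cross_cross_eq_smul_sub_smul, h,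
    dotProduct_comm (star (grad3 f x))]
  simp [smul_smul, h1]

lemma AnalyticAt.grad3 {f : (Fin 3 → ℝ) → ℂ} {x : Fin 3 → ℝ} (hf : AnalyticAt ℝ f x) :
    AnalyticAt ℝ (grad3 f) x :=
  .pi fun j =>
    ((ContinuousLinearMap.apply ℝ ℂ (Pi.single j 1)).analyticAt _).fun_comp hf.fderiv

lemma AnalyticAt.axisField {f : (Fin 3 → ℝ) → ℂ} {x : Fin 3 → ℝ} (hf : AnalyticAt ℝ f x)
    (h0 : _root_.grad3 f x ≠ 0) : AnalyticAt ℝ (axisField f) x := by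
  have hg : ∀ j, AnalyticAt ℝ (fun x => _root_.grad3 f x j) x := analyticAt_pi_iff.1 hf.grad3
  have hs : ∀ j, AnalyticAt ℝ (fun x => star (_root_.grad3 f x j)) x := fun j =>
    (conjCLE.toContinuousLinearMap.analyticAt _).fun_comp (hg j)
  have hN : AnalyticAt ℝ (fun x => _root_.grad3 f x ⬝ᵥ star (_root_.grad3 f x)) x :=
    Finset.analyticAt_fun_sum _ fun j _ => (hg j).mul (hs j)
  have h1 : _root_.grad3 f x ⬝ᵥ star (_root_.grad3 f x) ≠ 0 := by
    open scoped ComplexOrder in simpa [dotProduct_star_self_eq_zero] using h0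
  refine (analyticAt_const.div hN h1).smul (.pi fun j => ?_)
  fin_cases j <;> simp only [cross_apply] <;>
    exact ((hs _).mul (hg _)).sub ((hs _).mul (hg _))

/-- A holomorphic extension has the complexified gradient. -/
lemma cgrad_complexVec {F : (Fin 3 → ℂ) → ℂ} {f : (Fin 3 → ℝ) → ℂ} {x : Fin 3 → ℝ}
    (hF : DifferentiableAt ℂ F (complexVec x)) (h : ∀ᶠ y in 𝓝 x, F (complexVec y) = f y) :
    cgrad F (complexVec x) = grad3 f x := by
  have h1 := ((hF.hasFDerivAt.restrictScalars ℝ).comp x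
    (complexVec (ι := Fin 3)).hasFDerivAt).congr_of_eventuallyEq
    (EventuallyEq.symm h : f =ᶠ[𝓝 x] F ∘ complexVec)
  funext j
  have : complexVec (Pi.single j 1 : Fin 3 → ℝ) = Pi.single j 1 := by
    funext i
    by_cases hij : i = j <;> simp [hij]
  simp only [grad3, pd3]
  rw [h1.fderiv]
  simp [cgrad, this]

/-- `φ` is, near the real point `q` of `{x₀ = 0}`, the twistorial extension of `f`. -/
def IsTwistorGerm (f : (Fin 3 → ℝ) → ℂ) (φ : (Fin 4 → ℝ) → ℂ) (q : Fin 3 → ℝ) : Prop :=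
  ∃ F M Y, IsTwistorSolution F M Y (incl3 q) ∧ Y (incl3 q) = complexVec q ∧
    (∀ᶠ x in 𝓝 q, F (complexVec x) = f x) ∧ (∀ᶠ x in 𝓝 q, M (complexVec x) = axisField f x) ∧
    φ =ᶠ[𝓝 (incl3 q)] fun X => F (Y X)

/-- The inclusion `incl3` as a continuous linear map. -/
noncomputable def incl3L : (Fin 3 → ℝ) →L[ℝ] (Fin 4 → ℝ) :=
  ContinuousLinearMap.pi (Fin.cons 0 fun j => ContinuousLinearMap.proj j)

lemma coe_incl3L : ⇑incl3L = incl3 := by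
  funext x i
  refine Fin.cases ?_ (fun j => ?_) i <;> simp [incl3L, incl3]

lemma continuous_incl3 : Continuous incl3 := coe_incl3L ▸ incl3L.continuous

lemma exists_isTwistorGerm {f : (Fin 3 → ℝ) → ℂ} {p : Fin 3 → ℝ} (hf : AnalyticAt ℝ f p)
    (h0 : grad3 f p ≠ 0) (hnull : ∀ᶠ x in 𝓝 p, grad3 f x ⬝ᵥ grad3 f x = 0) :
    ∃ φ, IsTwistorGerm f φ p := by
  obtain ⟨F, hF, hFf⟩ := hf.exists_complexify
  choose m hm hmf using fun j =>
    AnalyticAt.exists_complexify (analyticAt_pi_iff.1 (hf.axisField h0) j)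
  set M : (Fin 3 → ℂ) → Fin 3 → ℂ := fun z j => m j z
  have hM : AnalyticAt ℂ M (complexVec p) := .pi hm
  have hMf : ∀ᶠ x in 𝓝 p, M (complexVec x) = axisField f x := by
    filter_upwards [eventually_all.2 hmf] with x hx using funext hx
  obtain ⟨Y, hY, hYp, hYX⟩ := exists_implicit_solution hM
  have hgrad : ∀ᶠ x in 𝓝 p, cgrad F (complexVec x) = grad3 f x := by
    filter_upwards [complexVec.continuous.continuousAt.eventually hF.eventually_analyticAt,
      hFf.eventually_nhds] with x h1 h2 using cgrad_complexVec h1.differentiableAt h2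
  have hg : ∀ j, AnalyticAt ℂ (fun z => cgrad F z j) (complexVec p) :=
    analyticAt_pi_iff.1 hF.cgrad
  have hN : ∀ᶠ z in 𝓝 (complexVec p), cgrad F z ⬝ᵥ cgrad F z = 0 := by
    refine AnalyticAt.eventually_eq_zero_of_real
      (Finset.analyticAt_fun_sum _ fun j _ => (hg j).mul (hg j)) ?_
    filter_upwards [hgrad, hnull] with x h1 h2
    rw [← h1] at h2
    exact h2
  have hX : ∀ᶠ z in 𝓝 (complexVec p), M z ⨯₃ cgrad F z = -I • cgrad F z := by
    have hj : ∀ j, ∀ᶠ z in 𝓝 (complexVec p), (M z ⨯₃ cgrad F z) j + I * cgrad F z j = 0 := by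
      intro j
      refine AnalyticAt.eventually_eq_zero_of_real ?_ ?_
      · refine AnalyticAt.add ?_ (analyticAt_const.mul (hg j))
        fin_cases j <;> simp only [cross_apply] <;>
          exact ((hm _).mul (hg _)).sub ((hm _).mul (hg _))
      · filter_upwards [hgrad, hnull, hMf, hf.grad3.continuousAt.eventually_ne h0]
          with x h1 h2 h3 h4
        rw [h1, h3, axisField_cross h2 h4]
        simp
    filter_upwards [eventually_all.2 hj] with z hz
    funext j
    have := hz j
    simp only [Pi.smul_apply, smul_eq_mul]
    linear_combination this
  refine ⟨fun X => F (Y X), F, M, Y, ⟨?_, ?_, hY, ?_, ?_, ?_, hYX⟩, hYp, hFf, hMf, .rfl⟩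
  all_goals rw [hYp]
  exacts [hF, hM, hN, hX, hgrad.self_of_nhds ▸ h0]

namespace IsTwistorGerm

variable {f : (Fin 3 → ℝ) → ℂ} {φ φ' : (Fin 4 → ℝ) → ℂ} {q : Fin 3 → ℝ}

lemma apply_incl3 (h : IsTwistorGerm f φ q) : φ (incl3 q) = f q := by
  obtain ⟨F, M, Y, -, hY, hF, -, hφ⟩ := h
  rw [hφ.self_of_nhds, ← hF.self_of_nhds, ← hY]

lemma eventually (h : IsTwistorGerm f φ q) : ∀ᶠ x in 𝓝 q, IsTwistorGerm f φ x := by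
  obtain ⟨F, M, Y, hS, hY, hF, hM, hφ⟩ := h
  have hc : ContinuousAt incl3 q := continuous_incl3.continuousAt
  filter_upwards [hc.eventually hS.eventually, hF.eventually_nhds, hM.eventually_nhds,
    hc.eventually (eventually_eventuallyEq_nhds.2 hφ)] with x h1 h2 h3 h4
  refine ⟨F, M, Y, h1, ?_, h2, h3, h4⟩
  have := h1.implicit.self_of_nhds
  funext j
  simpa [incl3] using congr($this j)

lemma eventuallyEq (h : IsTwistorGerm f φ q) (h' : IsTwistorGerm f φ' q) :
    φ =ᶠ[𝓝 (incl3 q)] φ' := by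
  obtain ⟨F, M, Y, hS, hY, hF, hM, hφ⟩ := h
  obtain ⟨F', M', Y', hS', hY', hF', hM', hφ'⟩ := h'
  have hFa := hS.analyticAt_F
  have hFa' := hS'.analyticAt_F
  have hMa := hS.analyticAt_M
  have hMa' := hS'.analyticAt_M
  rw [hY] at hFa hMa
  rw [hY'] at hFa' hMa'
  have hFF : ∀ᶠ z in 𝓝 (complexVec q), F z - F' z = 0 := by
    refine AnalyticAt.eventually_eq_zero_of_real (hFa.sub hFa') ?_
    filter_upwards [hF, hF'] with x h1 h2
    simp [h1, h2]
  have hMM : ∀ᶠ z in 𝓝 (complexVec q), ∀ j, M z j - M' z j = 0 := by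
    refine eventually_all.2 fun j => AnalyticAt.eventually_eq_zero_of_real
      ((analyticAt_pi_iff.1 hMa j).sub (analyticAt_pi_iff.1 hMa' j)) ?_
    filter_upwards [hM, hM'] with x h1 h2
    simp [h1, h2]
  obtain ⟨K, s, hs, hK⟩ := (hMa.contDiffAt (n := 1)).exists_lipschitzOnWith
  have hc := hS.analyticAt_Y.continuousAt
  have hc' := hS'.analyticAt_Y.continuousAt
  rw [ContinuousAt, hY] at hc
  rw [ContinuousAt, hY'] at hc'
  have hsmall : ∀ᶠ X in 𝓝 (incl3 q), |X 0| * (K : ℝ) < 1 := by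
    have : ContinuousAt (fun X : Fin 4 → ℝ => |X 0| * (K : ℝ)) (incl3 q) :=
      ((continuous_apply 0).abs.mul continuous_const).continuousAt
    exact this.eventually_lt continuousAt_const (by simp [incl3])
  filter_upwards [hφ, hφ', hc hs, hc' hs, hc'.eventually hFF, hc'.eventually hMM, hS.implicit,
    hS'.implicit, hsmall] with X e e' hX hX' eF eM hi hi' hlt
  have hMX : M' (Y' X) = M (Y' X) := funext fun j => (sub_eq_zero.1 (eM j)).symm
  have hYY : Y X = Y' X := by
    rw [hMX, ← hi] at hi'
    have hd : Y X - Y' X = (I * (X 0 : ℂ)) • (M (Y' X) - M (Y X)) := by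
      rw [smul_sub, sub_eq_sub_iff_add_eq_add, add_comm _ (Y' X), hi']
    by_contra hne
    have hpos : 0 < ‖Y X - Y' X‖ := norm_pos_iff.2 (sub_ne_zero.2 hne)
    have hle : ‖Y X - Y' X‖ ≤ |X 0| * (K * ‖Y X - Y' X‖) := by
      conv_lhs => rw [hd, norm_smul]
      rw [norm_sub_rev (Y X)]
      simp only [norm_mul, norm_I, norm_real, Real.norm_eq_abs, one_mul]
      gcongr
      exact hK.norm_sub_le hX' hX
    nlinarith
  rw [e, e', hYY]
  exact sub_eq_zero.1 eF

lemma eventually_hyperbolic (h : IsTwistorGerm f φ q) (hf : fderiv ℝ f q ≠ 0) :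
    ∀ᶠ X in 𝓝 (incl3 q), AnalyticAt ℝ φ X ∧ fderiv ℝ φ X ≠ 0 ∧
      (X 0 : ℂ) * (pd4 (pd4 φ 0) 0 X + pd4 (pd4 φ 1) 1 X + pd4 (pd4 φ 2) 2 X +
        pd4 (pd4 φ 3) 3 X) - 2 * pd4 φ 0 X = 0 ∧
      pd4 φ 0 X ^ 2 + pd4 φ 1 X ^ 2 + pd4 φ 2 X ^ 2 + pd4 φ 3 X ^ 2 = 0 := by
  have hev : ∀ᶠ x in 𝓝 q, f x = φ (incl3 x) := h.eventually.mono fun x hx => hx.apply_incl3.symm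
  obtain ⟨F, M, Y, hS, -, -, -, hφ⟩ := h
  have hφa : AnalyticAt ℝ φ (incl3 q) := hS.analyticAt.congr hφ.symm
  have hne : fderiv ℝ φ (incl3 q) ≠ 0 := by
    intro h0
    have h1 := hφa.differentiableAt.hasFDerivAt
    rw [← coe_incl3L] at h1 hev
    have h2 := (h1.comp q incl3L.hasFDerivAt).congr_of_eventuallyEq hev
    rw [coe_incl3L, h0] at h2
    exact hf (by simpa using h2.fderiv)
  filter_upwards [hS.eventually, eventually_eventuallyEq_nhds.2 hφ, hφa.eventually_analyticAt,
    hφa.fderiv.continuousAt.eventually_ne hne] with X h1 h2 h3 h4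
  refine ⟨h3, h4, ?_⟩
  have e : ∀ a, pd4 φ a X = _ := fun a => (pd4_congr h2 a).self_of_nhds
  have e2 : ∀ a, pd4 (pd4 φ a) a X = _ := fun a => (pd4_congr (pd4_congr h2 a) a).self_of_nhds
  simp only [e, e2]
  exact h1.hyperbolic rfl

end IsTwistorGerm

/-- A nonzero null complex gradient has real rank two. -/
lemma rank_fderiv_eq_two {φ : (Fin 4 → ℝ) → ℂ} {X : Fin 4 → ℝ} (h0 : fderiv ℝ φ X ≠ 0)
    (hnull : pd4 φ 0 X ^ 2 + pd4 φ 1 X ^ 2 + pd4 φ 2 X ^ 2 + pd4 φ 3 X ^ 2 = 0) :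
    LinearMap.rank (fderiv ℝ φ X).toLinearMap = 2 := by
  have hsurj : LinearMap.range (fderiv ℝ φ X).toLinearMap = ⊤ := by
    by_contra hlt
    obtain ⟨l, hl0, hl⟩ := Submodule.exists_le_ker_of_lt_top _ (lt_top_iff_ne_top.2 hlt)
    have hla : ∀ z : ℂ, l z = z.re * l 1 + z.im * l I := fun z => by
      conv_lhs => rw [← re_add_im z, ← mul_one (z.re : ℂ), ← real_smul, ← real_smul, map_add,
        map_smul, map_smul]
      simp
    have hr : ∀ a, ((l 1 - l I * I : ℂ) * pd4 φ a X).re = 0 := fun a => by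
      have : l (pd4 φ a X) = 0 := hl ⟨Pi.single a 1, rfl⟩
      rw [hla] at this
      simp
      linear_combination this
    have hw : (l 1 - l I * I : ℂ) ≠ 0 := fun hw => by
      have h1 : l 1 = 0 := by simpa using congr(re $hw)
      have h2 : l I = 0 := by simpa using congr(im $hw)
      exact hl0 (LinearMap.ext fun z => by rw [hla, h1, h2]; simp)
    have hs : ∑ a, ((l 1 - l I * I : ℂ) * pd4 φ a X).im ^ 2 = 0 := by
      have := congr((((l 1 - l I * I : ℂ) ^ 2) * $hnull).re)
      rw [mul_zero, zero_re, mul_add, mul_add, mul_add, ← mul_pow, ← mul_pow, ← mul_pow,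
        ← mul_pow] at this
      simp only [pow_two, add_re, mul_re _ (_ * _), hr] at this
      rw [Fin.sum_univ_four]
      linear_combination -this
    rw [Finset.sum_eq_zero_iff_of_nonneg fun _ _ => sq_nonneg _] at hs
    refine h0 (ContinuousLinearMap.coe_injective (LinearMap.pi_ext' fun a => LinearMap.ext_ring ?_))
    have : (l 1 - l I * I : ℂ) * pd4 φ a X = 0 :=
      Complex.ext (hr a) (pow_eq_zero_iff two_ne_zero |>.1 (hs a (Finset.mem_univ a)))
    exact (mul_eq_zero.1 this).resolve_left hw
  rw [LinearMap.rank, hsurj, rank_top, Complex.rank_real_complex]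

lemma exists_local_extension {A3 : Set (Fin 3 → ℝ)} (hA3 : IsOpen A3) {f : (Fin 3 → ℝ) → ℂ}
    (hf_an : AnalyticOnNhd ℝ f A3) (hf_subm : ∀ x ∈ A3, fderiv ℝ f x ≠ 0)
    (hf_hwc : ∀ x ∈ A3, (pd3 f 0 x) ^ 2 + (pd3 f 1 x) ^ 2 + (pd3 f 2 x) ^ 2 = 0) (p : A3) :
    ∃ (φ : (Fin 4 → ℝ) → ℂ) (r : ℝ), 0 < r ∧ ∀ X ∈ Metric.ball (incl3 p) r,
      (AnalyticAt ℝ φ X ∧ fderiv ℝ φ X ≠ 0 ∧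
        (X 0 : ℂ) * (pd4 (pd4 φ 0) 0 X + pd4 (pd4 φ 1) 1 X + pd4 (pd4 φ 2) 2 X +
          pd4 (pd4 φ 3) 3 X) - 2 * pd4 φ 0 X = 0 ∧
        pd4 φ 0 X ^ 2 + pd4 φ 1 X ^ 2 + pd4 φ 2 X ^ 2 + pd4 φ 3 X ^ 2 = 0) ∧
      Fin.tail X ∈ A3 ∧ IsTwistorGerm f φ (Fin.tail X) := by
  obtain ⟨p, hp⟩ := p
  have hnull : ∀ᶠ x in 𝓝 p, grad3 f x ⬝ᵥ grad3 f x = 0 := by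
    filter_upwards [hA3.mem_nhds hp] with x hx
    simpa [grad3, dotProduct, Fin.sum_univ_three, pow_two] using hf_hwc x hx
  have h0 : grad3 f p ≠ 0 := fun h => hf_subm p hp <|
    ContinuousLinearMap.coe_injective <| LinearMap.pi_ext' fun a => LinearMap.ext_ring <|
      congrFun h a
  obtain ⟨φ, hφ⟩ := exists_isTwistorGerm (hf_an p hp) h0 hnull
  have ht : Tendsto (Fin.tail : (Fin 4 → ℝ) → Fin 3 → ℝ) (𝓝 (incl3 p)) (𝓝 p) :=
    Continuous.tendsto' (continuous_pi fun j => continuous_apply j.succ) _ _ (Fin.tail_cons _ _)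
  have := (hφ.eventually_hyperbolic (hf_subm p hp)).and
    (ht.eventually ((hA3.eventually_mem hp).and hφ.eventually))
  obtain ⟨r, hr, h⟩ := Metric.eventually_nhds_iff_ball.1 this
  exact ⟨φ, r, hr, h⟩

lemma incl3_tail_mem_ball {X : Fin 4 → ℝ} {p : Fin 3 → ℝ} {r : ℝ}
    (hX : X ∈ Metric.ball (incl3 p) r) : incl3 (Fin.tail X) ∈ Metric.ball (incl3 p) r := by
  refine lt_of_le_of_lt ((dist_pi_le_iff dist_nonneg).2 fun i => ?_) hX
  refine Fin.cases (by simp [incl3]) (fun j => ?_) i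
  exact dist_le_pi_dist X (incl3 p) j.succ

/-- any real-analytic horizontally conformal submersion `f : A³ → ℂ` on an
open subset of `ℝ³` extends to a real-analytic submersion `φ : A⁴ → ℂ` on an open subset
of `ℝ⁴` with `A⁴ ∩ {x₀ = 0} = A³` which is a hyperbolic harmonic morphism on
`A⁴ ∖ {x₀ = 0}`. -/
theorem hwc_submersion_extends_to_hyperbolic_harmonic_morphism
    (A3 : Set (Fin 3 → ℝ)) (hA3 : IsOpen A3)
    (f : (Fin 3 → ℝ) → ℂ)
    (hf_an : AnalyticOnNhd ℝ f A3)
    (hf_subm : ∀ x ∈ A3, fderiv ℝ f x ≠ 0)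
    (hf_hwc : ∀ x ∈ A3,
      (pd3 f 0 x) ^ 2 + (pd3 f 1 x) ^ 2 + (pd3 f 2 x) ^ 2 = 0) :
    ∃ (A4 : Set (Fin 4 → ℝ)) (φ : (Fin 4 → ℝ) → ℂ),
      IsOpen A4 ∧
      {x ∈ A4 | x 0 = 0} = incl3 '' A3 ∧
      AnalyticOnNhd ℝ φ A4 ∧
      (∀ x ∈ A4, LinearMap.rank (fderiv ℝ φ x).toLinearMap = 2) ∧
      (∀ x ∈ A3, φ (incl3 x) = f x) ∧
      (∀ x ∈ A4, x 0 ≠ 0 →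
        (x 0 : ℂ) * (pd4 (pd4 φ 0) 0 x + pd4 (pd4 φ 1) 1 x +
            pd4 (pd4 φ 2) 2 x + pd4 (pd4 φ 3) 3 x) - 2 * pd4 φ 0 x = 0 ∧
        (pd4 φ 0 x) ^ 2 + (pd4 φ 1 x) ^ 2 + (pd4 φ 2 x) ^ 2 + (pd4 φ 3 x) ^ 2 = 0) := by
  choose φ r hr h using exists_local_extension hA3 hf_an hf_subm hf_hwc
  have hcompat : ∀ (p q : A3) (X : Fin 4 → ℝ), X ∈ Metric.ball (incl3 p) (r p) →
      X ∈ Metric.ball (incl3 q) (r q) → φ p X = φ q X := by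
    intro p q X hp hq
    exact AnalyticOnNhd.eqOn_of_preconnected_of_eventuallyEq
      (U := Metric.ball (incl3 p) (r p) ∩ Metric.ball (incl3 q) (r q))
      (fun Z hZ => (h p Z hZ.1).1.1) (fun Z hZ => (h q Z hZ.2).1.1)
      ((convex_ball _ _).inter (convex_ball _ _)).isPreconnected
      ⟨incl3_tail_mem_ball hp, incl3_tail_mem_ball hq⟩
      ((h p X hp).2.2.eventuallyEq (h q X hq).2.2) ⟨hp, hq⟩
  classical
  set Φ : (Fin 4 → ℝ) → ℂ := fun X =>
    if hX : ∃ p : A3, X ∈ Metric.ball (incl3 p) (r p) then φ hX.choose X else 0 with hΦ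
  have hΦφ : ∀ (p : A3) (X : Fin 4 → ℝ), X ∈ Metric.ball (incl3 p) (r p) → Φ X = φ p X := by
    intro p X hX
    have hex : ∃ p : A3, X ∈ Metric.ball (incl3 p) (r p) := ⟨p, hX⟩
    rw [hΦ]
    simp only [dif_pos hex]
    exact hcompat _ _ X hex.choose_spec hX
  have hev : ∀ (p : A3) (X : Fin 4 → ℝ), X ∈ Metric.ball (incl3 p) (r p) →
      Φ =ᶠ[𝓝 X] φ p := fun p X hX => by
    filter_upwards [Metric.isOpen_ball.mem_nhds hX] with Z hZ using hΦφ p Z hZ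
  have hself : ∀ p : A3, incl3 p ∈ Metric.ball (incl3 p) (r p) := fun p =>
    Metric.mem_ball_self (hr p)
  have hpde : ∀ (p : A3) (X : Fin 4 → ℝ), X ∈ Metric.ball (incl3 p) (r p) →
      (X 0 : ℂ) * (pd4 (pd4 Φ 0) 0 X + pd4 (pd4 Φ 1) 1 X + pd4 (pd4 Φ 2) 2 X +
        pd4 (pd4 Φ 3) 3 X) - 2 * pd4 Φ 0 X = 0 ∧
      pd4 Φ 0 X ^ 2 + pd4 Φ 1 X ^ 2 + pd4 Φ 2 X ^ 2 + pd4 Φ 3 X ^ 2 = 0 := by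
    intro p X hX
    have e : ∀ a, pd4 Φ a X = pd4 (φ p) a X := fun a => (pd4_congr (hev p X hX) a).self_of_nhds
    have e2 : ∀ a, pd4 (pd4 Φ a) a X = pd4 (pd4 (φ p) a) a X := fun a =>
      (pd4_congr (pd4_congr (hev p X hX) a) a).self_of_nhds
    simp only [e, e2]
    exact (h p X hX).1.2.2
  refine ⟨⋃ p : A3, Metric.ball (incl3 p) (r p), Φ, isOpen_iUnion fun _ => Metric.isOpen_ball,
    ?_, ?_, ?_, ?_, ?_⟩
  · ext X
    simp only [Set.mem_ofPred_eq, Set.mem_iUnion, Set.mem_image]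
    constructor
    · rintro ⟨⟨p, hX⟩, h0⟩
      refine ⟨Fin.tail X, (h p X hX).2.1, ?_⟩
      rw [incl3, ← h0, Fin.cons_self_tail]
    · rintro ⟨q, hq, rfl⟩
      exact ⟨⟨⟨q, hq⟩, hself ⟨q, hq⟩⟩, rfl⟩
  · intro X hX
    obtain ⟨p, hX⟩ := Set.mem_iUnion.1 hX
    exact (h p X hX).1.1.congr (hev p X hX).symm
  · intro X hX
    obtain ⟨p, hX⟩ := Set.mem_iUnion.1 hX
    refine rank_fderiv_eq_two ?_ (hpde p X hX).2
    rw [(hev p X hX).fderiv_eq]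
    exact (h p X hX).1.2.1
  · intro x hx
    rw [hΦφ ⟨x, hx⟩ _ (hself ⟨x, hx⟩)]
    exact (h ⟨x, hx⟩ _ (hself ⟨x, hx⟩)).2.2.apply_incl3
  · intro X hX _
    obtain ⟨p, hX⟩ := Set.mem_iUnion.1 hX
    exact hpde p X hX
end

section
/- Equip ℝ⁴ (coordinates (t,x₁,x₂,x₃), standard basis e₀,e₁,e₂,e₃) with the Minkowski bilinear form g(v,w) = −v₀w₀ + v₁w₁ + v₂w₂ + v₃w₃. Let L : ℝ⁴ → ℂ be a nonzero real-linear map satisfying −(L e₀)² + (L e₁)² + (L e₂)² + (L e₃)² = 0, and suppose its kernel is degenerate, i.e. there is a nonzero v ∈ ker L with g(v,w) = 0 for all w ∈ ker L. Then there is a unique one-dimensional subspace V ⊆ ker L spanned by a g-null vector, and moreover ker L = V^⊥ := {w ∈ ℝ⁴ : g(v,w) = 0 for all v ∈ V}. (This is the linear-algebra content of the statement: at a degenerate point p with dφ_p ≠ 0 of a Minkowski harmonic morphism φ, there is a unique null direction V_p ⊆ ker dφ_p, and ker dφ_p = V_p^⊥.) -/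
open Complex

/-- The Minkowski bilinear form on `ℝ⁴` (coordinates `(t,x₁,x₂,x₃)`). -/
def mink (v w : Fin 4 → ℝ) : ℝ :=
  -(v 0 * w 0) + v 1 * w 1 + v 2 * w 2 + v 3 * w 3

lemma mink_comm (v w : Fin 4 → ℝ) : mink v w = mink w v := by
  simp only [mink]; ring

lemma mink_smul_left (c : ℝ) (v w : Fin 4 → ℝ) : mink (c • v) w = c * mink v w := by
  simp only [mink, Pi.smul_apply, smul_eq_mul]; ring

/-- The linear functional `mink v`. -/
def minkLeft (v : Fin 4 → ℝ) : Module.Dual ℝ (Fin 4 → ℝ) where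
  toFun := mink v
  map_add' x y := by simp only [mink, Pi.add_apply]; ring
  map_smul' c x := by simp only [mink, Pi.smul_apply, smul_eq_mul, RingHom.id_apply]; ring

lemma eq_zero_of_mink_self_eq_zero {v : Fin 4 → ℝ} (h : mink v v = 0) (h₀ : v 0 = 0) :
    v = 0 := by
  simp only [mink, h₀] at h
  have h1 : v 1 = 0 := by nlinarith [sq_nonneg (v 1), sq_nonneg (v 2), sq_nonneg (v 3)]
  have h2 : v 2 = 0 := by nlinarith [sq_nonneg (v 1), sq_nonneg (v 2), sq_nonneg (v 3)]
  have h3 : v 3 = 0 := by nlinarith [sq_nonneg (v 1), sq_nonneg (v 2), sq_nonneg (v 3)]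
  ext i
  fin_cases i <;> assumption

/-- Orthogonal null vectors are proportional. -/
lemma exists_eq_smul_of_null {v w : Fin 4 → ℝ} (hv : v ≠ 0) (hvv : mink v v = 0)
    (hww : mink w w = 0) (hvw : mink v w = 0) : ∃ c : ℝ, w = c • v := by
  have h₀ : v 0 ≠ 0 := fun h => hv (eq_zero_of_mink_self_eq_zero hvv h)
  refine ⟨w 0 / v 0, sub_eq_zero.mp (eq_zero_of_mink_self_eq_zero ?_ ?_)⟩
  · generalize w 0 / v 0 = c
    have : mink (w - c • v) (w - c • v) = mink w w - 2 * c * mink v w + c ^ 2 * mink v v := by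
      simp only [mink, Pi.sub_apply, Pi.smul_apply, smul_eq_mul]; ring
    rw [this, hww, hvw, hvv]; ring
  · simp [h₀]

/-- The vector representing a linear functional with respect to `mink`. -/
def minkGradient (f : Module.Dual ℝ (Fin 4 → ℝ)) : Fin 4 → ℝ :=
  ![-f (Pi.single 0 1), f (Pi.single 1 1), f (Pi.single 2 1), f (Pi.single 3 1)]

lemma mink_minkGradient (f : Module.Dual ℝ (Fin 4 → ℝ)) (w : Fin 4 → ℝ) :
    mink (minkGradient f) w = f w := by
  have h (i : Fin 4) : (fun j => if i = j then (1 : ℝ) else 0) = Pi.single i 1 := by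
    ext j; simp [Pi.single_apply, eq_comm]
  rw [LinearMap.pi_apply_eq_sum_univ f w]
  simp only [h, mink, minkGradient, Fin.sum_univ_four, smul_eq_mul, Matrix.cons_val]
  ring

lemma eq_of_mink_eq {v w : Fin 4 → ℝ} (h : ∀ x, mink v x = mink w x) : v = w := by
  ext i
  have := h (Pi.single i 1)
  fin_cases i <;> simpa [mink] using this

/-- if `L : ℝ⁴ → ℂ` is a nonzero real-linear map satisfying the Minkowski
horizontal weak conformality condition and its kernel is degenerate, then there is a
unique one-dimensional subspace `V ⊆ ker L` spanned by a null vector, and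
`ker L = V^⊥`. -/
theorem degenerate_kernel_unique_null_direction
    (L : (Fin 4 → ℝ) →ₗ[ℝ] ℂ) (hL : L ≠ 0)
    (hHWC : -(L (Pi.single 0 1)) ^ 2 + (L (Pi.single 1 1)) ^ 2 +
      (L (Pi.single 2 1)) ^ 2 + (L (Pi.single 3 1)) ^ 2 = 0)
    (hdeg : ∃ v : Fin 4 → ℝ, v ≠ 0 ∧ v ∈ LinearMap.ker L ∧
      ∀ w ∈ LinearMap.ker L, mink v w = 0) :
    ∃ V : Submodule ℝ (Fin 4 → ℝ),
      (∃ v : Fin 4 → ℝ, v ≠ 0 ∧ mink v v = 0 ∧ V = Submodule.span ℝ {v}) ∧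
      V ≤ LinearMap.ker L ∧
      (∀ V' : Submodule ℝ (Fin 4 → ℝ),
        (∃ v : Fin 4 → ℝ, v ≠ 0 ∧ mink v v = 0 ∧ V' = Submodule.span ℝ {v}) →
        V' ≤ LinearMap.ker L → V' = V) ∧
      (LinearMap.ker L : Set (Fin 4 → ℝ)) = {w | ∀ v ∈ V, mink v w = 0} := by
  obtain ⟨v, hv, hvker, hvorth⟩ := hdeg
  have hvv := hvorth v hvker
  set a := minkGradient (reLm ∘ₗ L) with ha
  set b := minkGradient (imLm ∘ₗ L) with hb
  have hre (w) : mink a w = (L w).re := mink_minkGradient (reLm ∘ₗ L) w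
  have him (w) : mink b w = (L w).im := mink_minkGradient (imLm ∘ₗ L) w
  have hab : mink a b = 0 := by
    have := congrArg Complex.im hHWC
    simp [pow_two] at this
    simp [ha, hb, mink, minkGradient]
    linarith
  have haabb : mink a a = mink b b := by
    have := congrArg Complex.re hHWC
    simp [pow_two] at this
    simp [ha, hb, mink, minkGradient]
    linarith
  have hLv : L v = 0 := hvker
  have hav : mink a v = 0 := by rw [hre, hLv, zero_re]
  have hbv : mink b v = 0 := by rw [him, hLv, zero_im]
  obtain ⟨φ, hφ⟩ : minkLeft v ∈ LinearMap.range L.dualMap := by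
    rw [LinearMap.range_dualMap_eq_dualAnnihilator_ker, Submodule.mem_dualAnnihilator]
    exact hvorth
  have hcomb : v = φ 1 • a + φ I • b := by
    refine eq_of_mink_eq fun x => ?_
    have h1 : mink v x = φ (L x) := (LinearMap.congr_fun hφ x).symm
    have h2 : L x = (L x).re • (1 : ℂ) + (L x).im • I := by
      simp [Complex.re_add_im]
    have h3 : mink (φ 1 • a + φ I • b) x = φ 1 * mink a x + φ I * mink b x := by
      simp only [mink, Pi.add_apply, Pi.smul_apply, smul_eq_mul]; ring
    rw [h1, h3, hre, him, h2, map_add, map_smul, map_smul, ← h2, smul_eq_mul, smul_eq_mul]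
    ring
  have hexpand (x) : mink x v = φ 1 * mink x a + φ I * mink x b := by
    conv_lhs => rw [hcomb]
    simp only [mink, Pi.add_apply, Pi.smul_apply, smul_eq_mul]; ring
  have haa : mink a a = 0 := by
    by_contra hne
    have h1 : φ 1 = 0 := by
      have := hexpand a
      rw [hav, hab, mul_zero, add_zero] at this
      exact (mul_eq_zero.mp this.symm).resolve_right hne
    have h2 : φ I = 0 := by
      have := hexpand b
      rw [hbv, mink_comm b a, hab, mul_zero, zero_add, ← haabb] at this
      exact (mul_eq_zero.mp this.symm).resolve_right hne
    exact hv (by rw [hcomb, h1, h2, zero_smul, zero_smul, add_zero])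
  obtain ⟨c, hc⟩ := exists_eq_smul_of_null hv hvv haa (mink_comm v a ▸ hav)
  obtain ⟨d, hd⟩ := exists_eq_smul_of_null hv hvv (haabb ▸ haa) (mink_comm v b ▸ hbv)
  refine ⟨Submodule.span ℝ {v}, ⟨v, hv, hvv, rfl⟩, ?_, ?_, ?_⟩
  · rwa [Submodule.span_singleton_le_iff_mem]
  · rintro _ ⟨u, hu, huu, rfl⟩ hle
    rw [Submodule.span_singleton_le_iff_mem] at hle
    obtain ⟨r, rfl⟩ := exists_eq_smul_of_null hv hvv huu (hvorth u hle)
    exact Submodule.span_singleton_smul_eq (left_ne_zero_of_smul hu).isUnit v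
  · ext w
    constructor
    · intro hw u hu
      obtain ⟨r, rfl⟩ := Submodule.mem_span_singleton.mp hu
      rw [mink_smul_left, hvorth w hw, mul_zero]
    · intro hw
      have hvw := hw v (Submodule.mem_span_singleton_self v)
      refine LinearMap.mem_ker.mpr (Complex.ext ?_ ?_)
      · rw [← hre, hc, mink_smul_left, hvw, mul_zero, zero_re]
      · rw [← him, hd, mink_smul_left, hvw, mul_zero, zero_im]
end

section
/- Let A⁴ ⊆ ℝ⁴ be open and let f : A⁴ → ℂ be a smooth harmonic morphism, i.e. Σᵢ₌₀³ ∂²f/∂xᵢ² = 0 and Σᵢ₌₀³ (∂f/∂xᵢ)² = 0 on A⁴. Then there exist an open set A^C ⊆ ℂ⁴ with A^C ∩ ℝ⁴ = A⁴ (where ℝ⁴ ⊆ ℂ⁴ is the standard real slice) and a holomorphic map φ : A^C → ℂ with φ restricted to A⁴ equal to f, such that φ is a complex-harmonic morphism: Σᵢ₌₀³ ∂²φ/∂xᵢ² = 0 and Σᵢ₌₀³ (∂φ/∂xᵢ)² = 0 on A^C (complex directional derivatives). -/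
open Complex

/-- Complex directional derivative in the `i`-th coordinate direction of a map `ℂ⁴ → ℂ`. -/
noncomputable def cd (f : (Fin 4 → ℂ) → ℂ) (i : Fin 4) (x : Fin 4 → ℂ) : ℂ :=
  fderiv ℂ f x (Pi.single i 1)

/-- The standard inclusion `ℝ⁴ → ℂ⁴`. -/
def inclR (x : Fin 4 → ℝ) : Fin 4 → ℂ := fun i => (x i : ℂ)

open MeasureTheory Metric Filter Topology
open scoped ContDiff

lemma continuous_inclR : Continuous inclR := by
  unfold inclR; fun_prop

lemma ContDiffOn.cd {K : (Fin 4 → ℂ) → ℂ} {V : Set (Fin 4 → ℂ)} (hV : IsOpen V)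
    (hK : ContDiffOn ℂ ∞ K V) (i : Fin 4) : ContDiffOn ℂ ∞ (cd K i) V :=
  (hK.fderiv_of_isOpen hV (by simp)).clm_apply contDiffOn_const

section Convolution

variable {K : (Fin 4 → ℂ) → ℂ} {V U : Set (Fin 4 → ℂ)} {S : Set (Fin 4 → ℝ)}
  {g : (Fin 4 → ℝ) → ℂ}

lemma hasFDerivAt_setIntegral_mul_comp_sub (hV : IsOpen V) (hK : ContDiffOn ℂ ∞ K V)
    (hU : IsOpen U) (hS : IsCompact S) (hg : Continuous g)
    (hUS : ∀ z ∈ U, ∀ y ∈ S, z - inclR y ∈ V) {z : Fin 4 → ℂ} (hz : z ∈ U) :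
    IntegrableOn (fun y => g y • fderiv ℂ K (z - inclR y)) S ∧
    HasFDerivAt (fun z => ∫ y in S, g y * K (z - inclR y))
      (∫ y in S, g y • fderiv ℂ K (z - inclR y)) z := by
  have hfc : ContinuousOn (fderiv ℂ K) V := hK.continuousOn_fderiv_of_isOpen hV (by simp)
  have hslice : ∀ w ∈ U, ContinuousOn (fun y => w - inclR y) S := fun w _ =>
    (continuous_const.sub continuous_inclR).continuousOn
  have hcF : ∀ w ∈ U, ContinuousOn (fun y => g y * K (w - inclR y)) S := fun w hw =>
    hg.continuousOn.mul (hK.continuousOn.comp (hslice w hw) (hUS w hw))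
  have hcF' : ContinuousOn (fun y => g y • fderiv ℂ K (z - inclR y)) S :=
    hg.continuousOn.smul (hfc.comp (hslice z hz) (hUS z hz))
  obtain ⟨ε, hε, hball⟩ := nhds_basis_closedBall.mem_iff.1 (hU.mem_nhds hz)
  have hjoint : ContinuousOn (fun p : (Fin 4 → ℂ) × (Fin 4 → ℝ) =>
      g p.2 • fderiv ℂ K (p.1 - inclR p.2)) (closedBall z ε ×ˢ S) := by
    refine (hg.comp continuous_snd).continuousOn.smul (hfc.comp ?_ ?_)
    · exact (continuous_fst.sub (continuous_inclR.comp continuous_snd)).continuousOn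
    · exact fun p hp => hUS _ (hball hp.1) _ hp.2
  obtain ⟨M, hM⟩ := ((isCompact_closedBall z ε).prod hS).exists_bound_of_continuousOn hjoint
  refine ⟨hcF'.integrableOn_compact hS, ?_⟩
  refine hasFDerivAt_integral_of_dominated_of_fderiv_le (bound := fun _ => M)
    (F' := fun z y => g y • fderiv ℂ K (z - inclR y)) (closedBall_mem_nhds z hε)
    ?_ ((hcF z hz).integrableOn_compact hS) (hcF'.aestronglyMeasurable hS.measurableSet)
    ?_ (integrableOn_const hS.measure_lt_top.ne) ?_
  · filter_upwards [hU.mem_nhds hz] with w hw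
    exact (hcF w hw).aestronglyMeasurable hS.measurableSet
  · filter_upwards [ae_restrict_mem hS.measurableSet] with y hy w hw
    exact hM (w, y) ⟨hw, hy⟩
  · filter_upwards [ae_restrict_mem hS.measurableSet] with y hy w hw
    have hd := ((hK.contDiffAt (hV.mem_nhds (hUS w (hball hw) y hy))).differentiableAt
      (by simp)).hasFDerivAt
    simpa using (hd.comp w ((hasFDerivAt_id w).sub_const (inclR y))).const_mul (g y)

lemma cd_setIntegral_mul_comp_sub (hV : IsOpen V) (hK : ContDiffOn ℂ ∞ K V)
    (hU : IsOpen U) (hS : IsCompact S) (hg : Continuous g)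
    (hUS : ∀ z ∈ U, ∀ y ∈ S, z - inclR y ∈ V) (i : Fin 4) {z : Fin 4 → ℂ} (hz : z ∈ U) :
    cd (fun z => ∫ y in S, g y * K (z - inclR y)) i z =
      ∫ y in S, g y * cd K i (z - inclR y) := by
  obtain ⟨hint, hd⟩ := hasFDerivAt_setIntegral_mul_comp_sub hV hK hU hS hg hUS hz
  rw [cd, hd.fderiv, ContinuousLinearMap.integral_apply hint]
  rfl

end Convolution

lemma Filter.EventuallyEq.cd {φ ψ : (Fin 4 → ℂ) → ℂ} {z : Fin 4 → ℂ} (h : φ =ᶠ[𝓝 z] ψ)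
    (i : Fin 4) : cd φ i =ᶠ[𝓝 z] cd ψ i := by
  filter_upwards [h.fderiv (𝕜 := ℂ)] with w hw
  rw [_root_.cd, hw, _root_.cd]

lemma Filter.EventuallyEq.pd4 {f g : (Fin 4 → ℝ) → ℂ} {x : Fin 4 → ℝ} (h : f =ᶠ[𝓝 x] g)
    (i : Fin 4) : pd4 f i =ᶠ[𝓝 x] pd4 g i := by
  filter_upwards [h.fderiv (𝕜 := ℝ)] with w hw
  rw [_root_.pd4, hw, _root_.pd4]

/-- The real-linear inclusion `ℝ⁴ → ℂ⁴` as a continuous linear map. -/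
noncomputable def inclRCLM : (Fin 4 → ℝ) →L[ℝ] (Fin 4 → ℂ) :=
  ContinuousLinearMap.pi fun i => Complex.ofRealCLM.comp (ContinuousLinearMap.proj i)

lemma cd_inclR_eq_pd4 {φ : (Fin 4 → ℂ) → ℂ} {f : (Fin 4 → ℝ) → ℂ} {x : Fin 4 → ℝ}
    (hφ : DifferentiableAt ℂ φ (inclR x)) (hf : (fun y => φ (inclR y)) =ᶠ[𝓝 x] f) (i : Fin 4) :
    cd φ i (inclR x) = pd4 f i x := by
  have h1 : HasFDerivAt (fun y => φ (inclR y))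
      (((fderiv ℂ φ (inclR x)).restrictScalars ℝ).comp inclRCLM) x :=
    (hφ.hasFDerivAt.restrictScalars ℝ).comp x inclRCLM.hasFDerivAt
  rw [pd4, ← hf.fderiv_eq, h1.fderiv, cd]
  simp only [ContinuousLinearMap.comp_apply, ContinuousLinearMap.coe_restrictScalars']
  congr 1
  ext j
  by_cases h : j = i
  · subst h; simp [inclRCLM]
  · simp [inclRCLM, h]

/-- Identity theorem: a holomorphic function on a convex open set that vanishes at the real points
vanishes at every point whose real part lies in the set. -/
lemma eq_zero_of_eq_zero_on_real {U : Set (Fin 4 → ℂ)} (hU : IsOpen U) (hUc : Convex ℝ U)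
    {h : (Fin 4 → ℂ) → ℂ} (hh : ∀ z ∈ U, DifferentiableAt ℂ h z)
    (h0 : ∀ x, inclR x ∈ U → h (inclR x) = 0) {z : Fin 4 → ℂ} (hz : z ∈ U)
    (hre : inclR (fun i => (z i).re) ∈ U) : h z = 0 := by
  set a : Fin 4 → ℝ := fun i => (z i).re
  set b : Fin 4 → ℝ := fun i => (z i).im
  let l : ℂ → (Fin 4 → ℂ) := fun w => inclR a + w • inclR b
  have hl : Differentiable ℂ l := by fun_prop
  have hlI : l I = z := by
    ext i
    simp [l, a, b, inclR, mul_comm I, Complex.re_add_im]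
  have hl0 : l 0 = inclR a := by simp [l]
  have hD : IsOpen (l ⁻¹' U) := hU.preimage hl.continuous
  have hDc : Convex ℝ (l ⁻¹' U) := by
    intro p hp q hq s t hs ht hst
    have h1 := hUc hp hq hs ht hst
    have h2 : l (s • p + t • q) = s • l p + t • l q := by
      ext i
      have hst' : (s : ℂ) + t = 1 := by exact_mod_cast hst
      simp only [l, Pi.add_apply, Pi.smul_apply, smul_eq_mul, Complex.real_smul]
      linear_combination (-(inclR a i)) * hst'
    rwa [Set.mem_preimage, h2]
  have han : AnalyticOnNhd ℂ (fun w => h (l w)) (l ⁻¹' U) := by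
    refine DifferentiableOn.analyticOnNhd (fun w hw => ?_) hD
    exact ((hh _ hw).comp w hl.differentiableAt).differentiableWithinAt
  have h0D : (0 : ℂ) ∈ l ⁻¹' U := by simpa [hl0] using hre
  have hfreq : ∃ᶠ w in 𝓝[≠] (0 : ℂ), h (l w) = 0 := by
    have htend : Tendsto (fun t : ℝ => (t : ℂ)) (𝓝[≠] 0) (𝓝[≠] 0) := by
      refine tendsto_nhdsWithin_iff.2 ⟨?_, ?_⟩
      · have := Complex.continuous_ofReal.tendsto 0
        exact (by simpa using this : Tendsto _ _ _).mono_left nhdsWithin_le_nhds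
      · filter_upwards [self_mem_nhdsWithin] with t ht
        simpa using ht
    refine htend.frequently (Eventually.frequently ?_)
    have hev : ∀ᶠ t : ℝ in 𝓝[≠] 0, (t : ℂ) ∈ l ⁻¹' U :=
      htend.eventually (mem_nhdsWithin_of_mem_nhds (hD.mem_nhds h0D))
    filter_upwards [hev] with t ht
    have hlt : l t = inclR (a + t • b) := by
      ext i; simp [l, inclR]
    rw [hlt]
    exact h0 _ (by rw [← hlt]; exact ht)
  have := han.eqOn_zero_of_preconnected_of_frequently_eq_zero hDc.isPreconnected h0D hfreq
    (show I ∈ l ⁻¹' U by simpa [hlI] using hz)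
  simpa [hlI] using this

lemma ContDiff.pd4 {u : (Fin 4 → ℝ) → ℂ} (hu : ContDiff ℝ ∞ u) (i : Fin 4) :
    ContDiff ℝ ∞ (pd4 u i) :=
  (hu.fderiv_right (by simp)).clm_apply contDiff_const

lemma HasCompactSupport.pd4 {u : (Fin 4 → ℝ) → ℂ} (hu : HasCompactSupport u) (i : Fin 4) :
    HasCompactSupport (pd4 u i) :=
  hu.fderiv_apply ℝ _

lemma integrable_smul_of_hasCompactSupport {k : (Fin 4 → ℝ) → ℝ} {v : (Fin 4 → ℝ) → ℂ}
    (hk : Continuous k) (hv : Continuous v) (hvc : HasCompactSupport v) :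
    Integrable fun x => k x • v x :=
  (hk.smul hv).integrable_of_hasCompactSupport hvc.smul_left

lemma integral_smul_pd4_pd4 {h : (Fin 4 → ℝ) → ℝ} {h' h'' : (Fin 4 → ℝ) → ℝ}
    {u : (Fin 4 → ℝ) → ℂ} (i : Fin 4) (hu : ContDiff ℝ ∞ u) (huc : HasCompactSupport u)
    (hd : Differentiable ℝ h) (hd' : Differentiable ℝ h') (hc'' : Continuous h'')
    (h1 : ∀ x, fderiv ℝ h x (Pi.single i 1) = h' x)
    (h2 : ∀ x, fderiv ℝ h' x (Pi.single i 1) = h'' x) :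
    ∫ x, h x • pd4 (pd4 u i) i x = ∫ x, h'' x • u x := by
  have hu1 := hu.pd4 i
  have hu2 := hu1.pd4 i
  have e1 : ∫ x, h x • pd4 (pd4 u i) i x = - ∫ x, h' x • pd4 u i x := by
    simp_rw [← h1]
    refine integral_smul_fderiv_eq_neg_fderiv_smul_of_integrable ?_ ?_ ?_ ?_ ?_
    · simp_rw [h1]
      exact integrable_smul_of_hasCompactSupport hd'.continuous hu1.continuous (huc.pd4 i)
    · exact integrable_smul_of_hasCompactSupport hd.continuous hu2.continuous ((huc.pd4 i).pd4 i)
    · exact integrable_smul_of_hasCompactSupport hd.continuous hu1.continuous (huc.pd4 i)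
    · exact fun x _ => hd x
    · exact fun x _ => hu1.differentiable (by simp) x
  have e2 : ∫ x, h' x • pd4 u i x = - ∫ x, h'' x • u x := by
    simp_rw [← h2]
    refine integral_smul_fderiv_eq_neg_fderiv_smul_of_integrable ?_ ?_ ?_ ?_ ?_
    · simp_rw [h2]
      exact integrable_smul_of_hasCompactSupport hc'' hu.continuous huc
    · exact integrable_smul_of_hasCompactSupport hd'.continuous hu1.continuous (huc.pd4 i)
    · exact integrable_smul_of_hasCompactSupport hd'.continuous hu.continuous huc
    · exact fun x _ => hd' x
    · exact fun x _ => hu.differentiable (by simp) x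
  rw [e1, e2, neg_neg]

/-- The squared Euclidean norm on `ℝ⁴`. -/
def sqNorm (x : Fin 4 → ℝ) : ℝ := ∑ i, x i ^ 2

lemma sqNorm_nonneg (x : Fin 4 → ℝ) : 0 ≤ sqNorm x :=
  Finset.sum_nonneg fun i _ => sq_nonneg (x i)

lemma continuous_sqNorm : Continuous sqNorm := by
  unfold sqNorm; fun_prop

lemma norm_sq_le_sqNorm (x : Fin 4 → ℝ) : ‖x‖ ^ 2 ≤ sqNorm x := by
  refine (Real.le_sqrt (norm_nonneg _) (sqNorm_nonneg x)).1
    ((pi_norm_le_iff_of_nonneg (Real.sqrt_nonneg _)).2 fun i => ?_)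
  refine Real.le_sqrt_of_sq_le ?_
  rw [Real.norm_eq_abs, sq_abs]
  exact Finset.single_le_sum (f := fun i => x i ^ 2) (fun i _ => sq_nonneg (x i))
    (Finset.mem_univ i)

lemma sqNorm_pos {x : Fin 4 → ℝ} (hx : x ≠ 0) : 0 < sqNorm x :=
  (by positivity : 0 < ‖x‖ ^ 2).trans_le (norm_sq_le_sqNorm x)

lemma hasFDerivAt_sqNorm (x : Fin 4 → ℝ) :
    HasFDerivAt sqNorm
      (∑ i, (2 * x i) • (ContinuousLinearMap.proj i : (Fin 4 → ℝ) →L[ℝ] ℝ)) x := by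
  refine HasFDerivAt.fun_sum fun i _ => ?_
  simpa using (hasFDerivAt_apply (𝕜 := ℝ) i x).pow 2

lemma continuous_inv_one_add_sqNorm_pow (n : ℕ) :
    Continuous fun x : Fin 4 → ℝ => (1 + sqNorm x)⁻¹ ^ n := by
  have hpos : ∀ x, 1 + sqNorm x ≠ 0 := fun x => by linarith [sqNorm_nonneg x]
  exact ((continuous_const.add continuous_sqNorm).inv₀ hpos).pow n

lemma hasFDerivAt_inv_one_add_sqNorm_pow (n : ℕ) (x : Fin 4 → ℝ) :
    HasFDerivAt (fun x => (1 + sqNorm x)⁻¹ ^ n)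
      ((-n * (1 + sqNorm x)⁻¹ ^ (n + 1)) •
        ∑ i, (2 * x i) • (ContinuousLinearMap.proj i : (Fin 4 → ℝ) →L[ℝ] ℝ)) x := by
  have hpos : 1 + sqNorm x ≠ 0 := by linarith [sqNorm_nonneg x]
  have hc : -n * (1 + sqNorm x)⁻¹ ^ (n + 1) =
      n * (1 + sqNorm x)⁻¹ ^ (n - 1) * -((1 + sqNorm x) ^ 2)⁻¹ := by
    rcases n with _ | n
    · simp
    · rw [Nat.add_sub_cancel, inv_pow, inv_pow]
      field_simp
      ring
  rw [hc]
  exact HasDerivAt.comp_hasFDerivAt (f := fun x => 1 + sqNorm x) x ((hasDerivAt_inv hpos).pow n)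
    ((hasFDerivAt_sqNorm x).const_add 1)

lemma integral_inv_one_add_sqNorm_smul_laplacian {u : (Fin 4 → ℝ) → ℂ} (hu : ContDiff ℝ ∞ u)
    (huc : HasCompactSupport u) :
    ∫ w, (1 + sqNorm w)⁻¹ • ∑ i, pd4 (pd4 u i) i w =
      ∫ w, (-8 * (1 + sqNorm w)⁻¹ ^ 3) • u w := by
  have hpos : ∀ x, 1 + sqNorm x ≠ 0 := fun x => by linarith [sqNorm_nonneg x]
  let h' : Fin 4 → (Fin 4 → ℝ) → ℝ := fun i x => -2 * x i * (1 + sqNorm x)⁻¹ ^ 2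
  let h'' : Fin 4 → (Fin 4 → ℝ) → ℝ := fun i x =>
    -2 * (1 + sqNorm x)⁻¹ ^ 2 + 8 * x i ^ 2 * (1 + sqNorm x)⁻¹ ^ 3
  have hc'' : ∀ i, Continuous (h'' i) := fun i => by
    have := continuous_inv_one_add_sqNorm_pow 2
    have := continuous_inv_one_add_sqNorm_pow 3
    fun_prop
  have hd' : ∀ i x, HasFDerivAt (h' i) _ x := fun i x =>
    ((hasFDerivAt_apply (𝕜 := ℝ) i x).const_mul (-2)).mul
      (hasFDerivAt_inv_one_add_sqNorm_pow 2 x)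
  have hd : ∀ x, HasFDerivAt (fun x => (1 + sqNorm x)⁻¹) _ x := fun x => by
    simpa only [pow_one] using hasFDerivAt_inv_one_add_sqNorm_pow 1 x
  have key : ∀ i, ∫ x, (1 + sqNorm x)⁻¹ • pd4 (pd4 u i) i x = ∫ x, h'' i x • u x := fun i => by
    refine integral_smul_pd4_pd4 i hu huc (h' := h' i) (fun x => (hd x).differentiableAt)
      (fun x => (hd' i x).differentiableAt) (hc'' i) (fun x => ?_) (fun x => ?_)
    · rw [(hd x).fderiv]
      simp [h', Pi.single_apply]
      ring
    · rw [(hd' i x).fderiv]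
      simp [h'', Pi.single_apply]
      ring
  simp_rw [Finset.smul_sum]
  rw [integral_finsetSum]
  · simp_rw [key]
    rw [← integral_finsetSum]
    · refine integral_congr_ae (Eventually.of_forall fun x => ?_)
      simp only [← Finset.sum_smul]
      congr 1
      simp only [h'', Finset.sum_add_distrib, ← Finset.sum_mul, ← Finset.mul_sum]
      change _ + 8 * sqNorm x * _ = _
      have := hpos x
      simp
      field_simp
      ring
    · exact fun i _ => integrable_smul_of_hasCompactSupport (hc'' i) hu.continuous huc
  · exact fun i _ => integrable_smul_of_hasCompactSupport
      (by simpa using continuous_inv_one_add_sqNorm_pow 1) ((hu.pd4 i).pd4 i).continuous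
      ((huc.pd4 i).pd4 i)

lemma pd4_comp_add_smul {u : (Fin 4 → ℝ) → ℂ} (hu : Differentiable ℝ u) (x : Fin 4 → ℝ) (s : ℝ)
    (i : Fin 4) : pd4 (fun w => u (x + s • w)) i = fun w => s • pd4 u i (x + s • w) := by
  funext w
  have h := (hu (x + s • w)).hasFDerivAt.comp w
    (((hasFDerivAt_id (𝕜 := ℝ) w).const_smul s).const_add x)
  have h' : HasFDerivAt (fun w => u (x + s • w)) _ w := h
  rw [pd4, h'.fderiv, pd4]
  simp

lemma laplacian_comp_add_smul {u : (Fin 4 → ℝ) → ℂ} (hu : ContDiff ℝ ∞ u) (x w : Fin 4 → ℝ)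
    (s : ℝ) :
    ∑ i, pd4 (pd4 (fun w => u (x + s • w)) i) i w =
      s ^ 2 • ∑ i, pd4 (pd4 u i) i (x + s • w) := by
  rw [Finset.smul_sum]
  refine Finset.sum_congr rfl fun i _ => ?_
  have hd := (hu.pd4 i).differentiable (by simp)
  have hd' : Differentiable ℝ fun w => s • pd4 u i w := hd.const_smul s
  rw [pd4_comp_add_smul (hu.differentiable (by simp)),
    pd4_comp_add_smul (u := fun w => s • pd4 u i w) hd']
  have h := ((hd (x + s • w)).hasFDerivAt.const_smul s).fderiv
  change s • pd4 (s • pd4 u i) i (x + s • w) = _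
  rw [pd4, h, pd4]
  simp [pow_two, mul_assoc]

lemma integral_inv_add_sqNorm_smul_laplacian {u : (Fin 4 → ℝ) → ℂ} (hu : ContDiff ℝ ∞ u)
    (huc : HasCompactSupport u) (x : Fin 4 → ℝ) {s : ℝ} (hs : 0 < s) :
    ∫ y, (s ^ 2 + sqNorm (y - x))⁻¹ • ∑ i, pd4 (pd4 u i) i y =
      ∫ w, (-8 * (1 + sqNorm w)⁻¹ ^ 3) • u (x + s • w) := by
  have hus : ContDiff ℝ ∞ fun w => u (x + s • w) :=
    hu.comp (contDiff_const.add (contDiff_const_smul s))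
  have husc : HasCompactSupport fun w => u (x + s • w) :=
    huc.comp_homeomorph ((Homeomorph.smulOfNeZero s hs.ne').trans (Homeomorph.addLeft x))
  rw [← integral_inv_one_add_sqNorm_smul_laplacian hus husc,
    ← integral_add_left_eq_self _ x]
  have hscale := Measure.integral_comp_smul volume
    (fun y => (s ^ 2 + sqNorm (x + y - x))⁻¹ • ∑ i, pd4 (pd4 u i) i (x + y)) s
  have hs4 : s ^ 4 • |(s ^ Module.finrank ℝ (Fin 4 → ℝ))⁻¹| = 1 := by
    rw [Module.finrank_fin_fun, abs_of_pos (by positivity), smul_eq_mul,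
      mul_inv_cancel₀ (by positivity)]
  have hback := congrArg (s ^ 4 • ·) hscale
  simp only [← smul_assoc, hs4, one_smul] at hback
  rw [← hback, ← integral_smul]
  refine integral_congr_ae (Eventually.of_forall fun w => ?_)
  simp only [laplacian_comp_add_smul hu, smul_smul]
  congr 1
  have hq : sqNorm (x + s • w - x) = s ^ 2 * sqNorm w := by
    simp [sqNorm, mul_pow, Finset.mul_sum]
  have hpos : 1 + sqNorm w ≠ 0 := by linarith [sqNorm_nonneg w]
  have hpos' : s ^ 2 + s ^ 2 * sqNorm w ≠ 0 := by
    have := sqNorm_nonneg w; positivity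
  rw [hq]
  field_simp

lemma integrable_inv_one_add_sqNorm_pow :
    Integrable fun w : Fin 4 → ℝ => (1 + sqNorm w)⁻¹ ^ 3 := by
  have h := integrable_rpow_neg_one_add_norm_sq (E := Fin 4 → ℝ) (μ := volume) (r := 6)
    (by simp; norm_num)
  refine h.mono' (continuous_inv_one_add_sqNorm_pow 3).aestronglyMeasurable
    (Eventually.of_forall fun w => ?_)
  have h0 := sqNorm_nonneg w
  rw [Real.norm_of_nonneg (by positivity), show (-6 / 2 : ℝ) = -((3 : ℕ) : ℝ) by norm_num,
    Real.rpow_neg (by positivity), Real.rpow_natCast, inv_pow]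
  gcongr
  exact norm_sq_le_sqNorm w

lemma integral_inv_one_add_sqNorm_pow_pos : 0 < ∫ w : Fin 4 → ℝ, (1 + sqNorm w)⁻¹ ^ 3 := by
  have hp : ∀ w : Fin 4 → ℝ, 0 < (1 + sqNorm w)⁻¹ ^ 3 := fun w => by
    have := sqNorm_nonneg w; positivity
  refine (integral_pos_iff_support_of_nonneg (fun w => (hp w).le)
    integrable_inv_one_add_sqNorm_pow).2 ?_
  have : (Function.support fun w : Fin 4 → ℝ => (1 + sqNorm w)⁻¹ ^ 3) = Set.univ :=
    Set.eq_univ_of_forall fun w => (hp w).ne'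
  rw [this]
  simp

/-- The Newtonian potential of the Laplacian of a test function recovers the function outside the
support of the Laplacian. -/
lemma setIntegral_inv_sqNorm_smul_laplacian {u : (Fin 4 → ℝ) → ℂ} (hu : ContDiff ℝ ∞ u)
    (huc : HasCompactSupport u) {S : Set (Fin 4 → ℝ)} (hS : IsCompact S)
    (hSu : ∀ y ∉ S, ∑ i, pd4 (pd4 u i) i y = 0) {x : Fin 4 → ℝ} (hx : x ∉ S) :
    ∫ y in S, (sqNorm (y - x))⁻¹ • ∑ i, pd4 (pd4 u i) i y =
      (-8 * ∫ w : Fin 4 → ℝ, (1 + sqNorm w)⁻¹ ^ 3) • u x := by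
  set g : (Fin 4 → ℝ) → ℂ := fun y => ∑ i, pd4 (pd4 u i) i y
  have hg : Continuous g := continuous_finsetSum _ fun i _ => ((hu.pd4 i).pd4 i).continuous
  have hpos : ∀ y ∈ S, 0 < sqNorm (y - x) := fun y hy =>
    sqNorm_pos (sub_ne_zero.2 fun h => hx (h ▸ hy))
  have hq : Continuous fun y => sqNorm (y - x) :=
    continuous_sqNorm.comp (continuous_id.sub continuous_const)
  have hleft : Tendsto (fun s : ℝ => ∫ y in S, (s ^ 2 + sqNorm (y - x))⁻¹ • g y) (𝓝[>] 0)
      (𝓝 (∫ y in S, (sqNorm (y - x))⁻¹ • g y)) := by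
    refine tendsto_integral_filter_of_dominated_convergence
      (fun y => (sqNorm (y - x))⁻¹ * ‖g y‖) ?_ ?_ ?_ ?_
    · refine Eventually.of_forall fun s => ContinuousOn.aestronglyMeasurable ?_ hS.measurableSet
      exact ((continuous_const.add hq).continuousOn.inv₀
        fun y hy => (add_pos_of_nonneg_of_pos (sq_nonneg s) (hpos y hy)).ne').smul hg.continuousOn
    · refine Eventually.of_forall fun s => ?_
      filter_upwards [ae_restrict_mem hS.measurableSet] with y hy
      have := hpos y hy
      rw [norm_smul, Real.norm_of_nonneg (by positivity)]
      gcongr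
      exact le_add_of_nonneg_left (sq_nonneg s)
    · exact ((hq.continuousOn.inv₀ fun y hy => (hpos y hy).ne').mul
        hg.norm.continuousOn).integrableOn_compact hS
    · filter_upwards [ae_restrict_mem hS.measurableSet] with y hy
      have hc : ContinuousAt (fun s : ℝ => (s ^ 2 + sqNorm (y - x))⁻¹ • g y) 0 := by
        have : (0 : ℝ) ^ 2 + sqNorm (y - x) ≠ 0 := by have := hpos y hy; positivity
        exact ((by fun_prop : ContinuousAt (fun s : ℝ => s ^ 2 + sqNorm (y - x)) 0).inv₀
          this).smul continuousAt_const
      simpa using hc.tendsto.mono_left nhdsWithin_le_nhds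
  have hright : Tendsto (fun s : ℝ => ∫ w, (-8 * (1 + sqNorm w)⁻¹ ^ 3) • u (x + s • w)) (𝓝[>] 0)
      (𝓝 (∫ w, (-8 * (1 + sqNorm w)⁻¹ ^ 3) • u x)) := by
    obtain ⟨M, hM⟩ := huc.exists_bound_of_continuous hu.continuous
    have hc : Continuous fun w : Fin 4 → ℝ => (-8 * (1 + sqNorm w)⁻¹ ^ 3) :=
      continuous_const.mul (continuous_inv_one_add_sqNorm_pow 3)
    refine tendsto_integral_filter_of_dominated_convergence
      (fun w => ‖-8 * (1 + sqNorm w)⁻¹ ^ 3‖ * M) ?_ ?_ ?_ ?_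
    · refine Eventually.of_forall fun s => Continuous.aestronglyMeasurable ?_
      exact hc.smul (hu.continuous.comp (by fun_prop))
    · refine Eventually.of_forall fun s => Eventually.of_forall fun w => ?_
      rw [norm_smul]
      gcongr
      exact hM _
    · exact ((integrable_inv_one_add_sqNorm_pow.const_mul (-8)).norm).mul_const M
    · refine Eventually.of_forall fun w => ?_
      have hl : Continuous fun s : ℝ => x + s • w := by fun_prop
      have hcs : Continuous fun s : ℝ => (-8 * (1 + sqNorm w)⁻¹ ^ 3) • u (x + s • w) :=
        (hu.continuous.comp hl).fun_const_smul _
      simpa using (hcs.tendsto 0).mono_left nhdsWithin_le_nhds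
  have heq : (fun s : ℝ => ∫ y in S, (s ^ 2 + sqNorm (y - x))⁻¹ • g y) =ᶠ[𝓝[>] 0]
      fun s => ∫ w, (-8 * (1 + sqNorm w)⁻¹ ^ 3) • u (x + s • w) := by
    filter_upwards [self_mem_nhdsWithin] with s hs
    rw [← integral_inv_add_sqNorm_smul_laplacian hu huc x hs]
    refine setIntegral_eq_integral_of_forall_compl_eq_zero fun y hy => ?_
    rw [show g y = 0 from hSu y hy, smul_zero]
  rw [tendsto_nhds_unique (hleft.congr' heq) hright, integral_smul_const, integral_const_mul]

lemma isometry_inclR : Isometry inclR :=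
  Isometry.of_dist_eq fun x y => by
    simp only [inclR, dist_pi_def, Complex.isometry_ofReal.nndist_eq]

lemma inclR_mem_ball {p x : Fin 4 → ℝ} {r : ℝ} : inclR p ∈ ball (inclR x) r ↔ p ∈ ball x r := by
  rw [mem_ball, mem_ball, isometry_inclR.dist_eq]

lemma inclR_re_mem_ball {z : Fin 4 → ℂ} {x : Fin 4 → ℝ} {r : ℝ} (hz : z ∈ ball (inclR x) r) :
    inclR (fun i => (z i).re) ∈ ball (inclR x) r := by
  have hr : 0 < r := pos_of_mem_ball hz
  rw [inclR_mem_ball, mem_ball, dist_pi_lt_iff hr]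
  rw [mem_ball, dist_pi_lt_iff hr] at hz
  refine fun i => lt_of_le_of_lt ?_ (hz i)
  rw [Real.dist_eq, Complex.dist_eq]
  simpa [inclR] using Complex.abs_re_le_norm (z i - inclR x i)

/-- The complex quadratic form stays in the right half-plane for complex points near the centre of
a ball and real points far from it. -/
lemma re_sum_sq_sub_inclR_pos {x₀ y : Fin 4 → ℝ} {z : Fin 4 → ℂ} {δ : ℝ} (hδ : 0 < δ)
    (hz : z ∈ ball (inclR x₀) (δ / 4)) (hy : y ∉ ball x₀ δ) :
    0 < (∑ i, (z - inclR y) i ^ 2).re := by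
  rw [mem_ball, dist_pi_lt_iff (by positivity)] at hz
  have hre : ∀ i, |(z i).re - x₀ i| < δ / 4 := fun i => by
    refine lt_of_le_of_lt ?_ (hz i)
    rw [Complex.dist_eq]
    simpa [inclR] using Complex.abs_re_le_norm (z i - inclR x₀ i)
  have him : ∀ i, |(z i).im| < δ / 4 := fun i => by
    refine lt_of_le_of_lt ?_ (hz i)
    rw [Complex.dist_eq]
    simpa [inclR] using Complex.abs_im_le_norm (z i - inclR x₀ i)
  rw [mem_ball, dist_pi_lt_iff hδ] at hy
  push Not at hy
  obtain ⟨j, hj⟩ := hy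
  rw [Real.dist_eq] at hj
  have h1 : (3 * δ / 4) ^ 2 ≤ ((z j).re - y j) ^ 2 := by
    rw [← sq_abs ((z j).re - y j)]
    refine pow_le_pow_left₀ (by positivity) ?_ 2
    have h3 := abs_sub_le (y j) (z j).re (x₀ j)
    rw [abs_sub_comm (y j) (z j).re] at h3
    linarith [hre j]
  have h2 : ((z j).re - y j) ^ 2 ≤ ∑ i, ((z i).re - y i) ^ 2 :=
    Finset.single_le_sum (f := fun i => ((z i).re - y i) ^ 2) (fun i _ => sq_nonneg _)
      (Finset.mem_univ j)
  have h3 : ∑ i, (z i).im ^ 2 ≤ ∑ _i : Fin 4, (δ / 4) ^ 2 :=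
    Finset.sum_le_sum fun i _ => by
      rw [← sq_abs]; exact pow_le_pow_left₀ (abs_nonneg _) (him i).le 2
  have h4 : (∑ i, (z - inclR y) i ^ 2).re =
      ∑ i, ((z i).re - y i) ^ 2 - ∑ i, (z i).im ^ 2 := by
    rw [Complex.re_sum, ← Finset.sum_sub_distrib]
    refine Finset.sum_congr rfl fun i _ => ?_
    simp [inclR, pow_two]
  rw [h4]
  simp at h3
  nlinarith [pow_pos hδ 2]

/-- A harmonic function extends holomorphically to a complex ball around each real point, together
with its first and pure second derivatives. -/
lemma exists_holomorphic_extension_ball {A : Set (Fin 4 → ℝ)} (hA : IsOpen A)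
    {f : (Fin 4 → ℝ) → ℂ} (hf : ContDiffOn ℝ ∞ f A)
    (hharm : ∀ x ∈ A, ∑ i, pd4 (pd4 f i) i x = 0) {x₀ : Fin 4 → ℝ} (hx₀ : x₀ ∈ A) :
    ∃ (r : ℝ) (φ : (Fin 4 → ℂ) → ℂ), 0 < r ∧ ball x₀ r ⊆ A ∧
      (∀ z ∈ ball (inclR x₀) r, DifferentiableAt ℂ φ z ∧
        ∀ i, DifferentiableAt ℂ (cd φ i) z ∧ DifferentiableAt ℂ (cd (cd φ i) i) z) ∧
      ∀ x ∈ ball x₀ r, φ (inclR x) = f x := by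
  obtain ⟨ε, hε, hεA⟩ := nhds_basis_closedBall.mem_iff.1 (hA.mem_nhds hx₀)
  set δ := ε / 2
  have hδ : 0 < δ := by positivity
  have hδε : δ < ε := by simp only [δ]; linarith
  let χ : ContDiffBump x₀ := ⟨δ, ε, hδ, hδε⟩
  let u : (Fin 4 → ℝ) → ℂ := fun y => χ y • f y
  have hts : tsupport u ⊆ closedBall x₀ ε :=
    (tsupport_smul_subset_left _ _).trans χ.tsupport_eq.subset
  have hu : ContDiff ℝ ∞ u := contDiff_iff_contDiffAt.2 fun y => by
    by_cases hy : y ∈ tsupport u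
    · exact χ.contDiffAt.smul (hf.contDiffAt (hA.mem_nhds (hεA (hts hy))))
    · exact contDiffAt_const.congr_of_eventuallyEq (notMem_tsupport_iff_eventuallyEq.1 hy)
  have huc : HasCompactSupport u := χ.hasCompactSupport.smul_right
  have huf : ∀ y ∈ ball x₀ δ, u =ᶠ[𝓝 y] f := fun y hy => by
    filter_upwards [isOpen_ball.mem_nhds hy] with w hw
    simp [u, χ.one_of_mem_closedBall (ball_subset_closedBall hw)]
  let S := closedBall x₀ ε \ ball x₀ δ
  have hS : IsCompact S := (isCompact_closedBall x₀ ε).diff isOpen_ball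
  have hSu : ∀ y ∉ S, ∑ i, pd4 (pd4 u i) i y = 0 := fun y hy => by
    by_cases hb : y ∈ ball x₀ δ
    · rw [← hharm y (hεA (ball_subset_closedBall (ball_subset_ball hδε.le hb)))]
      exact Finset.sum_congr rfl fun i _ => (((huf y hb).pd4 i).pd4 i).eq_of_nhds
    · have hy' : y ∉ tsupport u := fun h => hy ⟨hts h, hb⟩
      refine Finset.sum_eq_zero fun i _ => ?_
      rw [(((notMem_tsupport_iff_eventuallyEq.1 hy').pd4 i).pd4 i).eq_of_nhds]
      have h0 : pd4 0 i = 0 := by funext w; simp [pd4]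
      rw [h0, h0, Pi.zero_apply]
  set c : ℝ := -8 * ∫ w : Fin 4 → ℝ, (1 + sqNorm w)⁻¹ ^ 3
  have hc : c ≠ 0 := mul_ne_zero (by norm_num) integral_inv_one_add_sqNorm_pow_pos.ne'
  let g : (Fin 4 → ℝ) → ℂ := fun y => c⁻¹ • ∑ i, pd4 (pd4 u i) i y
  have hg : Continuous g :=
    (continuous_finsetSum _ fun i _ => ((hu.pd4 i).pd4 i).continuous).fun_const_smul _
  let K : (Fin 4 → ℂ) → ℂ := fun z => (∑ i, z i ^ 2)⁻¹
  let V : Set (Fin 4 → ℂ) := {z | 0 < (∑ i, z i ^ 2).re}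
  have hV : IsOpen V := isOpen_lt continuous_const (by fun_prop)
  have hK : ContDiffOn ℂ ∞ K V := by
    refine ContDiffOn.inv (ContDiff.contDiffOn (by fun_prop)) fun z hz h => ?_
    have hz' : 0 < (∑ i, z i ^ 2).re := hz
    simp [h] at hz'
  let U : Set (Fin 4 → ℂ) := ball (inclR x₀) (δ / 4)
  have hU : IsOpen U := isOpen_ball
  have hUS : ∀ z ∈ U, ∀ y ∈ S, z - inclR y ∈ V := fun z hz y hy =>
    re_sum_sq_sub_inclR_pos hδ hz hy.2
  let Φ : ((Fin 4 → ℂ) → ℂ) → (Fin 4 → ℂ) → ℂ := fun L z => ∫ y in S, g y * L (z - inclR y)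
  have hΦ : ∀ {L}, ContDiffOn ℂ ∞ L V → ∀ z ∈ U, DifferentiableAt ℂ (Φ L) z := fun hL z hz =>
    (hasFDerivAt_setIntegral_mul_comp_sub hV hL hU hS hg hUS hz).2.differentiableAt
  have hcd : ∀ {L}, ContDiffOn ℂ ∞ L V → ∀ i, ∀ z ∈ U, cd (Φ L) i =ᶠ[𝓝 z] Φ (cd L i) :=
    fun hL i z hz => by
      filter_upwards [hU.mem_nhds hz] with w hw
      exact cd_setIntegral_mul_comp_sub hV hL hU hS hg hUS i hw
  refine ⟨δ / 4, Φ K, by positivity, ?_, fun z hz => ⟨hΦ hK z hz, fun i => ⟨?_, ?_⟩⟩,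
    fun x hx => ?_⟩
  · exact (ball_subset_ball (by linarith)).trans (ball_subset_closedBall.trans hεA)
  · exact (hcd hK i z hz).differentiableAt_iff.2 (hΦ (hK.cd hV i) z hz)
  · exact (((hcd hK i z hz).cd i).trans (hcd (hK.cd hV i) i z hz)).differentiableAt_iff.2
      (hΦ ((hK.cd hV i).cd hV i) z hz)
  · have hxδ : x ∈ ball x₀ δ := ball_subset_ball (by linarith) hx
    have hrep := setIntegral_inv_sqNorm_smul_laplacian hu huc hS hSu (x := x) fun h => h.2 hxδ
    have hux : u x = f x := (huf x hxδ).eq_of_nhds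
    rw [hux] at hrep
    have hker : ∀ y, g y * K (inclR x - inclR y) =
        c⁻¹ • ((sqNorm (y - x))⁻¹ • ∑ i, pd4 (pd4 u i) i y) := fun y => by
      have : ∑ i, (inclR x - inclR y) i ^ 2 = (sqNorm (y - x) : ℂ) := by
        simp only [sqNorm, inclR, Pi.sub_apply]
        push_cast
        exact Finset.sum_congr rfl fun i _ => by ring
      simp only [g, K, this, Complex.real_smul]
      push_cast
      ring
    simp only [Φ, hker]
    rw [integral_smul, hrep, smul_smul, inv_mul_cancel₀ hc, one_smul]

/-- any smooth Euclidean harmonic morphism on an open subset `A⁴` of `ℝ⁴`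
extends to a holomorphic complex-harmonic morphism on an open subset `A^C` of `ℂ⁴` with
`A^C ∩ ℝ⁴ = A⁴`. -/
theorem euclidean_harmonic_morphism_extends_to_complex
    (A4 : Set (Fin 4 → ℝ)) (hA4 : IsOpen A4)
    (f : (Fin 4 → ℝ) → ℂ)
    (hf_smooth : ContDiffOn ℝ (⊤ : ℕ∞) f A4)
    (hf_harm : ∀ x ∈ A4,
      pd4 (pd4 f 0) 0 x + pd4 (pd4 f 1) 1 x + pd4 (pd4 f 2) 2 x + pd4 (pd4 f 3) 3 x = 0)
    (hf_hwc : ∀ x ∈ A4,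
      (pd4 f 0 x) ^ 2 + (pd4 f 1 x) ^ 2 + (pd4 f 2 x) ^ 2 + (pd4 f 3 x) ^ 2 = 0) :
    ∃ (AC : Set (Fin 4 → ℂ)) (φ : (Fin 4 → ℂ) → ℂ),
      IsOpen AC ∧
      AC ∩ Set.range inclR = inclR '' A4 ∧
      (∀ x ∈ AC, DifferentiableAt ℂ φ x) ∧
      (∀ x ∈ A4, φ (inclR x) = f x) ∧
      (∀ x ∈ AC,
        cd (cd φ 0) 0 x + cd (cd φ 1) 1 x + cd (cd φ 2) 2 x + cd (cd φ 3) 3 x = 0) ∧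
      (∀ x ∈ AC,
        (cd φ 0 x) ^ 2 + (cd φ 1 x) ^ 2 + (cd φ 2 x) ^ 2 + (cd φ 3 x) ^ 2 = 0) := by
  have hharm : ∀ x ∈ A4, ∑ i, pd4 (pd4 f i) i x = 0 := fun x hx => by
    rw [Fin.sum_univ_four]; exact hf_harm x hx
  choose! r φ hr hrA hφd hφf using fun x (hx : x ∈ A4) =>
    exists_holomorphic_extension_ball hA4 hf_smooth hharm hx
  let B : (Fin 4 → ℝ) → Set (Fin 4 → ℂ) := fun x => ball (inclR x) (r x)
  have hagree : ∀ x ∈ A4, ∀ y ∈ A4, ∀ z ∈ B x ∩ B y, φ x z = φ y z := by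
    intro x hx y hy z hz
    refine sub_eq_zero.1 (eq_zero_of_eq_zero_on_real (U := B x ∩ B y)
      (h := fun z => φ x z - φ y z) (isOpen_ball.inter isOpen_ball)
      ((convex_ball _ _).inter (convex_ball _ _))
      (fun w hw => (hφd x hx w hw.1).1.sub (hφd y hy w hw.2).1) (fun p hp => ?_) hz
      ⟨inclR_re_mem_ball hz.1, inclR_re_mem_ball hz.2⟩)
    rw [hφf x hx p (inclR_mem_ball.1 hp.1), hφf y hy p (inclR_mem_ball.1 hp.2), sub_self]
  have hpd : ∀ x ∈ A4, ∀ p ∈ ball x (r x), ∀ i, cd (φ x) i (inclR p) = pd4 f i p :=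
    fun x hx p hp i => cd_inclR_eq_pd4 (hφd x hx _ (inclR_mem_ball.2 hp)).1
      (by filter_upwards [isOpen_ball.mem_nhds hp] with q hq using hφf x hx q hq) i
  have hpd2 : ∀ x ∈ A4, ∀ p ∈ ball x (r x), ∀ i,
      cd (cd (φ x) i) i (inclR p) = pd4 (pd4 f i) i p :=
    fun x hx p hp i => cd_inclR_eq_pd4 ((hφd x hx _ (inclR_mem_ball.2 hp)).2 i).1
      (by filter_upwards [isOpen_ball.mem_nhds hp] with q hq using hpd x hx q hq i) i
  have hlap : ∀ x ∈ A4, ∀ z ∈ B x, ∑ i, cd (cd (φ x) i) i z = 0 := by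
    intro x hx z hz
    refine eq_zero_of_eq_zero_on_real (h := fun z => ∑ i, cd (cd (φ x) i) i z) isOpen_ball
      (convex_ball _ _) (fun w hw => ?_) (fun p hp => ?_) hz (inclR_re_mem_ball hz)
    · exact DifferentiableAt.fun_sum fun i _ => ((hφd x hx w hw).2 i).2
    · have hp' := inclR_mem_ball.1 hp
      simp only [hpd2 x hx p hp']
      exact hharm p (hrA x hx hp')
  have hconf : ∀ x ∈ A4, ∀ z ∈ B x, ∑ i, cd (φ x) i z ^ 2 = 0 := by
    intro x hx z hz
    refine eq_zero_of_eq_zero_on_real (h := fun z => ∑ i, cd (φ x) i z ^ 2) isOpen_ball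
      (convex_ball _ _) (fun w hw => ?_) (fun p hp => ?_) hz (inclR_re_mem_ball hz)
    · exact DifferentiableAt.fun_sum fun i _ => ((hφd x hx w hw).2 i).1.pow 2
    · have hp' := inclR_mem_ball.1 hp
      simp only [hpd x hx p hp', Fin.sum_univ_four]
      exact hf_hwc p (hrA x hx hp')
  classical
  let ψ : (Fin 4 → ℂ) → ℂ := fun z =>
    if h : ∃ x ∈ A4, z ∈ B x then φ h.choose z else 0
  have hψ : ∀ x ∈ A4, ∀ z ∈ B x, ψ z = φ x z := by
    intro x hx z hz
    have h : ∃ x ∈ A4, z ∈ B x := ⟨x, hx, hz⟩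
    simp only [ψ, dif_pos h]
    exact hagree _ h.choose_spec.1 x hx z ⟨h.choose_spec.2, hz⟩
  have hψe : ∀ x ∈ A4, ∀ z ∈ B x, ψ =ᶠ[𝓝 z] φ x := fun x hx z hz => by
    filter_upwards [isOpen_ball.mem_nhds hz] with w hw using hψ x hx w hw
  have hself : ∀ x ∈ A4, inclR x ∈ B x := fun x hx => mem_ball_self (hr x hx)
  refine ⟨⋃ x ∈ A4, B x, ψ, isOpen_biUnion fun x _ => isOpen_ball, ?_, ?_, fun x hx => ?_, ?_, ?_⟩
  · ext z
    simp only [Set.mem_inter_iff, Set.mem_iUnion, Set.mem_range, Set.mem_image]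
    constructor
    · rintro ⟨⟨x, hx, hz⟩, p, rfl⟩
      exact ⟨p, hrA x hx (inclR_mem_ball.1 hz), rfl⟩
    · rintro ⟨p, hp, rfl⟩
      exact ⟨⟨p, hp, hself p hp⟩, p, rfl⟩
  · intro z hz
    obtain ⟨x, hx, hz⟩ := Set.mem_iUnion₂.1 hz
    exact (hψe x hx z hz).differentiableAt_iff.2 (hφd x hx z hz).1
  · rw [hψ x hx _ (hself x hx), hφf x hx x (mem_ball_self (hr x hx))]
  · intro z hz
    obtain ⟨x, hx, hz⟩ := Set.mem_iUnion₂.1 hz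
    simp only [fun i => (((hψe x hx z hz).cd i).cd i).eq_of_nhds]
    simpa only [Fin.sum_univ_four] using hlap x hx z hz
  · intro z hz
    obtain ⟨x, hx, hz⟩ := Set.mem_iUnion₂.1 hz
    simp only [fun i => ((hψe x hx z hz).cd i).eq_of_nhds]
    simpa only [Fin.sum_univ_four] using hconf x hx z hz
end

section
/- Let A^M ⊆ 𝕄⁴ be open and let f : A^M → ℂ be a real-analytic Minkowski harmonic morphism, i.e. −∂²f/∂t² + Σᵢ₌₁³ ∂²f/∂xᵢ² = 0 and −(∂f/∂t)² + Σᵢ₌₁³ (∂f/∂xᵢ)² = 0 on A^M. Let ι_M : ℝ⁴ → ℂ⁴ be the embedding (t,x₁,x₂,x₃) ↦ (−i t, x₁, x₂, x₃). Then there exist an open set A^C ⊆ ℂ⁴ with A^C ∩ ι_M(ℝ⁴) = ι_M(A^M) and a holomorphic map φ : A^C → ℂ with φ∘ι_M = f on A^M, such that φ is a complex-harmonic morphism: Σᵢ₌₀³ ∂²φ/∂xᵢ² = 0 and Σᵢ₌₀³ (∂φ/∂xᵢ)² = 0 on A^C (complex directional derivatives). -/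
open Complex

/-- The embedding `𝕄⁴ → ℂ⁴`, `(t,x₁,x₂,x₃) ↦ (−i t, x₁, x₂, x₃)`. -/
def inclM (x : Fin 4 → ℝ) : Fin 4 → ℂ :=
  fun i => if i = 0 then -Complex.I * (x 0 : ℂ) else (x i : ℂ)

/-- The factor by which `inclM` multiplies the `i`-th coordinate. -/
noncomputable def wickFactor (i : Fin 4) : ℂ := if i = 0 then -Complex.I else 1

lemma norm_wickFactor (i : Fin 4) : ‖wickFactor i‖ = 1 := by
  unfold wickFactor; split_ifs <;> simp

lemma wickFactor_ne_zero (i : Fin 4) : wickFactor i ≠ 0 := by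
  rw [← norm_ne_zero_iff, norm_wickFactor]; exact one_ne_zero

lemma inclM_apply (x : Fin 4 → ℝ) (i : Fin 4) : inclM x i = wickFactor i * (x i : ℂ) := by
  unfold inclM wickFactor
  split_ifs with h <;> simp [h]

/-- `inclM` as a continuous real-linear map. -/
noncomputable def inclMCLM : (Fin 4 → ℝ) →L[ℝ] (Fin 4 → ℂ) :=
  LinearMap.toContinuousLinearMap
    { toFun := inclM
      map_add' := fun x y => by ext i; simp [inclM_apply, mul_add]
      map_smul' := fun c x => by ext i; simp [inclM_apply, mul_left_comm] }

@[simp] lemma inclMCLM_apply (x : Fin 4 → ℝ) : inclMCLM x = inclM x := rfl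

lemma inclM_sub (x y : Fin 4 → ℝ) : inclM (x - y) = inclM x - inclM y :=
  inclMCLM.map_sub x y

lemma inclM_smul (c : ℝ) (x : Fin 4 → ℝ) : inclM (c • x) = c • inclM x :=
  inclMCLM.map_smul c x

lemma inclM_add (x y : Fin 4 → ℝ) : inclM (x + y) = inclM x + inclM y :=
  inclMCLM.map_add x y

lemma norm_inclM_le (x : Fin 4 → ℝ) : ‖inclM x‖ ≤ ‖x‖ := by
  refine (pi_norm_le_iff_of_nonneg (norm_nonneg x)).2 fun i => ?_
  rw [inclM_apply, norm_mul, norm_wickFactor, one_mul, Complex.norm_real]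
  exact norm_le_pi_norm x i

/-- The complex-linear coordinate on `ℂ⁴` that restricts to the `i`-th coordinate along `inclM`. -/
noncomputable def wickCoord (i : Fin 4) : (Fin 4 → ℂ) →L[ℂ] ℂ :=
  (wickFactor i)⁻¹ • ContinuousLinearMap.proj i

lemma wickCoord_apply (i : Fin 4) (z : Fin 4 → ℂ) : wickCoord i z = (wickFactor i)⁻¹ * z i := rfl

lemma wickCoord_inclM (i : Fin 4) (x : Fin 4 → ℝ) : wickCoord i (inclM x) = x i := by
  rw [wickCoord_apply, inclM_apply, inv_mul_cancel_left₀ (wickFactor_ne_zero i)]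

lemma norm_wickCoord_apply_le (i : Fin 4) (z : Fin 4 → ℂ) : ‖wickCoord i z‖ ≤ ‖z‖ := by
  rw [wickCoord_apply, norm_mul, norm_inv, norm_wickFactor, inv_one, one_mul]
  exact norm_le_pi_norm z i

lemma norm_wickCoord_le (i : Fin 4) : ‖wickCoord i‖ ≤ 1 :=
  ContinuousLinearMap.opNorm_le_bound _ zero_le_one fun z => by
    simpa using norm_wickCoord_apply_le i z

/-- The real part of a point of `ℂ⁴` with respect to the real form `inclM`. -/
noncomputable def wickRe (z : Fin 4 → ℂ) : Fin 4 → ℝ := fun i => (wickCoord i z).re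

/-- The imaginary part of a point of `ℂ⁴` with respect to the real form `inclM`. -/
noncomputable def wickIm (z : Fin 4 → ℂ) : Fin 4 → ℝ := fun i => (wickCoord i z).im

lemma inclM_wickRe_add_wickIm (z : Fin 4 → ℂ) :
    inclM (wickRe z) + Complex.I • inclM (wickIm z) = z := by
  ext i
  have h : ((wickCoord i z).re : ℂ) + (wickCoord i z).im * Complex.I = wickCoord i z :=
    Complex.re_add_im _
  simp only [Pi.add_apply, Pi.smul_apply, inclM_apply, smul_eq_mul, wickRe, wickIm]
  calc _ = wickFactor i * (((wickCoord i z).re : ℂ) + (wickCoord i z).im * Complex.I) := by ring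
    _ = z i := by rw [h, wickCoord_apply, mul_inv_cancel_left₀ (wickFactor_ne_zero i)]

lemma dist_wickRe_le (x : Fin 4 → ℝ) (z : Fin 4 → ℂ) : dist (wickRe z) x ≤ dist z (inclM x) := by
  rw [dist_eq_norm, dist_eq_norm]
  refine (pi_norm_le_iff_of_nonneg (norm_nonneg _)).2 fun i => ?_
  calc ‖(wickRe z - x) i‖ = |(wickCoord i (z - inclM x)).re| := by
        simp [wickRe, wickCoord_inclM, Real.norm_eq_abs]
    _ ≤ ‖wickCoord i (z - inclM x)‖ := Complex.abs_re_le_norm _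
    _ ≤ ‖z - inclM x‖ := norm_wickCoord_apply_le _ _

lemma wickRe_inclM (x : Fin 4 → ℝ) : wickRe (inclM x) = x := by
  ext i; simp [wickRe, wickCoord_inclM]

lemma dist_inclM_le (x y : Fin 4 → ℝ) : dist (inclM x) (inclM y) ≤ dist x y := by
  rw [dist_eq_norm, dist_eq_norm, ← inclM_sub]; exact norm_inclM_le _

lemma inclM_mem_ball_iff {x p : Fin 4 → ℝ} {r : ℝ} :
    inclM x ∈ Metric.ball (inclM p) r ↔ x ∈ Metric.ball p r := by
  refine ⟨fun h => ?_, fun h => (dist_inclM_le x p).trans_lt h⟩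
  have := (dist_wickRe_le p (inclM x)).trans_lt h
  rwa [wickRe_inclM] at this

lemma inclM_wickRe_mem_ball {p : Fin 4 → ℝ} {r : ℝ} {z : Fin 4 → ℂ}
    (hz : z ∈ Metric.ball (inclM p) r) : inclM (wickRe z) ∈ Metric.ball (inclM p) r :=
  inclM_mem_ball_iff.2 ((dist_wickRe_le p z).trans_lt hz)

/-- A holomorphic function on a convex open set stable under taking real parts vanishes if it
vanishes at the real points of that set. -/
lemma eq_zero_of_eq_zero_on_inclM {V : Set (Fin 4 → ℂ)} (hVo : IsOpen V) (hVc : Convex ℝ V)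
    (hVre : ∀ z ∈ V, inclM (wickRe z) ∈ V) {g : (Fin 4 → ℂ) → ℂ} (hg : DifferentiableOn ℂ g V)
    (h0 : ∀ x, inclM x ∈ V → g (inclM x) = 0) : ∀ z ∈ V, g z = 0 := by
  intro z hz
  set a := wickRe z
  set b := wickIm z
  let l : ℂ → (Fin 4 → ℂ) := fun w => inclM a + w • inclM b
  have hl : Differentiable ℂ l := by fun_prop
  have hWo : IsOpen (l ⁻¹' V) := hVo.preimage hl.continuous
  have hWc : Convex ℝ (l ⁻¹' V) := by
    intro u hu v hv s t hs ht hst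
    have : l (s • u + t • v) = s • l u + t • l v := by
      ext i
      have hst' : (s : ℂ) + t = 1 := by exact_mod_cast hst
      simp only [l, Pi.add_apply, Pi.smul_apply, smul_eq_mul, Complex.real_smul]
      linear_combination (-inclM a i) * hst'
    rw [Set.mem_preimage, this]
    exact hVc hu hv hs ht hst
  have h0W : (0 : ℂ) ∈ l ⁻¹' V := by
    simpa [l] using hVre z hz
  have hIW : l Complex.I = z := inclM_wickRe_add_wickIm z
  have han : AnalyticOnNhd ℂ (g ∘ l) (l ⁻¹' V) :=
    (hg.comp hl.differentiableOn (Set.mapsTo_preimage l V)).analyticOnNhd hWo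
  have hreal : ∀ᶠ t : ℝ in nhdsWithin 0 {0}ᶜ, (g ∘ l) (t : ℂ) = 0 := by
    have : ∀ᶠ t : ℝ in nhds 0, (t : ℂ) ∈ l ⁻¹' V :=
      Complex.continuous_ofReal.continuousAt.eventually
        (by rw [Complex.ofReal_zero]; exact hWo.mem_nhds h0W)
    filter_upwards [this.filter_mono nhdsWithin_le_nhds] with t ht
    have hlt : l (t : ℂ) = inclM (a + t • b) := by
      simp only [l, inclM_add, inclM_smul]
      ext i; simp
    rw [Set.mem_preimage, hlt] at ht
    rw [Function.comp_apply, hlt, h0 _ ht]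
  have hfreq : ∃ᶠ w in nhdsWithin (0 : ℂ) {0}ᶜ, (g ∘ l) w = 0 := by
    have ht : Filter.Tendsto (fun t : ℝ => (t : ℂ)) (nhdsWithin 0 {0}ᶜ) (nhdsWithin 0 {0}ᶜ) := by
      refine tendsto_nhdsWithin_iff.2 ⟨?_, ?_⟩
      · simpa using (Complex.continuous_ofReal.tendsto 0).mono_left nhdsWithin_le_nhds
      · filter_upwards [self_mem_nhdsWithin] with t ht
        simpa using ht
    exact ht.frequently hreal.frequently
  have := han.eqOn_zero_of_preconnected_of_frequently_eq_zero hWc.isPreconnected h0W hfreq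
    (show Complex.I ∈ l ⁻¹' V by rwa [Set.mem_preimage, hIW])
  simpa [hIW] using this

/-- The complexification of a real formal multilinear series along `inclM`. -/
noncomputable def complexifySeries (P : FormalMultilinearSeries ℝ (Fin 4 → ℝ) ℂ) :
    FormalMultilinearSeries ℂ (Fin 4 → ℂ) ℂ := fun n =>
  ∑ s : Fin n → Fin 4, P n (fun i => Pi.single (s i) 1) •
    (ContinuousMultilinearMap.mkPiAlgebra ℂ (Fin n) ℂ).compContinuousLinearMap
      (fun i => wickCoord (s i))

lemma complexifySeries_inclM (P : FormalMultilinearSeries ℝ (Fin 4 → ℝ) ℂ) (n : ℕ)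
    (x : Fin 4 → ℝ) : complexifySeries P n (fun _ => inclM x) = P n (fun _ => x) := by
  have hx : x = ∑ j, x j • (Pi.single j 1 : Fin 4 → ℝ) := by
    ext i; simp [Finset.sum_apply, Pi.single_apply]
  conv_rhs => rw [hx]
  rw [ContinuousMultilinearMap.map_sum]
  simp only [complexifySeries, sum_apply,
    smul_apply, ContinuousMultilinearMap.compContinuousLinearMap_apply,
    ContinuousMultilinearMap.mkPiAlgebra_apply, wickCoord_inclM]
  refine Finset.sum_congr rfl fun s _ => ?_
  rw [ContinuousMultilinearMap.map_smul_univ, smul_eq_mul, Complex.real_smul, mul_comm]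
  simp

lemma norm_complexifySeries_le (P : FormalMultilinearSeries ℝ (Fin 4 → ℝ) ℂ) (n : ℕ) :
    ‖complexifySeries P n‖ ≤ 4 ^ n * ‖P n‖ := by
  have hterm : ∀ s : Fin n → Fin 4, ‖P n (fun i => Pi.single (s i) 1) •
      (ContinuousMultilinearMap.mkPiAlgebra ℂ (Fin n) ℂ).compContinuousLinearMap
        (fun i => wickCoord (s i))‖ ≤ ‖P n‖ := by
    intro s
    have h1 : ‖P n (fun i => Pi.single (s i) 1)‖ ≤ ‖P n‖ := by
      simpa [Pi.norm_single] using (P n).le_opNorm (fun i => (Pi.single (s i) 1 : Fin 4 → ℝ))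
    have h2 : ‖(ContinuousMultilinearMap.mkPiAlgebra ℂ (Fin n) ℂ).compContinuousLinearMap
        (fun i => wickCoord (s i))‖ ≤ 1 := by
      refine (ContinuousMultilinearMap.norm_compContinuousLinearMap_le _ _).trans ?_
      rw [ContinuousMultilinearMap.norm_mkPiAlgebra, one_mul]
      exact Finset.prod_le_one (fun _ _ => norm_nonneg _) fun i _ => norm_wickCoord_le _
    rw [norm_smul]
    simpa using mul_le_mul h1 h2 (norm_nonneg _) (norm_nonneg _)
  refine (norm_sum_le_of_le _ fun s _ => hterm s).trans ?_
  simp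

lemma complexifySeries_radius_pos {P : FormalMultilinearSeries ℝ (Fin 4 → ℝ) ℂ}
    (hP : 0 < P.radius) : 0 < (complexifySeries P).radius := by
  obtain ⟨C, r, hC, hr, h⟩ := P.le_mul_pow_of_radius_pos hP
  let ρ : NNReal := ⟨(4 * r)⁻¹, by positivity⟩
  have hρ : 0 < ρ := show (0 : ℝ) < (4 * r)⁻¹ by positivity
  refine (ENNReal.coe_pos.2 hρ).trans_le ((complexifySeries P).le_radius_of_bound C fun n => ?_)
  have hρr : (ρ : ℝ) = (4 * r)⁻¹ := rfl
  calc ‖complexifySeries P n‖ * (ρ : ℝ) ^ n ≤ 4 ^ n * (C * r ^ n) * (4 * r)⁻¹ ^ n := by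
        rw [hρr]
        gcongr
        exact (norm_complexifySeries_le P n).trans (by gcongr; exact h n)
    _ = C * ((4 * r) * (4 * r)⁻¹) ^ n := by simp only [mul_pow]; ring
    _ = C := by rw [mul_inv_cancel₀ (by positivity), one_pow, mul_one]

/-- A real-analytic germ extends to a holomorphic germ along `inclM`. -/
lemma AnalyticAt.exists_extension_inclM {f : (Fin 4 → ℝ) → ℂ} {p : Fin 4 → ℝ}
    (hf : AnalyticAt ℝ f p) :
    ∃ r > 0, ∃ ψ : (Fin 4 → ℂ) → ℂ, AnalyticOnNhd ℂ ψ (Metric.ball (inclM p) r) ∧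
      ∀ x ∈ Metric.ball p r, ψ (inclM x) = f x := by
  obtain ⟨P, R, hP⟩ := hf
  have hQ := (complexifySeries P).hasFPowerSeriesOnBall
    (complexifySeries_radius_pos hP.radius_pos)
  obtain ⟨r, hr0, hr⟩ := ENNReal.lt_iff_exists_nnreal_btwn.1 (lt_min hP.r_pos hQ.r_pos)
  have hrR := hr.le.trans (min_le_left _ _)
  have hrQ := hr.le.trans (min_le_right _ _)
  refine ⟨r, by exact_mod_cast hr0, fun z => (complexifySeries P).sum (z - inclM p), ?_, ?_⟩
  · intro z hz
    have hz' : z - inclM p ∈ Metric.eball (0 : Fin 4 → ℂ) (complexifySeries P).radius := by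
      refine Metric.eball_subset_eball hrQ ?_
      rw [Metric.eball_coe]
      simpa [dist_eq_norm] using hz
    exact AnalyticAt.fun_comp (hQ.analyticOnNhd _ hz') (by fun_prop)
  · intro x hx
    have hx' : x - p ∈ Metric.eball (0 : Fin 4 → ℝ) R := by
      refine Metric.eball_subset_eball hrR ?_
      rw [Metric.eball_coe]
      simpa [dist_eq_norm] using hx
    have hs := hP.hasSum hx'
    rw [add_sub_cancel] at hs
    rw [← hs.tsum_eq]
    simp only [← inclM_sub]
    exact tsum_congr fun n => complexifySeries_inclM P n _

lemma pd4_eq_of_eventuallyEq_comp_inclM {h : (Fin 4 → ℝ) → ℂ} {g : (Fin 4 → ℂ) → ℂ}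
    {x : Fin 4 → ℝ} (hg : DifferentiableAt ℂ g (inclM x))
    (hh : h =ᶠ[nhds x] fun y => g (inclM y)) (i : Fin 4) :
    pd4 h i x = wickFactor i * cd g i (inclM x) := by
  have hd : HasFDerivAt (fun y => g (inclM y))
      (((fderiv ℂ g (inclM x)).restrictScalars ℝ).comp inclMCLM) x :=
    HasFDerivAt.comp x (hg.hasFDerivAt.restrictScalars ℝ) inclMCLM.hasFDerivAt
  have hs : inclM (Pi.single i 1) = wickFactor i • (Pi.single i 1 : Fin 4 → ℂ) := by
    ext j
    rcases eq_or_ne j i with rfl | hj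
    · simp [inclM_apply]
    · simp [inclM_apply, hj]
  rw [pd4, hh.fderiv_eq, hd.fderiv, ContinuousLinearMap.comp_apply, inclMCLM_apply, hs,
    ContinuousLinearMap.coe_restrictScalars', map_smul, smul_eq_mul, cd]

lemma AnalyticOnNhd.cd {g : (Fin 4 → ℂ) → ℂ} {U : Set (Fin 4 → ℂ)} (hg : AnalyticOnNhd ℂ g U)
    (i : Fin 4) : AnalyticOnNhd ℂ (cd g i) U := fun z hz =>
  ((ContinuousLinearMap.apply ℂ ℂ (Pi.single i 1 : Fin 4 → ℂ)).analyticAt _).comp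
    (hg.fderiv z hz)

/-- A real-analytic function on an open set extends holomorphically along `inclM` to a union of
balls centred at real points. -/
lemma AnalyticOnNhd.exists_extension_inclM {f : (Fin 4 → ℝ) → ℂ} {A : Set (Fin 4 → ℝ)}
    (hA : IsOpen A) (hf : AnalyticOnNhd ℝ f A) :
    ∃ (r : (Fin 4 → ℝ) → ℝ) (φ : (Fin 4 → ℂ) → ℂ),
      (∀ p ∈ A, 0 < r p ∧ Metric.ball p (r p) ⊆ A ∧
        AnalyticOnNhd ℂ φ (Metric.ball (inclM p) (r p))) ∧
      ∀ x ∈ A, φ (inclM x) = f x := by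
  have hloc : ∀ p, ∃ (r : ℝ) (ψ : (Fin 4 → ℂ) → ℂ), p ∈ A → 0 < r ∧ Metric.ball p r ⊆ A ∧
      AnalyticOnNhd ℂ ψ (Metric.ball (inclM p) r) ∧
      ∀ x ∈ Metric.ball p r, ψ (inclM x) = f x := by
    intro p
    by_cases hp : p ∈ A
    · obtain ⟨r, hr, ψ, hψ, hψf⟩ := (hf p hp).exists_extension_inclM
      obtain ⟨s, hs, hsA⟩ := Metric.isOpen_iff.1 hA p hp
      exact ⟨min r s, ψ, fun _ => ⟨lt_min hr hs,
        (Metric.ball_subset_ball (min_le_right _ _)).trans hsA,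
        hψ.mono (Metric.ball_subset_ball (min_le_left _ _)),
        fun x hx => hψf x (Metric.ball_subset_ball (min_le_left _ _) hx)⟩⟩
    · exact ⟨0, 0, fun h => absurd h hp⟩
  choose r ψ hrψ using hloc
  have hagree : ∀ p ∈ A, ∀ q ∈ A, ∀ z ∈ Metric.ball (inclM p) (r p),
      z ∈ Metric.ball (inclM q) (r q) → ψ p z = ψ q z := by
    intro p hp q hq z hzp hzq
    obtain ⟨-, -, hap, hfp⟩ := hrψ p hp
    obtain ⟨-, -, haq, hfq⟩ := hrψ q hq
    refine sub_eq_zero.1 (eq_zero_of_eq_zero_on_inclM (g := fun z => ψ p z - ψ q z)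
      (Metric.isOpen_ball.inter Metric.isOpen_ball)
      ((convex_ball (inclM p) (r p)).inter (convex_ball (inclM q) (r q)))
      (fun w hw => ⟨inclM_wickRe_mem_ball hw.1, inclM_wickRe_mem_ball hw.2⟩) ?_ ?_ z ⟨hzp, hzq⟩)
    · exact (hap.differentiableOn.mono Set.inter_subset_left).sub
        (haq.differentiableOn.mono Set.inter_subset_right)
    · intro x hx
      rw [hfp x (inclM_mem_ball_iff.1 hx.1), hfq x (inclM_mem_ball_iff.1 hx.2), sub_self]
  classical
  let φ : (Fin 4 → ℂ) → ℂ := fun z =>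
    if h : ∃ p ∈ A, z ∈ Metric.ball (inclM p) (r p) then ψ h.choose z else 0
  have hφ : ∀ p ∈ A, Set.EqOn (ψ p) φ (Metric.ball (inclM p) (r p)) := by
    intro p hp z hz
    have h : ∃ p ∈ A, z ∈ Metric.ball (inclM p) (r p) := ⟨p, hp, hz⟩
    simp only [φ, dif_pos h]
    exact hagree p hp _ h.choose_spec.1 z hz h.choose_spec.2
  refine ⟨r, φ, fun p hp => ?_, fun x hx => ?_⟩
  · obtain ⟨h1, h2, h3, -⟩ := hrψ p hp
    exact ⟨h1, h2, h3.congr Metric.isOpen_ball (hφ p hp)⟩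
  · obtain ⟨h1, -, -, h4⟩ := hrψ x hx
    rw [← hφ x hx (Metric.mem_ball_self h1), h4 x (Metric.mem_ball_self h1)]

/-- any real-analytic Minkowski harmonic morphism on an open subset `A^M`
of `𝕄⁴` extends to a holomorphic complex-harmonic morphism on an open subset `A^C` of
`ℂ⁴` with `A^C ∩ ι_M(ℝ⁴) = ι_M(A^M)`. -/
theorem minkowski_harmonic_morphism_extends_to_complex
    (AM : Set (Fin 4 → ℝ)) (hAM : IsOpen AM)
    (f : (Fin 4 → ℝ) → ℂ)
    (hf_an : AnalyticOnNhd ℝ f AM)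
    (hf_wave : ∀ x ∈ AM,
      -pd4 (pd4 f 0) 0 x + pd4 (pd4 f 1) 1 x + pd4 (pd4 f 2) 2 x + pd4 (pd4 f 3) 3 x = 0)
    (hf_hwc : ∀ x ∈ AM,
      -(pd4 f 0 x) ^ 2 + (pd4 f 1 x) ^ 2 + (pd4 f 2 x) ^ 2 + (pd4 f 3 x) ^ 2 = 0) :
    ∃ (AC : Set (Fin 4 → ℂ)) (φ : (Fin 4 → ℂ) → ℂ),
      IsOpen AC ∧
      AC ∩ Set.range inclM = inclM '' AM ∧
      (∀ x ∈ AC, DifferentiableAt ℂ φ x) ∧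
      (∀ x ∈ AM, φ (inclM x) = f x) ∧
      (∀ x ∈ AC,
        cd (cd φ 0) 0 x + cd (cd φ 1) 1 x + cd (cd φ 2) 2 x + cd (cd φ 3) 3 x = 0) ∧
      (∀ x ∈ AC,
        (cd φ 0 x) ^ 2 + (cd φ 1 x) ^ 2 + (cd φ 2 x) ^ 2 + (cd φ 3 x) ^ 2 = 0) := by
  obtain ⟨r, φ, hr, hφf⟩ := hf_an.exists_extension_inclM hAM
  let AC : Set (Fin 4 → ℂ) := ⋃ p ∈ AM, Metric.ball (inclM p) (r p)
  have hballAC : ∀ p ∈ AM, Metric.ball (inclM p) (r p) ⊆ AC := fun p hp =>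
    Set.subset_biUnion_of_mem (u := fun p => Metric.ball (inclM p) (r p)) hp
  have hmemAC : ∀ z ∈ AC, ∃ p ∈ AM, z ∈ Metric.ball (inclM p) (r p) := fun z hz => by
    simpa only [AC, Set.mem_iUnion, exists_prop] using hz
  have hreal : ∀ x, inclM x ∈ AC → x ∈ AM := fun x hx => by
    obtain ⟨p, hp, hxp⟩ := hmemAC _ hx
    exact (hr p hp).2.1 (inclM_mem_ball_iff.1 hxp)
  have hAMAC : ∀ x ∈ AM, inclM x ∈ AC := fun x hx =>
    hballAC x hx (Metric.mem_ball_self (hr x hx).1)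
  have han : AnalyticOnNhd ℂ φ AC := fun z hz => by
    obtain ⟨p, hp, hzp⟩ := hmemAC z hz
    exact (hr p hp).2.2 z hzp
  have hzero : ∀ g : (Fin 4 → ℂ) → ℂ, AnalyticOnNhd ℂ g AC →
      (∀ x ∈ AM, g (inclM x) = 0) → ∀ z ∈ AC, g z = 0 := by
    intro g hg h0 z hz
    obtain ⟨p, hp, hzp⟩ := hmemAC z hz
    exact eq_zero_of_eq_zero_on_inclM Metric.isOpen_ball (convex_ball _ _)
      (fun w hw => inclM_wickRe_mem_ball hw) (hg.mono (hballAC p hp)).differentiableOn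
      (fun x hx => h0 x (hreal x (hballAC p hp hx))) z hzp
  have hd1 : ∀ i, ∀ x ∈ AM, pd4 f i x = wickFactor i * cd φ i (inclM x) := fun i x hx =>
    pd4_eq_of_eventuallyEq_comp_inclM (han _ (hAMAC x hx)).differentiableAt
      (by filter_upwards [hAM.mem_nhds hx] with y hy using (hφf y hy).symm) i
  have hd2 : ∀ i, ∀ x ∈ AM,
      pd4 (pd4 f i) i x = wickFactor i ^ 2 * cd (cd φ i) i (inclM x) := by
    intro i x hx
    have hdiff := (han.cd i _ (hAMAC x hx)).differentiableAt
    rw [pd4_eq_of_eventuallyEq_comp_inclM (g := fun z => wickFactor i * cd φ i z)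
      (hdiff.const_mul _) (by filter_upwards [hAM.mem_nhds hx] with y hy using hd1 i y hy) i,
      cd, fderiv_const_mul hdiff, smul_apply, smul_eq_mul, sq, mul_assoc]
    rfl
  have hw0 : wickFactor 0 ^ 2 = -1 := by simp [wickFactor]
  have hw : ∀ i : Fin 4, i ≠ 0 → wickFactor i = 1 := fun i hi => by simp [wickFactor, hi]
  refine ⟨AC, φ, isOpen_biUnion fun _ _ => Metric.isOpen_ball, ?_,
    fun z hz => (han z hz).differentiableAt, hφf, ?_, ?_⟩
  · ext z
    constructor
    · rintro ⟨hz, x, rfl⟩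
      exact ⟨x, hreal x hz, rfl⟩
    · rintro ⟨x, hx, rfl⟩
      exact ⟨hAMAC x hx, x, rfl⟩
  · refine hzero _ (((((han.cd 0).cd 0).add ((han.cd 1).cd 1)).add ((han.cd 2).cd 2)).add
      ((han.cd 3).cd 3)) fun x hx => ?_
    have := hf_wave x hx
    rw [hd2 0 x hx, hd2 1 x hx, hd2 2 x hx, hd2 3 x hx, hw0, hw 1 (by decide), hw 2 (by decide),
      hw 3 (by decide)] at this
    linear_combination this
  · refine hzero _ (((((han.cd 0).pow 2).add ((han.cd 1).pow 2)).add ((han.cd 2).pow 2)).add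
      ((han.cd 3).pow 2)) fun x hx => ?_
    have := hf_hwc x hx
    rw [hd1 0 x hx, hd1 1 x hx, hd1 2 x hx, hd1 3 x hx, mul_pow, hw0, hw 1 (by decide),
      hw 2 (by decide), hw 3 (by decide)] at this
    linear_combination this
end

section
/- Let A ⊆ ℝ⁴ be open and let μ : A → ℂ be twice continuously differentiable, satisfying on A the equations ∂μ/∂z̄₁ − μ·∂μ/∂z₂ = 0 and ∂μ/∂z̄₂ + μ·∂μ/∂z₁ = 0. Then μ satisfies Laplace's equation Σᵢ₌₀³ ∂²μ/∂xᵢ² = 0 and the horizontal weak conformality condition Σᵢ₌₀³ (∂μ/∂xᵢ)² = 0 on A; that is, μ is a Euclidean harmonic morphism. -/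
open Complex

/-- `∂/∂z₁ = ½(∂/∂x₀ − i ∂/∂x₁)`. -/
noncomputable def dz1 (f : (Fin 4 → ℝ) → ℂ) (x : Fin 4 → ℝ) : ℂ :=
  (pd4 f 0 x - Complex.I * pd4 f 1 x) / 2

/-- `∂/∂z̄₁ = ½(∂/∂x₀ + i ∂/∂x₁)`. -/
noncomputable def dz1b (f : (Fin 4 → ℝ) → ℂ) (x : Fin 4 → ℝ) : ℂ :=
  (pd4 f 0 x + Complex.I * pd4 f 1 x) / 2

/-- `∂/∂z₂ = ½(∂/∂x₂ − i ∂/∂x₃)`. -/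
noncomputable def dz2 (f : (Fin 4 → ℝ) → ℂ) (x : Fin 4 → ℝ) : ℂ :=
  (pd4 f 2 x - Complex.I * pd4 f 3 x) / 2

/-- `∂/∂z̄₂ = ½(∂/∂x₂ + i ∂/∂x₃)`. -/
noncomputable def dz2b (f : (Fin 4 → ℝ) → ℂ) (x : Fin 4 → ℝ) : ℂ :=
  (pd4 f 2 x + Complex.I * pd4 f 3 x) / 2

theorem pd4_differentiableAt {f : (Fin 4 → ℝ) → ℂ} {x : Fin 4 → ℝ}
    (hf : ContDiffAt ℝ 2 f x) (i : Fin 4) : DifferentiableAt ℝ (pd4 f i) x :=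
  ((hf.fderiv_right (m := 1) (by norm_num)).differentiableAt (by norm_num)).clm_apply
    (differentiableAt_const _)

/-- Partial derivatives of a `C²` map commute. -/
theorem pd4_pd4_comm {f : (Fin 4 → ℝ) → ℂ} {x : Fin 4 → ℝ}
    (hf : ContDiffAt ℝ 2 f x) (i j : Fin 4) :
    pd4 (pd4 f i) j x = pd4 (pd4 f j) i x := by
  have hd : DifferentiableAt ℝ (fderiv ℝ f) x :=
    (hf.fderiv_right (m := 1) (by norm_num)).differentiableAt (by norm_num)
  have hpd (a b : Fin 4) : pd4 (pd4 f a) b x =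
      fderiv ℝ (fderiv ℝ f) x (Pi.single b 1) (Pi.single a 1) := by
    change fderiv ℝ (fun y => fderiv ℝ f y (Pi.single a 1)) x (Pi.single b 1) = _
    rw [fderiv_clm_apply hd (differentiableAt_const _)]
    simp
  rw [hpd, hpd]
  exact hf.isSymmSndFDerivAt (by simp) _ _

theorem pd4_eq_zero_of_eventually {f : (Fin 4 → ℝ) → ℂ} {x : Fin 4 → ℝ}
    (hf : ∀ᶠ y in nhds x, f y = 0) (j : Fin 4) : pd4 f j x = 0 := by
  have h : f =ᶠ[nhds x] fun _ => 0 := hf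
  simp [pd4, h.fderiv_eq]

/-- Leibniz rule for the expression `(a + c b) + e m (p + d q)` with constants `c`, `d`, `e`. -/
theorem pd4_add_mul_combination {a b m p q : (Fin 4 → ℝ) → ℂ} {x : Fin 4 → ℝ} (c d e : ℂ)
    (ha : DifferentiableAt ℝ a x) (hb : DifferentiableAt ℝ b x) (hm : DifferentiableAt ℝ m x)
    (hp : DifferentiableAt ℝ p x) (hq : DifferentiableAt ℝ q x) (j : Fin 4) :
    pd4 (fun y => (a y + c * b y) + e * (m y * (p y + d * q y))) j x =
      (pd4 a j x + c * pd4 b j x) +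
        e * (pd4 m j x * (p x + d * q x) + m x * (pd4 p j x + d * pd4 q j x)) := by
  have h := ((ha.hasFDerivAt.add (hb.hasFDerivAt.const_mul c)).add
    ((hm.hasFDerivAt.mul (hp.hasFDerivAt.add (hq.hasFDerivAt.const_mul d))).const_mul e))
  have h' : fderiv ℝ (fun y => (a y + c * b y) + e * (m y * (p y + d * q y))) x = _ := h.fderiv
  simp only [pd4, h', Pi.add_apply, add_apply, smul_apply, smul_eq_mul]
  ring

/-- a `C²` solution of the Hermitian-structure equations
`∂μ/∂z̄₁ − μ ∂μ/∂z₂ = 0`, `∂μ/∂z̄₂ + μ ∂μ/∂z₁ = 0` on an open subset of `ℝ⁴` is a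
Euclidean harmonic morphism. -/
theorem hermitian_structure_equations_give_harmonic_morphism
    (A : Set (Fin 4 → ℝ)) (hA : IsOpen A)
    (μ : (Fin 4 → ℝ) → ℂ)
    (hμ_C2 : ContDiffOn ℝ 2 μ A)
    (hμ_eq1 : ∀ x ∈ A, dz1b μ x - μ x * dz2 μ x = 0)
    (hμ_eq2 : ∀ x ∈ A, dz2b μ x + μ x * dz1 μ x = 0) :
    ∀ x ∈ A,
      (pd4 (pd4 μ 0) 0 x + pd4 (pd4 μ 1) 1 x + pd4 (pd4 μ 2) 2 x + pd4 (pd4 μ 3) 3 x = 0) ∧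
      ((pd4 μ 0 x) ^ 2 + (pd4 μ 1 x) ^ 2 + (pd4 μ 2 x) ^ 2 + (pd4 μ 3 x) ^ 2 = 0) := by
  intro x hx
  have hAx : A ∈ nhds x := hA.mem_nhds hx
  have hC : ContDiffAt ℝ 2 μ x := hμ_C2.contDiffAt hAx
  have hd : DifferentiableAt ℝ μ x := hC.differentiableAt (by norm_num)
  have hp := pd4_differentiableAt hC
  have hI : I * I = -1 := I_mul_I
  constructor
  · have deriv_eq1 (j : Fin 4) := (pd4_add_mul_combination I (-I) (-1)
      (hp 0) (hp 1) hd (hp 2) (hp 3) j).symm.trans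
        (pd4_eq_zero_of_eventually (by
          filter_upwards [hAx] with y hy
          have := hμ_eq1 y hy
          simp only [dz1b, dz2] at this
          linear_combination 2 * this) j)
    have deriv_eq2 (j : Fin 4) := (pd4_add_mul_combination I (-I) 1
      (hp 2) (hp 3) hd (hp 0) (hp 1) j).symm.trans
        (pd4_eq_zero_of_eventually (by
          filter_upwards [hAx] with y hy
          have := hμ_eq2 y hy
          simp only [dz2b, dz1] at this
          linear_combination 2 * this) j)
    have e0 := deriv_eq1 0
    have e1 := deriv_eq1 1
    have e2 := deriv_eq2 2
    have e3 := deriv_eq2 3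
    rw [pd4_pd4_comm hC 1 0, pd4_pd4_comm hC 2 0, pd4_pd4_comm hC 3 0] at e0
    rw [pd4_pd4_comm hC 2 1, pd4_pd4_comm hC 3 1] at e1
    rw [pd4_pd4_comm hC 3 2] at e2
    linear_combination e0 - I * e1 + e2 - I * e3 +
      (pd4 (pd4 μ 1) 1 x + pd4 (pd4 μ 3) 3 x) * hI
  · have h1 := hμ_eq1 x hx
    have h2 := hμ_eq2 x hx
    simp only [dz1, dz1b, dz2, dz2b] at h1 h2
    linear_combination 2 * (pd4 μ 0 x - I * pd4 μ 1 x) * h1 +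
      2 * (pd4 μ 2 x - I * pd4 μ 3 x) * h2 + ((pd4 μ 1 x) ^ 2 + (pd4 μ 3 x) ^ 2) * hI
end

section
/- Let A⁴ ⊆ ℝ⁴ be open, and for each p ∈ A⁴ let J_p : ℝ⁴ → ℝ⁴ be a linear map preserving the Euclidean inner product with J_p∘J_p = −id. Let φ : A⁴ → ℂ be differentiable with dφ_p ≠ 0 for all p and satisfying the holomorphicity condition dφ_p(J_p v) = i·dφ_p(v) for all p ∈ A⁴ and v ∈ ℝ⁴. Set A³ = A⁴ ∩ {x₀ = 0} and suppose ∂φ/∂x₀ = 0 at every point of A³. Then the restriction f of φ to A³, regarded as a function of (x₁,x₂,x₃), satisfies at every point of A³: (i) the horizontal weak conformality condition (∂f/∂x₁)² + (∂f/∂x₂)² + (∂f/∂x₃)² = 0; (ii) the differential of f is surjective onto ℂ ≅ ℝ²; and (iii) dφ_p(J_p e₀) = 0, i.e. f is constant in the direction U_p = J_p e₀. -/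
open Complex

/-- The hyperplane inclusion `ℝ³ → ℝ⁴` as a continuous linear map. -/
noncomputable def incl3CLM : (Fin 3 → ℝ) →L[ℝ] (Fin 4 → ℝ) :=
  LinearMap.toContinuousLinearMap
    { toFun := incl3
      map_add' := fun x y => by
        ext i; refine Fin.cases ?_ (fun j => ?_) i <;> simp [incl3]
      map_smul' := fun c x => by
        ext i; refine Fin.cases ?_ (fun j => ?_) i <;> simp [incl3] }

theorem incl3CLM_apply (x : Fin 3 → ℝ) : incl3CLM x = incl3 x := rfl

theorem incl3_single (i : Fin 3) : incl3 (Pi.single i 1) = Pi.single i.succ 1 := by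
  ext j
  refine Fin.cases ?_ (fun k => ?_) j
  · simp [incl3, (Fin.succ_ne_zero i).symm]
  · simp [incl3, Pi.single_apply]

theorem fderiv_comp_incl3 {φ : (Fin 4 → ℝ) → ℂ} {y : Fin 3 → ℝ}
    (h : DifferentiableAt ℝ φ (incl3 y)) :
    fderiv ℝ (φ ∘ incl3) y = (fderiv ℝ φ (incl3 y)).comp incl3CLM :=
  (HasFDerivAt.comp y h.hasFDerivAt incl3CLM.hasFDerivAt).fderiv

/-- An orthogonal complex structure is skew-symmetric. -/
theorem orthogonal_complex_structure_skew {ι : Type*} [Fintype ι] {J : (ι → ℝ) →ₗ[ℝ] (ι → ℝ)}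
    (h_orth : ∀ v w : ι → ℝ, ∑ i, J v i * J w i = ∑ i, v i * w i)
    (h_sq : ∀ v, J (J v) = -v) (v w : ι → ℝ) :
    ∑ i, J v i * w i = -∑ i, v i * J w i := by
  rw [← h_orth (J v) w, h_sq]
  simp

/-- A complex covector that is holomorphic for an orthogonal complex structure is isotropic. -/
theorem sum_sq_eq_zero_of_holomorphic {ι : Type*} [Fintype ι] [DecidableEq ι]
    {J : (ι → ℝ) →ₗ[ℝ] (ι → ℝ)}
    (h_orth : ∀ v w : ι → ℝ, ∑ i, J v i * J w i = ∑ i, v i * w i)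
    (h_sq : ∀ v, J (J v) = -v) (L : (ι → ℝ) →ₗ[ℝ] ℂ) (hL : ∀ v, L (J v) = I * L v) :
    ∑ i, L (Pi.single i 1) ^ 2 = 0 := by
  set a : ι → ℂ := fun i => L (Pi.single i 1) with ha
  set M : ι → ι → ℝ := fun i j => J (Pi.single j 1) i with hM
  have hskew (i j : ι) : M i j = -M j i := by
    simpa [Pi.single_apply, hM] using
      orthogonal_complex_structure_skew h_orth h_sq (Pi.single j 1) (Pi.single i 1)
  have hcol (j : ι) : I * a j = ∑ i, (M i j : ℂ) * a i := by
    rw [← hL, LinearMap.pi_apply_eq_sum_univ L]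
    refine Finset.sum_congr rfl fun i _ => ?_
    rw [Complex.real_smul]
    congr 2
    ext k
    simp [Pi.single_apply, eq_comm]
  have hsum : I * ∑ j, a j ^ 2 = ∑ j, ∑ i, (M i j : ℂ) * a i * a j := by
    rw [Finset.mul_sum]
    refine Finset.sum_congr rfl fun j _ => ?_
    rw [← Finset.sum_mul, ← hcol]
    ring
  have hneg : ∑ j, ∑ i, (M i j : ℂ) * a i * a j = -∑ j, ∑ i, (M i j : ℂ) * a i * a j := by
    conv_lhs => rw [Finset.sum_comm]
    simp only [← Finset.sum_neg_distrib]
    refine Finset.sum_congr rfl fun j _ => Finset.sum_congr rfl fun i _ => ?_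
    rw [hskew j i]
    push_cast
    ring
  have hzero : I * ∑ j, a j ^ 2 = 0 := by
    rw [hsum]
    exact self_eq_neg.mp hneg
  exact (mul_eq_zero.mp hzero).resolve_left I_ne_zero

/-- A nonzero real-linear functional `L : V → ℂ` with `L ∘ J = i L` is onto. -/
theorem surjective_of_holomorphic {V : Type*} [AddCommGroup V] [Module ℝ V] {J : V → V}
    {L : V →ₗ[ℝ] ℂ} (hL : ∀ v, L (J v) = I * L v) (hne : L ≠ 0) : Function.Surjective L := by
  obtain ⟨v, hv⟩ : ∃ v, L v ≠ 0 := by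
    by_contra! h
    exact hne (LinearMap.ext h)
  intro z
  refine ⟨(z / L v).re • v + (z / L v).im • J v, ?_⟩
  rw [map_add, map_smul, map_smul, hL, real_smul, real_smul]
  calc _ = ((z / L v).re + (z / L v).im * I) * L v := by ring
    _ = z := by rw [re_add_im, div_mul_cancel₀ z hv]

theorem apply_incl3_tail {L : (Fin 4 → ℝ) →ₗ[ℝ] ℂ} (h : L (Pi.single 0 1) = 0)
    (v : Fin 4 → ℝ) : L (incl3 (Fin.tail v)) = L v := by
  have hv : v = incl3 (Fin.tail v) + v 0 • Pi.single 0 1 := by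
    ext i
    refine Fin.cases ?_ (fun j => ?_) i <;> simp [incl3, Fin.tail]
  conv_rhs => rw [hv, map_add, map_smul, h, smul_zero, add_zero]

/-- if `φ` is differentiable with nowhere-zero differential on an open
`A⁴ ⊆ ℝ⁴`, holomorphic with respect to a field of orthogonal complex structures `J`, and
`∂φ/∂x₀ = 0` on `A³ = A⁴ ∩ {x₀ = 0}`, then the restriction `f` of `φ` to `A³` is a
horizontally conformal submersion whose level sets are tangent to `U = J e₀`. -/
theorem holomorphic_restricts_to_horizontally_conformal
    (A4 : Set (Fin 4 → ℝ)) (hA4 : IsOpen A4)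
    (J : (Fin 4 → ℝ) → ((Fin 4 → ℝ) →ₗ[ℝ] (Fin 4 → ℝ)))
    (hJ_orth : ∀ p ∈ A4, ∀ v w : Fin 4 → ℝ,
      ∑ i : Fin 4, (J p v) i * (J p w) i = ∑ i : Fin 4, v i * w i)
    (hJ_sq : ∀ p ∈ A4, ∀ v : Fin 4 → ℝ, J p (J p v) = -v)
    (φ : (Fin 4 → ℝ) → ℂ)
    (hφ_diff : ∀ p ∈ A4, DifferentiableAt ℝ φ p)
    (hφ_nz : ∀ p ∈ A4, fderiv ℝ φ p ≠ 0)
    (hφ_hol : ∀ p ∈ A4, ∀ v : Fin 4 → ℝ,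
      fderiv ℝ φ p (J p v) = Complex.I * fderiv ℝ φ p v)
    (hφ_x0 : ∀ x ∈ A4, x 0 = 0 → pd4 φ 0 x = 0) :
    ∀ y : Fin 3 → ℝ, incl3 y ∈ A4 →
      ((pd3 (φ ∘ incl3) 0 y) ^ 2 + (pd3 (φ ∘ incl3) 1 y) ^ 2 +
        (pd3 (φ ∘ incl3) 2 y) ^ 2 = 0) ∧
      Function.Surjective (fderiv ℝ (φ ∘ incl3) y) ∧
      fderiv ℝ φ (incl3 y) (J (incl3 y) (Pi.single 0 1)) = 0 := by
  intro y hy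
  have h0 : fderiv ℝ φ (incl3 y) (Pi.single 0 1) = 0 := hφ_x0 _ hy rfl
  have hpd (i : Fin 3) :
      pd3 (φ ∘ incl3) i y = fderiv ℝ φ (incl3 y) (Pi.single i.succ 1) := by
    rw [pd3, fderiv_comp_incl3 (hφ_diff _ hy), ContinuousLinearMap.comp_apply, incl3CLM_apply,
      incl3_single]
  refine ⟨?_, fun z => ?_, ?_⟩
  · have h := sum_sq_eq_zero_of_holomorphic (hJ_orth _ hy) (hJ_sq _ hy)
      (fderiv ℝ φ (incl3 y)).toLinearMap (hφ_hol _ hy)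
    simp only [ContinuousLinearMap.coe_coe] at h
    rw [Fin.sum_univ_succ, h0, Fin.sum_univ_three] at h
    rw [hpd, hpd, hpd]
    linear_combination h
  · obtain ⟨v, hv⟩ := surjective_of_holomorphic (L := (fderiv ℝ φ (incl3 y)).toLinearMap)
      (hφ_hol _ hy) (fun h => hφ_nz _ hy (ContinuousLinearMap.coe_injective h)) z
    refine ⟨Fin.tail v, ?_⟩
    rw [fderiv_comp_incl3 (hφ_diff _ hy), ← hv]
    exact apply_incl3_tail (L := (fderiv ℝ φ (incl3 y)).toLinearMap) h0 v
  · rw [hφ_hol _ hy, h0, mul_zero]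
end

section
/- Let J : ℝ⁴ → ℝ⁴ be a linear map preserving the Euclidean inner product with J∘J = −id, and let L : ℝ⁴ → ℂ be a real-linear map satisfying L(J v) = i·L(v) for all v ∈ ℝ⁴. Then Σᵢ₌₀³ (L eᵢ)² = 0, where (e₀,e₁,e₂,e₃) is the standard orthonormal basis of ℝ⁴ (an identity of complex numbers). In particular, a map holomorphic with respect to an orthogonal complex structure on ℝ⁴ is horizontally weakly conformal. -/
open Complex

/-- if `J : ℝ⁴ → ℝ⁴` is an orthogonal linear map with `J² = −id` and
`L : ℝ⁴ → ℂ` is real-linear with `L ∘ J = i·L`, then `Σᵢ (L eᵢ)² = 0`: a map holomorphic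
with respect to an orthogonal complex structure is horizontally weakly conformal. -/
theorem holomorphic_implies_horizontally_weakly_conformal
    (J : (Fin 4 → ℝ) →ₗ[ℝ] (Fin 4 → ℝ))
    (hJ_orth : ∀ v w : Fin 4 → ℝ,
      ∑ i : Fin 4, (J v) i * (J w) i = ∑ i : Fin 4, v i * w i)
    (hJ_sq : ∀ v : Fin 4 → ℝ, J (J v) = -v)
    (L : (Fin 4 → ℝ) →ₗ[ℝ] ℂ)
    (hL : ∀ v : Fin 4 → ℝ, L (J v) = Complex.I * L v) :
    ∑ i : Fin 4, (L (Pi.single i 1)) ^ 2 = 0 := by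
  have skew : ∀ i j : Fin 4,
      (J (Pi.single j 1)) i = -(J (Pi.single i 1)) j := by
    intro i j
    have h := hJ_orth (J (Pi.single j 1)) (Pi.single i 1)
    simpa [hJ_sq, Pi.single_apply] using h.symm
  have eigen : ∀ j : Fin 4,
      I * L (Pi.single j 1) = ∑ i, ((J (Pi.single j 1)) i : ℂ) * L (Pi.single i 1) := by
    intro j
    rw [← hL]
    conv_lhs => rw [← Finset.univ_sum_single (J (Pi.single j 1)), map_sum]
    refine Finset.sum_congr rfl fun i _ => ?_
    rw [← Complex.real_smul, ← map_smul, ← Pi.single_smul, smul_eq_mul, mul_one]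
  have key : I * ∑ i : Fin 4, (L (Pi.single i 1)) ^ 2 =
      -(I * ∑ i : Fin 4, (L (Pi.single i 1)) ^ 2) := by
    have expand : I * ∑ j : Fin 4, (L (Pi.single j 1)) ^ 2 =
        ∑ j, ∑ i, ((J (Pi.single j 1)) i : ℂ) * L (Pi.single i 1) * L (Pi.single j 1) := by
      simp_rw [Finset.mul_sum, sq, ← mul_assoc, eigen, Finset.sum_mul]
    rw [expand]
    conv_lhs => rw [Finset.sum_comm]
    simp_rw [← Finset.sum_neg_distrib]
    refine Finset.sum_congr rfl fun i _ => Finset.sum_congr rfl fun j _ => ?_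
    rw [skew i j]
    push_cast
    ring
  exact (mul_eq_zero.mp (self_eq_neg.mp key)).resolve_left I_ne_zero
end

section
/- Let A = ℝ³ ∖ {(x₁,x₂,x₃) : x₂ = x₃ = 0 and x₁ ≥ 0}, and define f : A → ℂ by f(x₁,x₂,x₃) = (x₂ + i x₃)/(√(x₁² + x₂² + x₃²) − x₁). Then f is real-analytic on A and horizontally weakly conformal: (∂f/∂x₁)² + (∂f/∂x₂)² + (∂f/∂x₃)² = 0 at every point of A. (The level curves of f are the radii from the origin, giving a conformal foliation of A by curves.) -/
open Complex

theorem sq_sum_pos_and_lt_sqrt {x : Fin 3 → ℝ} (hx : ¬(x 1 = 0 ∧ x 2 = 0 ∧ 0 ≤ x 0)) :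
    0 < x 0 ^ 2 + x 1 ^ 2 + x 2 ^ 2 ∧ x 0 < Real.sqrt (x 0 ^ 2 + x 1 ^ 2 + x 2 ^ 2) := by
  rcases lt_or_ge (x 0) 0 with h0 | h0
  · have hpos : 0 < x 0 ^ 2 + x 1 ^ 2 + x 2 ^ 2 := by
      have := pow_pos (neg_pos.2 h0) 2
      nlinarith [sq_nonneg (x 1), sq_nonneg (x 2)]
    exact ⟨hpos, h0.trans_le (Real.sqrt_nonneg _)⟩
  · have hpos : 0 < x 1 ^ 2 + x 2 ^ 2 := by
      by_contra! h
      refine hx ⟨?_, ?_, h0⟩ <;> nlinarith [sq_nonneg (x 1), sq_nonneg (x 2)]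
    exact ⟨by nlinarith [sq_nonneg (x 0)], Real.lt_sqrt_of_sq_lt (by linarith)⟩

theorem pd3_radial_foliation {x : Fin 3 → ℝ} (hx : ¬(x 1 = 0 ∧ x 2 = 0 ∧ 0 ≤ x 0)) (i : Fin 3) :
    pd3 (fun x : Fin 3 → ℝ =>
        ((x 1 : ℂ) + Complex.I * (x 2 : ℂ)) /
          ((Real.sqrt ((x 0) ^ 2 + (x 1) ^ 2 + (x 2) ^ 2) : ℂ) - (x 0 : ℂ))) i x =
      ((((Pi.single i 1 : Fin 3 → ℝ) 1 : ℂ) + Complex.I * ((Pi.single i 1 : Fin 3 → ℝ) 2 : ℂ)) *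
          ((Real.sqrt ((x 0) ^ 2 + (x 1) ^ 2 + (x 2) ^ 2) : ℂ) - (x 0 : ℂ)) -
        ((x 1 : ℂ) + Complex.I * (x 2 : ℂ)) *
          ((x i : ℂ) / (Real.sqrt ((x 0) ^ 2 + (x 1) ^ 2 + (x 2) ^ 2) : ℂ) -
            ((Pi.single i 1 : Fin 3 → ℝ) 0 : ℂ))) /
        ((Real.sqrt ((x 0) ^ 2 + (x 1) ^ 2 + (x 2) ^ 2) : ℂ) - (x 0 : ℂ)) ^ 2 := by
  obtain ⟨hpos, hlt⟩ := sq_sum_pos_and_lt_sqrt hx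
  have hD : (Real.sqrt ((x 0) ^ 2 + (x 1) ^ 2 + (x 2) ^ 2) : ℂ) - (x 0 : ℂ) ≠ 0 := by
    rw [← Complex.ofReal_sub]
    exact_mod_cast (sub_pos.2 hlt).ne'
  have hr : (Real.sqrt ((x 0) ^ 2 + (x 1) ^ 2 + (x 2) ^ 2) : ℂ) ≠ 0 := by
    exact_mod_cast (Real.sqrt_pos.2 hpos).ne'
  have hc (j : Fin 3) : HasFDerivAt (fun y : Fin 3 → ℝ => y j)
      (ContinuousLinearMap.proj (R := ℝ) (φ := fun _ : Fin 3 => ℝ) j) x :=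
    hasFDerivAt_apply j x
  have hcC (j : Fin 3) := Complex.ofRealCLM.hasFDerivAt.comp x (hc j)
  have hs := Complex.ofRealCLM.hasFDerivAt.comp x
    (((((hc 0).pow 2).add ((hc 1).pow 2)).add ((hc 2).pow 2)).sqrt hpos.ne')
  have hf := ((hcC 1).add ((hcC 2).const_mul Complex.I)).mul 
    ((hasFDerivAt_inv' hD).comp x (hs.sub (hcC 0)))
  simp only [pd3, div_eq_mul_inv]
  refine (congrArg (fun L => L (Pi.single i 1)) hf.fderiv).trans ?_
  fin_cases i <;> simp <;> field_simp <;> ring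

/-- `f(x₁,x₂,x₃) = (x₂ + i x₃)/(|x| − x₁)` is real-analytic and
horizontally weakly conformal on the complement of the nonnegative `x₁`-axis; its level
curves are the radii from the origin. -/
theorem radial_foliation_horizontally_conformal :
    AnalyticOnNhd ℝ
      (fun x : Fin 3 → ℝ =>
        ((x 1 : ℂ) + Complex.I * (x 2 : ℂ)) /
          ((Real.sqrt ((x 0) ^ 2 + (x 1) ^ 2 + (x 2) ^ 2) : ℂ) - (x 0 : ℂ)))
      {x : Fin 3 → ℝ | ¬(x 1 = 0 ∧ x 2 = 0 ∧ 0 ≤ x 0)} ∧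
    ∀ x ∈ {x : Fin 3 → ℝ | ¬(x 1 = 0 ∧ x 2 = 0 ∧ 0 ≤ x 0)},
      (pd3 (fun x : Fin 3 → ℝ =>
        ((x 1 : ℂ) + Complex.I * (x 2 : ℂ)) /
          ((Real.sqrt ((x 0) ^ 2 + (x 1) ^ 2 + (x 2) ^ 2) : ℂ) - (x 0 : ℂ))) 0 x) ^ 2 +
      (pd3 (fun x : Fin 3 → ℝ =>
        ((x 1 : ℂ) + Complex.I * (x 2 : ℂ)) /
          ((Real.sqrt ((x 0) ^ 2 + (x 1) ^ 2 + (x 2) ^ 2) : ℂ) - (x 0 : ℂ))) 1 x) ^ 2 +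
      (pd3 (fun x : Fin 3 → ℝ =>
        ((x 1 : ℂ) + Complex.I * (x 2 : ℂ)) /
          ((Real.sqrt ((x 0) ^ 2 + (x 1) ^ 2 + (x 2) ^ 2) : ℂ) - (x 0 : ℂ))) 2 x) ^ 2 = 0 := by
  refine ⟨fun x hx => ?_, fun x hx => ?_⟩
  · obtain ⟨hpos, hlt⟩ := sq_sum_pos_and_lt_sqrt hx
    have hc (j : Fin 3) : AnalyticAt ℝ (fun y : Fin 3 → ℝ => y j) x :=
      (ContinuousLinearMap.proj (R := ℝ) (φ := fun _ : Fin 3 => ℝ) j).analyticAt x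
    have hofReal {g : (Fin 3 → ℝ) → ℝ} (hg : AnalyticAt ℝ g x) :
        AnalyticAt ℝ (fun y => (g y : ℂ)) x :=
      (Complex.ofRealCLM.analyticAt (g x)).comp hg
    have hsqrt : AnalyticAt ℝ
        (fun y : Fin 3 → ℝ => Real.sqrt ((y 0) ^ 2 + (y 1) ^ 2 + (y 2) ^ 2)) x :=
      AnalyticAt.fun_comp (g := Real.sqrt) (Real.contDiffAt_sqrt (n := ⊤) hpos.ne').analyticAt
        ((((hc 0).pow 2).add ((hc 1).pow 2)).add ((hc 2).pow 2))
    refine ((hofReal (hc 1)).add (analyticAt_const.mul (hofReal (hc 2)))).div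
      ((hofReal hsqrt).sub (hofReal (hc 0))) ?_
    exact sub_ne_zero.2 (Complex.ofReal_injective.ne hlt.ne')
  · obtain ⟨hpos, hlt⟩ := sq_sum_pos_and_lt_sqrt hx
    rw [pd3_radial_foliation hx, pd3_radial_foliation hx, pd3_radial_foliation hx]
    have hsq : (Real.sqrt ((x 0) ^ 2 + (x 1) ^ 2 + (x 2) ^ 2) : ℂ) ^ 2 =
        (x 0 : ℂ) ^ 2 + (x 1 : ℂ) ^ 2 + (x 2 : ℂ) ^ 2 := by
      exact_mod_cast Real.sq_sqrt hpos.le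
    have hr : (Real.sqrt ((x 0) ^ 2 + (x 1) ^ 2 + (x 2) ^ 2) : ℂ) ≠ 0 := by
      exact_mod_cast (Real.sqrt_pos.2 hpos).ne'
    have hD : (Real.sqrt ((x 0) ^ 2 + (x 1) ^ 2 + (x 2) ^ 2) : ℂ) - (x 0 : ℂ) ≠ 0 :=
      sub_ne_zero.2 (Complex.ofReal_injective.ne hlt.ne')
    generalize (Real.sqrt ((x 0) ^ 2 + (x 1) ^ 2 + (x 2) ^ 2) : ℂ) = r at *
    simp
    field_simp
    grind [Complex.I_sq]
end

section
/- Let A = {(x₀,x₁,x₂,x₃) ∈ ℝ⁴ : x₀² + x₂² + x₃² > 0} and define φ : A → ℂ by φ(x₀,x₁,x₂,x₃) = −i x₁ + √(x₀² + x₂² + x₃²). Then φ satisfies on A the hyperbolic harmonic morphism equations: x₀·(∂²φ/∂x₀² + ∂²φ/∂x₁² + ∂²φ/∂x₂² + ∂²φ/∂x₃²) − 2 ∂φ/∂x₀ = 0 and (∂φ/∂x₀)² + (∂φ/∂x₁)² + (∂φ/∂x₂)² + (∂φ/∂x₃)² = 0. -/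
open Complex

/-- The map `φ(x₀,x₁,x₂,x₃) = −i x₁ + √(x₀² + x₂² + x₃²)`. -/
noncomputable def φex17 (x : Fin 4 → ℝ) : ℂ :=
  -Complex.I * (x 1 : ℂ) + (Real.sqrt ((x 0) ^ 2 + (x 2) ^ 2 + (x 3) ^ 2) : ℂ)

/-- The Euclidean distance from `x` to the `x₁`-axis. -/
noncomputable def axisDist (x : Fin 4 → ℝ) : ℝ :=
  Real.sqrt ((x 0) ^ 2 + (x 2) ^ 2 + (x 3) ^ 2)

/-- The differential of `axisDist` at a point off the `x₁`-axis. -/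
noncomputable def axisDistDeriv (x : Fin 4 → ℝ) : (Fin 4 → ℝ) →L[ℝ] ℝ :=
  (axisDist x)⁻¹ • (x 0 • ContinuousLinearMap.proj 0 + x 2 • ContinuousLinearMap.proj 2 +
    x 3 • ContinuousLinearMap.proj 3)

lemma hasFDerivAt_axisDist {x : Fin 4 → ℝ} (hx : 0 < (x 0) ^ 2 + (x 2) ^ 2 + (x 3) ^ 2) :
    HasFDerivAt axisDist (axisDistDeriv x) x := by
  have hp (i : Fin 4) := hasFDerivAt_apply (𝕜 := ℝ) i x
  have h := ((((hp 0).pow 2).add ((hp 2).pow 2)).add ((hp 3).pow 2)).sqrt hx.ne'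
  refine h.congr_fderiv ?_
  ext v
  simp [axisDistDeriv, axisDist]
  ring

lemma axisDistDeriv_single (x : Fin 4 → ℝ) {i : Fin 4} (hi : i ≠ 1) :
    axisDistDeriv x (Pi.single i 1) = x i / axisDist x := by
  fin_cases i <;> simp_all [axisDistDeriv, div_eq_inv_mul]

lemma axisDistDeriv_single_one (x : Fin 4 → ℝ) :
    axisDistDeriv x (Pi.single 1 1) = 0 := by
  simp [axisDistDeriv]

lemma pd4_φex17 {x : Fin 4 → ℝ} (hx : 0 < (x 0) ^ 2 + (x 2) ^ 2 + (x 3) ^ 2) (i : Fin 4) :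
    pd4 φex17 i x =
      -Complex.I * ((Pi.single i 1 : Fin 4 → ℝ) 1 : ℂ) + (axisDistDeriv x (Pi.single i 1) : ℂ) := by
  have h1 := (Complex.ofRealCLM.hasFDerivAt.comp x
    (hasFDerivAt_apply (𝕜 := ℝ) (1 : Fin 4) x)).const_mul (-Complex.I)
  have h2 := Complex.ofRealCLM.hasFDerivAt.comp x (hasFDerivAt_axisDist hx)
  have h : HasFDerivAt φex17 _ x := h1.add h2
  rw [pd4, h.fderiv]
  simp

lemma pd4_φex17_of_ne {x : Fin 4 → ℝ} (hx : 0 < (x 0) ^ 2 + (x 2) ^ 2 + (x 3) ^ 2)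
    {i : Fin 4} (hi : i ≠ 1) : pd4 φex17 i x = ((x i / axisDist x : ℝ) : ℂ) := by
  rw [pd4_φex17 hx, axisDistDeriv_single x hi, Pi.single_eq_of_ne hi.symm]
  simp

lemma pd4_φex17_one {x : Fin 4 → ℝ} (hx : 0 < (x 0) ^ 2 + (x 2) ^ 2 + (x 3) ^ 2) :
    pd4 φex17 1 x = -Complex.I := by
  rw [pd4_φex17 hx, axisDistDeriv_single_one, Pi.single_eq_same]
  simp

lemma eventually_off_axis {x : Fin 4 → ℝ} (hx : 0 < (x 0) ^ 2 + (x 2) ^ 2 + (x 3) ^ 2) :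
    ∀ᶠ y in nhds x, 0 < (y 0) ^ 2 + (y 2) ^ 2 + (y 3) ^ 2 :=
  (isOpen_lt continuous_const (by fun_prop)).mem_nhds hx

lemma axisDist_pos {x : Fin 4 → ℝ} (hx : 0 < (x 0) ^ 2 + (x 2) ^ 2 + (x 3) ^ 2) :
    0 < axisDist x :=
  Real.sqrt_pos.2 hx

lemma pd4_pd4_φex17_of_ne {x : Fin 4 → ℝ} (hx : 0 < (x 0) ^ 2 + (x 2) ^ 2 + (x 3) ^ 2)
    {i : Fin 4} (hi : i ≠ 1) :
    pd4 (pd4 φex17 i) i x = (((axisDist x ^ 2 - x i ^ 2) / axisDist x ^ 3 : ℝ) : ℂ) := by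
  have he : pd4 φex17 i =ᶠ[nhds x] fun y => ((y i * (axisDist y)⁻¹ : ℝ) : ℂ) :=
    (eventually_off_axis hx).mono fun y hy => by
      rw [pd4_φex17_of_ne hy hi, div_eq_mul_inv]
  have hr := (axisDist_pos hx).ne'
  have h : HasFDerivAt (fun y : Fin 4 → ℝ => ((y i * (axisDist y)⁻¹ : ℝ) : ℂ)) _ x :=
    Complex.ofRealCLM.hasFDerivAt.comp x
      ((hasFDerivAt_apply (𝕜 := ℝ) i x).mul
        ((hasDerivAt_inv hr).comp_hasFDerivAt x (hasFDerivAt_axisDist hx)))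
  rw [pd4, he.fderiv_eq, h.fderiv]
  simp [axisDistDeriv_single x hi]
  have hc : (axisDist x : ℂ) ≠ 0 := by exact_mod_cast hr
  field_simp
  ring

lemma pd4_pd4_φex17_one {x : Fin 4 → ℝ} (hx : 0 < (x 0) ^ 2 + (x 2) ^ 2 + (x 3) ^ 2) :
    pd4 (pd4 φex17 1) 1 x = 0 := by
  have he : pd4 φex17 1 =ᶠ[nhds x] fun _ => -Complex.I :=
    (eventually_off_axis hx).mono fun y hy => pd4_φex17_one hy
  rw [pd4, he.fderiv_eq]
  simp

/-- `φ = −i x₁ + √(x₀² + x₂² + x₃²)` satisfies the hyperbolic harmonic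
morphism equations on `{x₀² + x₂² + x₃² > 0}`. -/
theorem circles_hyperbolic_harmonic_morphism :
    ∀ x ∈ {x : Fin 4 → ℝ | 0 < (x 0) ^ 2 + (x 2) ^ 2 + (x 3) ^ 2},
      ((x 0 : ℂ) * (pd4 (pd4 φex17 0) 0 x + pd4 (pd4 φex17 1) 1 x +
          pd4 (pd4 φex17 2) 2 x + pd4 (pd4 φex17 3) 3 x) - 2 * pd4 φex17 0 x = 0) ∧
      ((pd4 φex17 0 x) ^ 2 + (pd4 φex17 1 x) ^ 2 +
        (pd4 φex17 2 x) ^ 2 + (pd4 φex17 3 x) ^ 2 = 0) := by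
  intro x hx
  have hx' : 0 < (x 0) ^ 2 + (x 2) ^ 2 + (x 3) ^ 2 := hx
  have hc : (axisDist x : ℂ) ≠ 0 := by exact_mod_cast (axisDist_pos hx').ne'
  have hsq : (axisDist x : ℂ) ^ 2 = (x 0 : ℂ) ^ 2 + (x 2 : ℂ) ^ 2 + (x 3 : ℂ) ^ 2 := by
    exact_mod_cast Real.sq_sqrt hx'.le
  have h0 : (0 : Fin 4) ≠ 1 := by decide
  have h2 : (2 : Fin 4) ≠ 1 := by decide
  have h3 : (3 : Fin 4) ≠ 1 := by decide
  rw [pd4_pd4_φex17_of_ne hx' h0, pd4_pd4_φex17_of_ne hx' h2, pd4_pd4_φex17_of_ne hx' h3,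
    pd4_pd4_φex17_one hx', pd4_φex17_of_ne hx' h0, pd4_φex17_of_ne hx' h2,
    pd4_φex17_of_ne hx' h3, pd4_φex17_one hx']
  push_cast
  constructor
  · field_simp
    linear_combination (x 0 : ℂ) * hsq
  · rw [neg_sq, Complex.I_sq]
    field_simp
    linear_combination -hsq
end

section
/- Let c, s ∈ ℝ, let A = {(x₁,x₂,x₃) ∈ ℝ³ : x₂² + x₃² > 0}, and define φ : A → ℂ by φ(x₁,x₂,x₃) = −((x₁+c)² + x₂² + x₃² − s² + 2i(x₁+c)s)/(x₂ + i x₃). Then φ is horizontally weakly conformal on A: (∂φ/∂x₁)² + (∂φ/∂x₂)² + (∂φ/∂x₃)² = 0 at every point of A. (For s ≠ 0 the level curves of φ are the circles of Villarceau, giving a conformal foliation of A by circles.) -/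
open Complex

/-- The Villarceau-circles map
`φ(x₁,x₂,x₃) = −((x₁+c)² + x₂² + x₃² − s² + 2i(x₁+c)s)/(x₂ + i x₃)`. -/
noncomputable def φVill (c s : ℝ) (x : Fin 3 → ℝ) : ℂ :=
  -((((x 0 + c) ^ 2 + (x 1) ^ 2 + (x 2) ^ 2 - s ^ 2 : ℝ) : ℂ) +
      2 * Complex.I * ((x 0 + c : ℝ) : ℂ) * (s : ℂ)) /
    ((x 1 : ℂ) + Complex.I * (x 2 : ℂ))

/-- The complexified coordinate `x ↦ (x i : ℂ)` as a real-linear map. -/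
noncomputable def complexCoord (i : Fin 3) : (Fin 3 → ℝ) →L[ℝ] ℂ :=
  Complex.ofRealCLM.comp (ContinuousLinearMap.proj i)

theorem hasFDerivAt_complexCoord (i : Fin 3) (x : Fin 3 → ℝ) :
    HasFDerivAt (fun y : Fin 3 → ℝ => (y i : ℂ)) (complexCoord i) x :=
  (complexCoord i).hasFDerivAt

theorem φVill_eq (c s : ℝ) (x : Fin 3 → ℝ) :
    φVill c s x =
      -(((x 0 : ℂ) + (c + s * I)) ^ 2 + ((x 1 : ℂ) + I * x 2) * ((x 1 : ℂ) - I * x 2)) *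
        ((x 1 : ℂ) + I * x 2)⁻¹ := by
  rw [φVill, div_eq_mul_inv]
  congr 2
  push_cast
  linear_combination ((x 2 : ℂ) ^ 2 - (s : ℂ) ^ 2) * I_sq

theorem ofReal_add_I_mul_ofReal_ne_zero {a b : ℝ} (h : 0 < a ^ 2 + b ^ 2) :
    (a : ℂ) + I * b ≠ 0 := by
  intro h0
  have ha : a = 0 := by simpa using congrArg Complex.re h0
  have hb : b = 0 := by simpa using congrArg Complex.im h0
  simp [ha, hb] at h

/-- The derivative of `φVill c s` away from the axis, as a combination of coordinate forms:
with `q = x₁ + c + i s` and `w = x₂ + i x₃`, one has `dφ = -(2 q / w) dq + (q² / w²) dw - dw̄`. -/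
theorem hasFDerivAt_φVill (c s : ℝ) {x : Fin 3 → ℝ} (hw : (x 1 : ℂ) + I * x 2 ≠ 0) :
    HasFDerivAt (φVill c s)
      ((-(2 * ((x 0 : ℂ) + (c + s * I)) / ((x 1 : ℂ) + I * x 2))) • complexCoord 0 +
        (((x 0 : ℂ) + (c + s * I)) ^ 2 / ((x 1 : ℂ) + I * x 2) ^ 2) •
          (complexCoord 1 + I • complexCoord 2) -
        (complexCoord 1 - I • complexCoord 2)) x := by
  have hq := (hasFDerivAt_complexCoord 0 x).add_const (c + s * I : ℂ)
  have hI := (hasFDerivAt_complexCoord 2 x).const_mul I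
  have hp := (hasFDerivAt_complexCoord 1 x).add hI
  have hm := (hasFDerivAt_complexCoord 1 x).sub hI
  have hinv := (hasDerivAt_inv hw).comp_hasFDerivAt x hp
  have h := (((hq.pow 2).add (hp.mul hm)).neg).mul hinv
  refine (h.congr_fderiv ?_).congr_of_eventuallyEq (.of_forall (φVill_eq c s))
  ext v
  simp
  field_simp
  ring

/-- for all real `c, s`, the map `φVill c s` is horizontally weakly
conformal on `{x₂² + x₃² > 0}`; for `s ≠ 0` its level curves are the circles of
Villarceau. -/
theorem villarceau_horizontally_conformal (c s : ℝ) :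
    ∀ x ∈ {x : Fin 3 → ℝ | 0 < (x 1) ^ 2 + (x 2) ^ 2},
      (pd3 (φVill c s) 0 x) ^ 2 + (pd3 (φVill c s) 1 x) ^ 2 +
        (pd3 (φVill c s) 2 x) ^ 2 = 0 := by
  intro x hx
  have hw := ofReal_add_I_mul_ofReal_ne_zero hx
  simp only [pd3, (hasFDerivAt_φVill c s hw).fderiv]
  simp [complexCoord]
  field_simp
  linear_combination
    (((x 0 : ℂ) + (c + s * I)) ^ 2 + ((x 1 : ℂ) + I * x 2) ^ 2) ^ 2 * I_sq
end
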